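/- Let n ≥ 2 and l ≥ 2 be integers, let Ω ⊂ ℝ^n be a bounded connected open set with smooth boundary, and for k ≥ 1 let Λ_k denote the k-th eigenvalue of the buckling problem of order l on Ω (defined variationally as in the context). Set C = 2l² + (n−4)l + 2 − n. Then for every k ≥ 1, Λ_{k+1} ≤ (1 + 2C/n²)·(1/k)Σ_{i=1}^k Λ_i + { [ (2C/n²)·(1/k)Σ_{i=1}^k Λ_i ]² − (1 + 4C/n²)·(1/k)Σ_{i=1}^k (Λ_i − (1/k)Σ_{j=1}^k Λ_j)² }^{1/2}. -/

import Mathlib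

open MeasureTheory

/-- The Euclidean Laplacian of a function on `ℝⁿ`. -/
noncomputable def lap {n : ℕ} (f : EuclideanSpace ℝ (Fin n) → ℝ) : EuclideanSpace ℝ (Fin n) → ℝ :=
  fun x => ∑ i : Fin n,
    fderiv ℝ (fun y => fderiv ℝ f y (EuclideanSpace.single i 1)) x (EuclideanSpace.single i 1)

/-- The negative Euclidean Laplacian. -/
noncomputable def negLap {n : ℕ} (f : EuclideanSpace ℝ (Fin n) → ℝ) :
    EuclideanSpace ℝ (Fin n) → ℝ :=
  fun x => -(lap f x)

/-- The `k`-th eigenvalue of the buckling problem of order `l` on `Ω ⊆ ℝⁿ`, defined via the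
Courant min–max principle: the infimum over `k`-dimensional subspaces `V` of smooth functions
compactly supported in `Ω` of the supremum of the Rayleigh quotient
`(∫ φ (−Δ)^l φ) / (∫ |∇φ|²)` over nonzero `φ ∈ V`. -/
noncomputable def bucklingEigenvalue (n l : ℕ) (Ω : Set (EuclideanSpace ℝ (Fin n))) (k : ℕ) :
    ℝ :=
  sInf { r : ℝ | ∃ V : Submodule ℝ (EuclideanSpace ℝ (Fin n) → ℝ),
    Module.finrank ℝ V = k ∧
    (∀ f ∈ V, ContDiff ℝ (⊤ : ℕ∞) f ∧ HasCompactSupport f ∧ tsupport f ⊆ Ω) ∧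
    r = sSup { s : ℝ | ∃ φ ∈ V, φ ≠ 0 ∧
      s = (∫ x, φ x * (negLap^[l] φ) x) / (∫ x, ‖gradient φ x‖ ^ 2) } }

/-- Skew-symmetric commuting operators `d α` and symmetric bounded operators `x α` on a real inner
product space satisfying the canonical commutation relations. -/
structure WeylRep (n : ℕ) (T : Type*) [NormedAddCommGroup T] [InnerProductSpace ℝ T] where
  /-- the partial derivatives -/
  d : Fin n → Module.End ℝ T
  /-- the multiplications by the coordinates -/
  x : Fin n → Module.End ℝ T
  /-- a bound for the coordinates -/
  R : ℝ
  R_nonneg : 0 ≤ R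
  d_skew : ∀ α f g, inner ℝ (d α f) g = -inner ℝ f (d α g)
  x_symm : ∀ α f g, inner ℝ (x α f) g = inner ℝ f (x α g)
  d_comm : ∀ α β f, d α (d β f) = d β (d α f)
  d_x : ∀ α β f, d α (x β f) = x β (d α f) + if α = β then f else 0
  x_bound : ∀ α f, ‖x α f‖ ≤ R * ‖f‖

namespace WeylRep

variable {n : ℕ} {T : Type*} [NormedAddCommGroup T] [InnerProductSpace ℝ T] (W : WeylRep n T)

/-- The negative Laplacian. -/
noncomputable def B : Module.End ℝ T := -∑ α, W.d α * W.d α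

/-- The bilinear form of the `s`-th power of the negative Laplacian. -/
noncomputable def Q (s : ℕ) (f g : T) : ℝ := inner ℝ ((W.B ^ s) f) g

lemma B_apply (f : T) : W.B f = -∑ α, W.d α (W.d α f) := by
  simp [B]

lemma B_pow_succ (s : ℕ) (f : T) : (W.B ^ (s + 1)) f = W.B ((W.B ^ s) f) := by
  rw [pow_succ', Module.End.mul_apply]

lemma B_pow_succ' (s : ℕ) (f : T) : (W.B ^ (s + 1)) f = (W.B ^ s) (W.B f) := by
  rw [pow_succ, Module.End.mul_apply]

lemma B_d (α : Fin n) (f : T) : W.B (W.d α f) = W.d α (W.B f) := by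
  simp only [B_apply, map_neg, map_sum]
  congr 1
  refine Finset.sum_congr rfl fun β _ => ?_
  rw [W.d_comm β α f, W.d_comm β α]

lemma B_pow_d (s : ℕ) (α : Fin n) (f : T) : (W.B ^ s) (W.d α f) = W.d α ((W.B ^ s) f) := by
  induction s with
  | zero => simp
  | succ s ih => rw [B_pow_succ, ih, B_d, B_pow_succ]

lemma B_inner (f g : T) : inner ℝ (W.B f) g = ∑ α, inner ℝ (W.d α f) (W.d α g) := by
  simp only [B_apply, inner_neg_left, sum_inner, W.d_skew _ (W.d _ f) g, Finset.sum_neg_distrib,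
    neg_neg]

lemma B_symm (f g : T) : inner ℝ (W.B f) g = inner ℝ f (W.B g) := by
  rw [B_inner, real_inner_comm, B_inner]
  exact Finset.sum_congr rfl fun α _ => real_inner_comm _ _

lemma B_pow_symm (s : ℕ) (f g : T) : inner ℝ ((W.B ^ s) f) g = inner ℝ f ((W.B ^ s) g) := by
  induction s generalizing f g with
  | zero => simp
  | succ s ih => rw [B_pow_succ, B_symm, ih, B_pow_succ']

lemma Q_comm (s : ℕ) (f g : T) : W.Q s f g = W.Q s g f := by
  rw [Q, B_pow_symm, Q, real_inner_comm]

lemma Q_add_left (s : ℕ) (f g h : T) : W.Q s (f + g) h = W.Q s f h + W.Q s g h := by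
  simp [Q, inner_add_left]

lemma Q_smul_left (s : ℕ) (c : ℝ) (f h : T) : W.Q s (c • f) h = c * W.Q s f h := by
  simp [Q, inner_smul_left]

lemma Q_neg_left (s : ℕ) (f h : T) : W.Q s (-f) h = -W.Q s f h := by
  simp [Q]

lemma Q_sub_left (s : ℕ) (f g h : T) : W.Q s (f - g) h = W.Q s f h - W.Q s g h := by
  simp [Q, inner_sub_left]

lemma Q_sum_left {ι : Type*} (S : Finset ι) (s : ℕ) (f : ι → T) (h : T) :
    W.Q s (∑ i ∈ S, f i) h = ∑ i ∈ S, W.Q s (f i) h := by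
  simp [Q, sum_inner]

lemma Q_add_right (s : ℕ) (f g h : T) : W.Q s f (g + h) = W.Q s f g + W.Q s f h := by
  simp [Q, inner_add_right]

lemma Q_smul_right (s : ℕ) (c : ℝ) (f h : T) : W.Q s f (c • h) = c * W.Q s f h := by
  simp [Q, inner_smul_right]

lemma Q_sub_right (s : ℕ) (f g h : T) : W.Q s f (g - h) = W.Q s f g - W.Q s f h := by
  simp [Q, inner_sub_right]

lemma Q_sum_right {ι : Type*} (S : Finset ι) (s : ℕ) (f : ι → T) (h : T) :
    W.Q s h (∑ i ∈ S, f i) = ∑ i ∈ S, W.Q s h (f i) := by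
  simp [Q, inner_sum]

lemma Q_zero (f g : T) : W.Q 0 f g = inner ℝ f g := by simp [Q]

lemma Q_one (f g : T) : W.Q 1 f g = ∑ α, inner ℝ (W.d α f) (W.d α g) := by
  simp [Q, B_inner]

lemma Q_B_left (s : ℕ) (f g : T) : W.Q s (W.B f) g = W.Q (s + 1) f g := by
  rw [Q, Q, B_pow_succ']

lemma Q_B_right (s : ℕ) (f g : T) : W.Q s f (W.B g) = W.Q (s + 1) f g := by
  rw [Q_comm, Q_B_left, Q_comm]

lemma Q_d_d (s : ℕ) (f g : T) : ∑ α, W.Q s (W.d α f) (W.d α g) = W.Q (s + 1) f g := by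
  simp only [Q, B_pow_d]
  rw [B_pow_succ, B_inner]

lemma Q_self_nonneg (s : ℕ) (f : T) : 0 ≤ W.Q s f f := by
  induction s using Nat.twoStepInduction generalizing f with
  | zero => simp [Q]
  | one => rw [Q_one]; exact Finset.sum_nonneg fun α _ => real_inner_self_nonneg
  | more s ih _ => rw [← Q_B_left, ← Q_B_right]; exact ih _

lemma Q_d_le (s : ℕ) (α : Fin n) (f : T) : W.Q s (W.d α f) (W.d α f) ≤ W.Q (s + 1) f f := by
  rw [← Q_d_d]
  exact Finset.single_le_sum (f := fun α => W.Q s (W.d α f) (W.d α f))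
    (fun α _ => W.Q_self_nonneg s _) (Finset.mem_univ α)

lemma Q_cauchy_schwarz (s : ℕ) (f g : T) : W.Q s f g ^ 2 ≤ W.Q s f f * W.Q s g g := by
  have h : ∀ c : ℝ, 0 ≤ W.Q s g g * (c * c) + 2 * W.Q s f g * c + W.Q s f f := by
    intro c
    have := W.Q_self_nonneg s (f + c • g)
    simp only [Q_add_left, Q_add_right, Q_smul_left, Q_smul_right, W.Q_comm s g f] at this
    linarith
  have := discrim_le_zero h
  rw [discrim] at this
  linarith

lemma Q_log_convex (s : ℕ) (f : T) :
    W.Q (s + 1) f f ^ 2 ≤ W.Q s f f * W.Q (s + 2) f f := by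
  have := W.Q_cauchy_schwarz s f (W.B f)
  rwa [Q_B_right, Q_B_right, Q_B_left] at this

end WeylRep

namespace WeylRep

variable {n : ℕ} {T : Type*} [NormedAddCommGroup T] [InnerProductSpace ℝ T] (W : WeylRep n T)

lemma B_x (β : Fin n) (f : T) : W.B (W.x β f) = W.x β (W.B f) - (2 : ℝ) • W.d β f := by
  have h : ∀ α, W.d α (W.d α (W.x β f)) =
      W.x β (W.d α (W.d α f)) + if α = β then (2 : ℝ) • W.d β f else 0 := by
    intro α
    rw [W.d_x, map_add, W.d_x]
    split_ifs with hc
    · subst hc; rw [two_smul]; abel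
    · simp
  simp only [B_apply, h, Finset.sum_add_distrib, Finset.sum_ite_eq', Finset.mem_univ, if_true,
    map_neg, map_sum]
  abel

lemma B_pow_succ_x (s : ℕ) (β : Fin n) (f : T) :
    (W.B ^ (s + 1)) (W.x β f) =
      W.x β ((W.B ^ (s + 1)) f) - (2 * (s + 1) : ℝ) • W.d β ((W.B ^ s) f) := by
  induction s with
  | zero => simp [B_x]
  | succ s ih =>
    rw [B_pow_succ, ih, map_sub, map_smul, B_x, B_d, ← B_pow_succ, ← B_pow_succ]
    push_cast
    rw [sub_sub, ← add_smul]
    congr 2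
    ring

lemma Q_x_left (s : ℕ) (β : Fin n) (f g : T) :
    W.Q (s + 1) (W.x β f) g = W.Q (s + 1) f (W.x β g) - 2 * (s + 1) * W.Q s (W.d β f) g := by
  rw [Q, B_pow_succ_x, inner_sub_left, W.x_symm, inner_smul_left, ← B_pow_d]
  simp [Q]

lemma Q_d_left (s : ℕ) (β : Fin n) (f g : T) : W.Q s (W.d β f) g = -W.Q s f (W.d β g) := by
  rw [Q, B_pow_d, W.d_skew, Q]

lemma two_mul_sum_Q_d_x (s : ℕ) (f : T) :
    2 * ∑ α, W.Q s (W.d α f) (W.x α f) = -(n + 2 * s) * W.Q s f f := by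
  have h1 : ∀ α, W.Q s (W.d α f) (W.x α f) = -W.Q s (W.x α (W.d α f)) f - W.Q s f f := by
    intro α
    rw [Q_d_left, W.d_x, if_pos rfl, Q_add_right, W.Q_comm s f (W.x α _)]
    ring
  have h2 : ∑ α, W.Q s (W.x α (W.d α f)) f =
      ∑ α, W.Q s (W.d α f) (W.x α f) + 2 * s * W.Q s f f := by
    cases s with
    | zero => simp [Q_zero, W.x_symm]
    | succ s =>
      simp only [Q_x_left, Finset.sum_sub_distrib, ← Finset.mul_sum, W.Q_d_left s _ (W.d _ f),
        Finset.sum_neg_distrib, Q_d_d]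
      push_cast
      ring
  have h3 : ∑ α, W.Q s (W.d α f) (W.x α f) =
      -∑ α, W.Q s (W.x α (W.d α f)) f - n * W.Q s f f := by
    rw [Finset.sum_congr rfl fun α _ => h1 α, Finset.sum_sub_distrib, Finset.sum_neg_distrib]
    simp
  linarith

lemma sum_Q_x_x (s : ℕ) (f : T) :
    ∑ α, W.Q (s + 1) (W.x α f) (W.x α f) =
      W.Q (s + 1) f (∑ α, W.x α (W.x α f)) + (s + 1) * (n + 2 * s) * W.Q s f f := by
  have h := W.two_mul_sum_Q_d_x s f
  simp only [Q_x_left, Finset.sum_sub_distrib, ← Finset.mul_sum, Q_sum_right]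
  linear_combination (-(s + 1) : ℝ) * h

lemma Q_zero_le [NeZero n] (f : T) : W.Q 0 f f ≤ 4 * W.R ^ 2 * W.Q 1 f f := by
  set α : Fin n := 0
  have h1 : ‖f‖ ^ 2 = -2 * inner ℝ (W.x α f) (W.d α f) := by
    have h := W.d_x α α f
    rw [if_pos rfl] at h
    have h2 : inner ℝ (W.d α (W.x α f)) f = inner ℝ (W.x α (W.d α f)) f + inner ℝ f f := by
      rw [h, inner_add_left]
    have h3 : inner ℝ (W.x α (W.d α f)) f = inner ℝ (W.x α f) (W.d α f) := by
      rw [W.x_symm, real_inner_comm]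
    rw [W.d_skew, h3, real_inner_self_eq_norm_sq] at h2
    linarith
  have h2 : ‖f‖ ^ 2 ≤ 2 * (W.R * ‖f‖ * ‖W.d α f‖) := by
    rw [h1]
    have := abs_real_inner_le_norm (W.x α f) (W.d α f)
    have h3 := mul_le_mul_of_nonneg_right (W.x_bound α f) (norm_nonneg (W.d α f))
    linarith [neg_abs_le (inner ℝ (W.x α f) (W.d α f))]
  have h3 : ‖f‖ ≤ 2 * W.R * ‖W.d α f‖ := by
    rcases (norm_nonneg f).eq_or_lt with h | h
    · rw [← h]; have := W.R_nonneg; positivity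
    · nlinarith
  have h4 := W.Q_d_le 0 α f
  rw [Q_zero, real_inner_self_eq_norm_sq] at h4 ⊢
  calc ‖f‖ ^ 2 ≤ (2 * W.R * ‖W.d α f‖) ^ 2 := by gcongr
    _ = 4 * W.R ^ 2 * ‖W.d α f‖ ^ 2 := by ring
    _ ≤ _ := by gcongr

lemma Q_le_succ [NeZero n] (s : ℕ) (f : T) : W.Q s f f ≤ 4 * W.R ^ 2 * W.Q (s + 1) f f := by
  induction s using Nat.twoStepInduction generalizing f with
  | zero => exact W.Q_zero_le f
  | one =>
    rw [← W.Q_d_d 0, ← W.Q_d_d 1, Finset.mul_sum]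
    exact Finset.sum_le_sum fun α _ => W.Q_zero_le _
  | more s ih _ =>
    have := ih (W.B f)
    simpa only [Q_B_left, Q_B_right] using this

lemma Q_one_le [NeZero n] (m : ℕ) (f : T) :
    W.Q 1 f f ≤ (4 * W.R ^ 2) ^ m * W.Q (m + 1) f f := by
  induction m with
  | zero => simp
  | succ m ih =>
    refine ih.trans ?_
    rw [pow_succ (4 * W.R ^ 2), mul_assoc]
    exact mul_le_mul_of_nonneg_left (W.Q_le_succ _ f) (by positivity)

lemma Q_zero_pos {f : T} (hf : f ≠ 0) : 0 < W.Q 0 f f := by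
  rw [Q_zero]; exact real_inner_self_pos.2 hf

lemma Q_pos [NeZero n] (s : ℕ) {f : T} (hf : f ≠ 0) : 0 < W.Q s f f := by
  induction s with
  | zero => exact W.Q_zero_pos hf
  | succ s ih =>
    have h1 := W.Q_le_succ s f
    have := W.R_nonneg
    by_contra hc
    push Not at hc
    have : 4 * W.R ^ 2 * W.Q (s + 1) f f ≤ 0 := mul_nonpos_of_nonneg_of_nonpos (by positivity) hc
    linarith

lemma Q_add_self_le (s : ℕ) (f g : T) :
    W.Q s (f + g) (f + g) ≤ 2 * W.Q s f f + 2 * W.Q s g g := by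
  have := W.Q_self_nonneg s (f - g)
  simp only [Q_sub_left, Q_sub_right, Q_add_left, Q_add_right] at *
  linarith

lemma norm_sum_d_sq_le (Φ : Fin n → T) :
    ‖∑ α, W.d α (Φ α)‖ ^ 2 ≤ ∑ α, W.Q 1 (Φ α) (Φ α) := by
  have h1 : ∀ α β, inner ℝ (W.d α (Φ α)) (W.d β (Φ β)) = inner ℝ (W.d β (Φ α)) (W.d α (Φ β)) := by
    intro α β
    rw [W.d_skew, W.d_comm, ← neg_eq_iff_eq_neg.2 (W.d_skew β (Φ α) _)]
    simp
  have h2 : ∀ α β, inner ℝ (W.d β (Φ α)) (W.d α (Φ β)) ≤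
      (‖W.d β (Φ α)‖ ^ 2 + ‖W.d α (Φ β)‖ ^ 2) / 2 := by
    intro α β
    have := real_inner_le_norm (W.d β (Φ α)) (W.d α (Φ β))
    nlinarith [sq_nonneg (‖W.d β (Φ α)‖ - ‖W.d α (Φ β)‖)]
  have h3 : ∑ α, W.Q 1 (Φ α) (Φ α) = ∑ α, ∑ β, ‖W.d β (Φ α)‖ ^ 2 := by
    simp only [Q_one, real_inner_self_eq_norm_sq]
  rw [← real_inner_self_eq_norm_sq, h3]
  simp only [sum_inner, inner_sum]
  calc _
      ≤ ∑ α, ∑ β, (‖W.d α (Φ β)‖ ^ 2 + ‖W.d β (Φ α)‖ ^ 2) / 2 :=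
        Finset.sum_le_sum fun α _ => Finset.sum_le_sum fun β _ => (h1 β α).trans_le (h2 β α)
    _ = _ := by
        simp only [← Finset.sum_div, Finset.sum_add_distrib]
        rw [Finset.sum_comm (f := fun α β => ‖W.d α (Φ β)‖ ^ 2)]
        ring

lemma exists_Q_x_le [NeZero n] (s : ℕ) :
    ∃ C, 0 ≤ C ∧ ∀ α f, W.Q s (W.x α f) (W.x α f) ≤ C * W.Q s f f := by
  have hR := W.R_nonneg
  induction s using Nat.twoStepInduction with
  | zero =>
    refine ⟨W.R ^ 2, by positivity, fun α f => ?_⟩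
    rw [Q_zero, Q_zero, real_inner_self_eq_norm_sq, real_inner_self_eq_norm_sq, ← mul_pow]
    gcongr
    exact W.x_bound α f
  | one =>
    refine ⟨2 * W.R ^ 2 + 2 * (4 * W.R ^ 2), by positivity, fun α f => ?_⟩
    have h1 : ∀ β, inner ℝ (W.d β (W.x α f)) (W.d β (W.x α f)) ≤
        2 * W.R ^ 2 * inner ℝ (W.d β f) (W.d β f) + if β = α then 2 * inner ℝ f f else 0 := by
      intro β
      have h2 := W.Q_add_self_le 0 (W.x α (W.d β f)) (if β = α then f else 0)
      rw [← W.d_x] at h2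
      simp only [Q_zero, real_inner_self_eq_norm_sq] at h2 ⊢
      have h3 : ‖W.x α (W.d β f)‖ ^ 2 ≤ (W.R * ‖W.d β f‖) ^ 2 := by
        gcongr
        exact W.x_bound α _
      split_ifs at h2 ⊢ <;> simp at h2 ⊢ <;> linarith
    have h4 := W.Q_zero_le f
    rw [Q_zero] at h4
    calc W.Q 1 (W.x α f) (W.x α f) ≤ ∑ β, (2 * W.R ^ 2 * inner ℝ (W.d β f) (W.d β f) +
          if β = α then 2 * inner ℝ f f else 0) := by
          rw [Q_one]; exact Finset.sum_le_sum fun β _ => h1 β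
      _ = 2 * W.R ^ 2 * W.Q 1 f f + 2 * inner ℝ f f := by
          rw [Q_one, Finset.sum_add_distrib, ← Finset.mul_sum]; simp
      _ ≤ _ := by linarith
  | more s ih _ =>
    obtain ⟨C, hC, h⟩ := ih
    refine ⟨2 * C + 8 * (4 * W.R ^ 2), by positivity, fun α f => ?_⟩
    have h1 : W.Q (s + 2) (W.x α f) (W.x α f) =
        W.Q s (W.x α (W.B f) + (-2 : ℝ) • W.d α f) (W.x α (W.B f) + (-2 : ℝ) • W.d α f) := by
      rw [← Q_B_left, ← Q_B_right, B_x, neg_smul, sub_eq_add_neg]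
    have h2 := W.Q_add_self_le s (W.x α (W.B f)) ((-2 : ℝ) • W.d α f)
    rw [← h1] at h2
    have h3 := h α (W.B f)
    simp only [Q_smul_left, Q_smul_right, Q_B_left, Q_B_right] at h2 h3
    have h4 := W.Q_d_le s α f
    have h5 := W.Q_le_succ (s + 1) f
    linarith

end WeylRep

namespace WeylRep

variable {n : ℕ} {T : Type*} [NormedAddCommGroup T] [InnerProductSpace ℝ T] (W : WeylRep n T)

/-- The min–max values of the form `Q (m + 1)` relative to `Q 1`. -/
structure IsMinMax (m : ℕ) (Λ : ℕ → ℝ) : Prop where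
  le_of_forall : ∀ k, 1 ≤ k → ∀ (V : Submodule ℝ T) (r : ℝ), Module.finrank ℝ V = k →
    (∀ φ ∈ V, W.Q (m + 1) φ φ ≤ r * W.Q 1 φ φ) → Λ k ≤ r
  exists_of_lt : ∀ k, 1 ≤ k → ∀ r, Λ k < r → ∃ V : Submodule ℝ T, Module.finrank ℝ V = k ∧
    ∀ φ ∈ V, W.Q (m + 1) φ φ ≤ r * W.Q 1 φ φ

/-- The vectors `u 0, …, u (K - 1)` are approximate eigenvectors for the min–max values. -/
structure IsApproxEigen (m : ℕ) (Λ : ℕ → ℝ) (K : ℕ) (M δ : ℝ) (u : ℕ → T) : Prop where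
  ortho : ∀ i < K, ∀ j < K, W.Q 1 (u i) (u j) = if i = j then 1 else 0
  eigen : ∀ i < K, ∀ v, W.Q (m + 1) v v ≤ M →
    |W.Q (m + 1) (u i) v - Λ (i + 1) * W.Q 1 (u i) v| ≤ δ
  min : ∀ i < K, ∀ v, (∀ j < i, W.Q 1 v (u j) = 0) →
    (Λ (i + 1) - δ) * W.Q 1 v v ≤ W.Q (m + 1) v v
  le : ∀ i < K, W.Q (m + 1) (u i) (u i) ≤ Λ (i + 1) + δ

variable {W} {m : ℕ} {Λ : ℕ → ℝ}

lemma IsApproxEigen.mono {K : ℕ} {M M' δ δ' : ℝ} {u : ℕ → T} (h : W.IsApproxEigen m Λ K M δ u)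
    (hM : M' ≤ M) (hδ : δ ≤ δ') : W.IsApproxEigen m Λ K M' δ' u where
  ortho := h.ortho
  eigen i hi v hv := (h.eigen i hi v (hv.trans hM)).trans hδ
  min i hi v hv := by
    have := h.min i hi v hv
    nlinarith [W.Q_self_nonneg 1 v]
  le i hi := (h.le i hi).trans (by linarith)

lemma Q_sum_sum {ι : Type*} (S : Finset ι) (s : ℕ) (c e : ι → ℝ) (w w' : ι → T) :
    W.Q s (∑ i ∈ S, c i • w i) (∑ i ∈ S, e i • w' i) =
      ∑ i ∈ S, ∑ j ∈ S, c i * e j * W.Q s (w i) (w' j) := by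
  simp only [Q_sum_left, Q_sum_right, Q_smul_left, Q_smul_right, Finset.mul_sum]
  rw [Finset.sum_comm]
  exact Finset.sum_congr rfl fun i _ => Finset.sum_congr rfl fun j _ => by ring

lemma Q_one_sum_of_ortho {ι : Type*} [DecidableEq ι] (S : Finset ι) (w : ι → T)
    (ho : ∀ i ∈ S, ∀ j ∈ S, W.Q 1 (w i) (w j) = if i = j then 1 else 0) (c : ι → ℝ) :
    W.Q 1 (∑ i ∈ S, c i • w i) (∑ i ∈ S, c i • w i) = ∑ i ∈ S, c i ^ 2 := by
  rw [Q_sum_sum]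
  refine Finset.sum_congr rfl fun i hi => ?_
  rw [Finset.sum_congr rfl fun j hj => by rw [ho i hi j hj]]
  simp [hi, sq]

lemma Q_sum_le_of_ortho {ι : Type*} [DecidableEq ι] (S : Finset ι) (w : ι → T)
    (ho : ∀ i ∈ S, ∀ j ∈ S, W.Q 1 (w i) (w j) = if i = j then 1 else 0) (r : ι → ℝ)
    (δ b : ℝ) (hr : ∀ i ∈ S, r i ≤ b)
    (hA : ∀ i ∈ S, ∀ j ∈ S, |W.Q (m + 1) (w i) (w j) - if i = j then r i else 0| ≤ δ)
    (c : ι → ℝ) :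
    W.Q (m + 1) (∑ i ∈ S, c i • w i) (∑ i ∈ S, c i • w i) ≤
      (b + S.card * δ) * W.Q 1 (∑ i ∈ S, c i • w i) (∑ i ∈ S, c i • w i) := by
  rw [Q_one_sum_of_ortho S w ho, Q_sum_sum]
  have h1 : ∀ i ∈ S, ∀ j ∈ S, c i * c j * W.Q (m + 1) (w i) (w j) ≤
      (if i = j then b * c i ^ 2 else 0) + δ * ((c i ^ 2 + c j ^ 2) / 2) := by
    intro i hi j hj
    have h := hA i hi j hj
    have h2 : c i * c j * (W.Q (m + 1) (w i) (w j) - if i = j then r i else 0) ≤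
        δ * ((c i ^ 2 + c j ^ 2) / 2) := by
      have hδ : 0 ≤ δ := (abs_nonneg _).trans h
      calc _ ≤ |c i * c j| * |W.Q (m + 1) (w i) (w j) - if i = j then r i else 0| := by
            rw [← abs_mul]; exact le_abs_self _
        _ ≤ (c i ^ 2 + c j ^ 2) / 2 * δ := by
            refine mul_le_mul ?_ h (abs_nonneg _) (by positivity)
            rw [abs_mul]
            nlinarith [sq_nonneg (|c i| - |c j|), sq_abs (c i), sq_abs (c j)]
        _ = _ := by ring
    split_ifs at h2 ⊢ with hij
    · subst hij
      nlinarith [hr i hi, sq_nonneg (c i)]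
    · linarith
  refine (Finset.sum_le_sum fun i hi => Finset.sum_le_sum fun j hj => h1 i hi j hj).trans_eq ?_
  simp only [Finset.sum_add_distrib, Finset.sum_ite_eq, ← Finset.mul_sum, ← Finset.sum_div,
    Finset.sum_const, nsmul_eq_mul]
  rw [Finset.sum_congr rfl (g := fun i => b * c i ^ 2) fun i hi => by rw [if_pos hi],
    ← Finset.mul_sum]
  ring

lemma IsMinMax.le_of_ortho (hΛ : W.IsMinMax m Λ) {p : ℕ} (hp : 1 ≤ p) (w : ℕ → T)
    (ho : ∀ i < p, ∀ j < p, W.Q 1 (w i) (w j) = if i = j then 1 else 0) (r : ℕ → ℝ)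
    (δ b : ℝ) (hr : ∀ i < p, r i ≤ b)
    (hA : ∀ i < p, ∀ j < p, |W.Q (m + 1) (w i) (w j) - if i = j then r i else 0| ≤ δ) :
    Λ p ≤ b + p * δ := by
  have key : ∀ c : Fin p → ℝ, ∃ e : ℕ → ℝ, (∀ i : Fin p, e i = c i) ∧
      ∑ i, c i • w i = ∑ i ∈ Finset.range p, e i • w i := by
    intro c
    refine ⟨fun i => if h : i < p then c ⟨i, h⟩ else 0, fun i => by simp, ?_⟩
    rw [← Fin.sum_univ_eq_sum_range (fun i => (if h : i < p then c ⟨i, h⟩ else 0) • w i)]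
    exact Finset.sum_congr rfl fun i _ => by simp
  have ho' : ∀ i ∈ Finset.range p, ∀ j ∈ Finset.range p,
      W.Q 1 (w i) (w j) = if i = j then 1 else 0 := fun i hi j hj =>
    ho i (Finset.mem_range.1 hi) j (Finset.mem_range.1 hj)
  have li : LinearIndependent ℝ (fun i : Fin p => w i) := by
    rw [Fintype.linearIndependent_iff]
    intro c hc i
    obtain ⟨e, he, hs⟩ := key c
    have h1 := Q_one_sum_of_ortho (Finset.range p) w ho' e
    rw [← hs, hc] at h1
    have h2 : W.Q 1 (0 : T) 0 = 0 := by simp [Q]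
    rw [h2] at h1
    have h3 := (Finset.sum_eq_zero_iff_of_nonneg fun i _ => sq_nonneg (e i)).1 h1.symm i
      (Finset.mem_range.2 i.2)
    rw [← he]
    exact pow_eq_zero_iff two_ne_zero |>.1 h3
  refine hΛ.le_of_forall p hp (Submodule.span ℝ (Set.range fun i : Fin p => w i)) _ ?_ ?_
  · rw [finrank_span_eq_card li, Fintype.card_fin]
  · intro φ hφ
    obtain ⟨c, rfl⟩ := (Submodule.mem_span_range_iff_exists_fun ℝ).1 hφ
    obtain ⟨e, he, hs⟩ := key c
    rw [hs]
    have := Q_sum_le_of_ortho (m := m) (Finset.range p) w ho' r δ b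
      (fun i hi => hr i (Finset.mem_range.1 hi))
      (fun i hi j hj => hA i (Finset.mem_range.1 hi) j (Finset.mem_range.1 hj)) e
    rwa [Finset.card_range] at this

lemma IsMinMax.nonneg [NeZero n] (hΛ : W.IsMinMax m Λ) {k : ℕ} (hk : 1 ≤ k) : 0 ≤ Λ k := by
  refine le_of_forall_gt_imp_ge_of_dense fun r hr => ?_
  obtain ⟨V, hV, h⟩ := hΛ.exists_of_lt k hk r hr
  have : Nontrivial V := Module.nontrivial_of_finrank_pos (R := ℝ) (by omega)
  obtain ⟨⟨v, hv⟩, hne⟩ := exists_ne (0 : V)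
  have hv0 : v ≠ 0 := fun h => hne (by simpa using h)
  have h1 := h v hv
  have h2 := W.Q_pos 1 hv0
  have h3 := W.Q_self_nonneg (m + 1) v
  by_contra hc
  nlinarith

lemma IsApproxEigen.min_next [NeZero n] (hΛ : W.IsMinMax m Λ) {K : ℕ} {M δ : ℝ} {u : ℕ → T}
    (h : W.IsApproxEigen m Λ K M δ u) (hδ : 0 ≤ δ) (hM : ∀ i ≤ K, Λ (i + 1) + δ ≤ M) (v : T)
    (hv : ∀ j < K, W.Q 1 v (u j) = 0) :
    (Λ (K + 1) - (K + 2) * δ) * W.Q 1 v v ≤ W.Q (m + 1) v v := by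
  have key : ∀ v, (∀ j < K, W.Q 1 v (u j) = 0) → W.Q 1 v v = 1 →
      Λ (K + 1) - (K + 2) * δ ≤ W.Q (m + 1) v v := by
    intro v hv hv1
    by_contra hc
    push Not at hc
    have hvM : W.Q (m + 1) v v ≤ M := by
      have h1 := hM K le_rfl
      have h2 : (0 : ℝ) ≤ (K + 2) * δ := by positivity
      linarith
    have huM : ∀ i < K, W.Q (m + 1) (u i) (u i) ≤ M := fun i hi =>
      (h.le i hi).trans (hM i hi.le)
    have hlt : ∀ {i}, i < K + 1 → ¬ i < K → i = K := by omega
    have := hΛ.le_of_ortho (p := K + 1) (by omega) (fun i => if i < K then u i else v) ?_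
      (fun i => if i < K then Λ (i + 1) else W.Q (m + 1) v v) δ (W.Q (m + 1) v v + δ) ?_ ?_
    · push_cast at this
      linarith
    · intro i hi j hj
      by_cases hi' : i < K <;> by_cases hj' : j < K <;> simp only [hi', hj', if_true, if_false]
      · exact h.ortho i hi' j hj'
      · rw [W.Q_comm, hv i hi', if_neg (by omega)]
      · rw [hv j hj', if_neg (by omega)]
      · rw [hv1, if_pos (by rw [hlt hi hi', hlt hj hj'])]
    · intro i hi
      by_cases hi' : i < K <;> simp only [hi', if_true, if_false]
      · have := h.min i hi' v fun j hj => hv j (by omega)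
        rw [hv1] at this
        linarith
      · linarith
    · intro i hi j hj
      by_cases hi' : i < K <;> by_cases hj' : j < K <;> simp only [hi', hj', if_true, if_false]
      · have := h.eigen i hi' (u j) (huM j hj')
        rw [h.ortho i hi' j hj'] at this
        simpa using this
      · have := h.eigen i hi' v hvM
        rw [W.Q_comm 1, hv i hi', mul_zero] at this
        rwa [if_neg (by omega)]
      · have := h.eigen j hj' v hvM
        rw [W.Q_comm 1, hv j hj', mul_zero] at this
        rwa [if_neg (by omega), W.Q_comm]
      · rw [if_pos (by rw [hlt hi hi', hlt hj hj'])]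
        simpa using hδ
  by_cases hv0 : v = 0
  · subst hv0; simp [Q]
  · have hpos := W.Q_pos 1 hv0
    set c := (Real.sqrt (W.Q 1 v v))⁻¹ with hc
    have hc2 : c * (c * W.Q 1 v v) = 1 := by
      have h1 := Real.mul_self_sqrt hpos.le
      have h2 := (Real.sqrt_pos.2 hpos).ne'
      rw [hc]; field_simp; nlinarith
    have := key (c • v) (fun j hj => by rw [Q_smul_left, hv j hj, mul_zero])
      (by rw [Q_smul_left, Q_smul_right, hc2])
    rw [Q_smul_left, Q_smul_right] at this
    calc _ ≤ c * (c * W.Q (m + 1) v v) * W.Q 1 v v := by gcongr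
      _ = c * (c * W.Q 1 v v) * W.Q (m + 1) v v := by ring
      _ = _ := by rw [hc2, one_mul]

lemma IsMinMax.exists_next [NeZero n] (hΛ : W.IsMinMax m Λ) (K : ℕ) (u : ℕ → T) (r : ℝ)
    (hr : Λ (K + 1) < r) :
    ∃ w, W.Q 1 w w = 1 ∧ (∀ j < K, W.Q 1 w (u j) = 0) ∧ W.Q (m + 1) w w ≤ r := by
  obtain ⟨V, hV, h⟩ := hΛ.exists_of_lt (K + 1) (by omega) r hr
  have : FiniteDimensional ℝ V := Module.finite_of_finrank_pos (by omega)
  let L : V →ₗ[ℝ] (Fin K → ℝ) :=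
    { toFun := fun v j => W.Q 1 v (u j)
      map_add' := fun f g => by ext j; simp [Q_add_left]
      map_smul' := fun c f => by ext j; simp [Q_smul_left] }
  have hker : LinearMap.ker L ≠ ⊥ := LinearMap.ker_ne_bot_of_finrank_lt (by simp [hV])
  obtain ⟨⟨v, hv⟩, hmem, hne⟩ := Submodule.exists_mem_ne_zero_of_ne_bot hker
  have hv0 : v ≠ 0 := fun h => hne (by simpa using h)
  have hperp : ∀ j < K, W.Q 1 v (u j) = 0 := fun j hj =>
    congrFun (LinearMap.mem_ker.1 hmem) (⟨j, hj⟩ : Fin K)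
  have hpos := W.Q_pos 1 hv0
  set c := (Real.sqrt (W.Q 1 v v))⁻¹ with hc
  have hc2 : c * (c * W.Q 1 v v) = 1 := by
    have h1 := Real.mul_self_sqrt hpos.le
    have h2 := (Real.sqrt_pos.2 hpos).ne'
    rw [hc]; field_simp; nlinarith
  refine ⟨c • v, by rw [Q_smul_left, Q_smul_right, hc2],
    fun j hj => by rw [Q_smul_left, hperp j hj, mul_zero], ?_⟩
  rw [Q_smul_left, Q_smul_right]
  have := h v hv
  calc c * (c * W.Q (m + 1) v v) ≤ c * (c * (r * W.Q 1 v v)) := by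
        rw [← mul_assoc, ← mul_assoc]
        exact mul_le_mul_of_nonneg_left this (mul_self_nonneg c)
    _ = r * (c * (c * W.Q 1 v v)) := by ring
    _ = r := by rw [hc2, mul_one]

end WeylRep

namespace WeylRep

variable {n : ℕ} {T : Type*} [NormedAddCommGroup T] [InnerProductSpace ℝ T] {W : WeylRep n T}
variable {m : ℕ} {Λ : ℕ → ℝ}

lemma IsApproxEigen.next_eigen [NeZero n] (hΛ : W.IsMinMax m Λ) {K : ℕ} {M δ c : ℝ} {u : ℕ → T}
    (h : W.IsApproxEigen m Λ K M δ u) (hδ : 0 ≤ δ) (hδ1 : δ ≤ 1)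
    (hM : ∀ i ≤ K, Λ (i + 1) + δ ≤ M) (hc0 : 0 ≤ c)
    (hc : ∀ f, W.Q 1 f f ≤ c * W.Q (m + 1) f f) (hw1 : W.Q 1 (u K) (u K) = 1)
    (hw : ∀ j < K, W.Q 1 (u K) (u j) = 0) (hwM : W.Q (m + 1) (u K) (u K) ≤ Λ (K + 1) + δ)
    (v : T) (hv : W.Q (m + 1) v v ≤ M) :
    |W.Q (m + 1) (u K) v - Λ (K + 1) * W.Q 1 (u K) v| ≤
      Real.sqrt ((K + 3) * δ * (2 * M + 2 * (M + K) * (c * M) + (K + 2) * (c * M))) +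
        (2 * K + 2) * δ * (1 + c * M) := by
  set w := u K
  have hM0 : 0 ≤ M := (W.Q_self_nonneg _ _).trans hv
  have hcM : 0 ≤ c * M := by positivity
  have hΛ0 : 0 ≤ Λ (K + 1) := hΛ.nonneg (by omega)
  have hAw : W.Q (m + 1) w w ≤ M := hwM.trans (hM K le_rfl)
  have huM : ∀ i < K, W.Q (m + 1) (u i) (u i) ≤ M := fun i hi => (h.le i hi).trans (hM i hi.le)
  set s := ∑ j ∈ Finset.range K, W.Q 1 v (u j) • u j with hs
  have ho : ∀ i ∈ Finset.range K, ∀ j ∈ Finset.range K,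
      W.Q 1 (u i) (u j) = if i = j then 1 else 0 := fun i hi j hj =>
    h.ortho i (Finset.mem_range.1 hi) j (Finset.mem_range.1 hj)
  have hsu : ∀ j < K, W.Q 1 s (u j) = W.Q 1 v (u j) := by
    intro j hj
    simp only [hs, Q_sum_left, Q_smul_left]
    rw [Finset.sum_congr rfl fun i hi => by rw [ho i hi j (Finset.mem_range.2 hj)]]
    simp [hj]
  have hDs : W.Q 1 s s = ∑ j ∈ Finset.range K, W.Q 1 v (u j) ^ 2 :=
    Q_one_sum_of_ortho _ _ ho _
  have hvs : W.Q 1 v s = ∑ j ∈ Finset.range K, W.Q 1 v (u j) ^ 2 := by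
    simp only [hs, Q_sum_right, Q_smul_right, sq]
  have hDv : W.Q 1 v v ≤ c * M := (hc v).trans (by gcongr)
  have hDv' : W.Q 1 (v - s) (v - s) = W.Q 1 v v - W.Q 1 s s := by
    simp only [Q_sub_left, Q_sub_right, W.Q_comm 1 s v]
    linarith
  have hDv'0 := W.Q_self_nonneg 1 (v - s)
  have hDs0 := W.Q_self_nonneg 1 s
  have hAs : W.Q (m + 1) s s ≤ (M + K) * (c * M) := by
    have := Q_sum_le_of_ortho (m := m) (Finset.range K) u ho (fun i => Λ (i + 1)) δ M
      (fun i hi => by have := hM i (Finset.mem_range.1 hi).le; linarith)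
      (fun i hi j hj => by
        have := h.eigen i (Finset.mem_range.1 hi) (u j) (huM j (Finset.mem_range.1 hj))
        rw [ho i hi j hj] at this
        simpa using this) (fun j => W.Q 1 v (u j))
    rw [← hs, Finset.card_range] at this
    refine this.trans (mul_le_mul ?_ (by linarith) hDs0 (by positivity))
    have : (K : ℝ) * δ ≤ K * 1 := by gcongr
    linarith
  have hAv' : W.Q (m + 1) (v - s) (v - s) ≤ 2 * M + 2 * (M + K) * (c * M) := by
    have := W.Q_add_self_le (m + 1) v (-s)
    rw [← sub_eq_add_neg] at this
    have h2 : W.Q (m + 1) (-s) (-s) = W.Q (m + 1) s s := by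
      rw [Q_neg_left, Q_comm, Q_neg_left, neg_neg]
    linarith
  have hperp : ∀ j < K, W.Q 1 (v - s) (u j) = 0 := fun j hj => by
    rw [Q_sub_left, hsu j hj, sub_self]
  set ν := Λ (K + 1) - (K + 2) * δ with hν
  have hcs : (W.Q (m + 1) w (v - s) - ν * W.Q 1 w (v - s)) ^ 2 ≤
      (W.Q (m + 1) w w - ν * W.Q 1 w w) *
        (W.Q (m + 1) (v - s) (v - s) - ν * W.Q 1 (v - s) (v - s)) := by
    have hq : ∀ c : ℝ, 0 ≤ (W.Q (m + 1) (v - s) (v - s) - ν * W.Q 1 (v - s) (v - s)) * (c * c) +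
        2 * (W.Q (m + 1) w (v - s) - ν * W.Q 1 w (v - s)) * c +
        (W.Q (m + 1) w w - ν * W.Q 1 w w) := by
      intro c
      have h1 := h.min_next hΛ hδ hM (w + c • (v - s)) fun j hj => by
        rw [Q_add_left, Q_smul_left, hw j hj, hperp j hj]; ring
      set v' := v - s
      simp only [Q_add_left, Q_add_right, Q_smul_left, Q_smul_right, W.Q_comm _ v' w] at h1
      rw [← hν] at h1
      linarith
    have := discrim_le_zero hq
    rw [discrim] at this
    linarith
  have hKδ : ((K : ℝ) + 2) * δ ≤ (K + 2) * 1 := by gcongr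
  have hqw : W.Q (m + 1) w w - ν * W.Q 1 w w ≤ (K + 3) * δ := by
    rw [hw1, hν]; linarith
  have hqv : W.Q (m + 1) (v - s) (v - s) - ν * W.Q 1 (v - s) (v - s) ≤
      2 * M + 2 * (M + K) * (c * M) + (K + 2) * (c * M) := by
    have h1 : W.Q 1 (v - s) (v - s) ≤ c * M := by linarith
    have h2 : -ν ≤ K + 2 := by rw [hν]; linarith
    have h3 : -ν * W.Q 1 (v - s) (v - s) ≤ (K + 2) * (c * M) :=
      (mul_le_mul_of_nonneg_right h2 hDv'0).trans (by gcongr)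
    linarith
  have hb1 : |W.Q (m + 1) w (v - s) - ν * W.Q 1 w (v - s)| ≤
      Real.sqrt ((K + 3) * δ * (2 * M + 2 * (M + K) * (c * M) + (K + 2) * (c * M))) := by
    refine Real.abs_le_sqrt (hcs.trans (mul_le_mul hqw hqv ?_ (by positivity)))
    have := h.min_next hΛ hδ hM (v - s) hperp
    linarith
  have hb2 : |W.Q 1 w (v - s)| ≤ 1 + c * M := by
    have h1 := W.Q_cauchy_schwarz 1 w (v - s)
    rw [hw1] at h1
    refine abs_le_of_sq_le_sq ?_ (by positivity)
    nlinarith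
  have hb3 : |W.Q (m + 1) w s| ≤ K * (δ * (1 + c * M)) := by
    rw [hs, Q_sum_right]
    refine (Finset.abs_sum_le_sum_abs _ _).trans ?_
    rw [← nsmul_eq_mul]
    nth_rw 2 [← Finset.card_range K]
    refine Finset.sum_le_card_nsmul _ _ _ fun j hj => ?_
    have hj' := Finset.mem_range.1 hj
    have h1 := h.eigen j hj' w hAw
    rw [W.Q_comm 1, hw j hj', mul_zero, sub_zero, W.Q_comm] at h1
    have h2 : |W.Q 1 v (u j)| ≤ 1 + c * M := by
      have h3 := W.Q_cauchy_schwarz 1 v (u j)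
      rw [h.ortho j hj' j hj', if_pos rfl] at h3
      refine abs_le_of_sq_le_sq ?_ (by positivity)
      nlinarith
    rw [Q_smul_right, abs_mul, mul_comm]
    exact mul_le_mul h1 h2 (abs_nonneg _) hδ
  have hDws : W.Q 1 w s = 0 := by
    simp only [hs, Q_sum_right, Q_smul_right]
    exact Finset.sum_eq_zero fun j hj => by rw [hw j (Finset.mem_range.1 hj), mul_zero]
  have e1 : W.Q (m + 1) w v - Λ (K + 1) * W.Q 1 w v =
      (W.Q (m + 1) w (v - s) - ν * W.Q 1 w (v - s)) - (K + 2) * δ * W.Q 1 w (v - s) +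
        W.Q (m + 1) w s := by
    simp only [Q_sub_right, hDws]
    rw [hν]; ring
  rw [e1]
  refine (abs_add_le _ _).trans ?_
  refine (add_le_add (abs_sub _ _) le_rfl).trans ?_
  rw [abs_mul ((K + 2) * δ), abs_of_nonneg (show 0 ≤ (K + 2) * δ by positivity)]
  have : (K + 2) * δ * |W.Q 1 w (v - s)| ≤ (K + 2) * δ * (1 + c * M) := by gcongr
  linarith

theorem IsMinMax.exists_isApproxEigen [NeZero n] (hΛ : W.IsMinMax m Λ) (K : ℕ) :
    ∀ M δ : ℝ, 0 < δ → ∃ u, W.IsApproxEigen m Λ K M δ u := by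
  induction K with
  | zero => exact fun M δ _ => ⟨0, by constructor <;> intro i hi <;> omega⟩
  | succ K ih =>
    intro M₀ δ hδ
    set c := (4 * W.R ^ 2) ^ m
    have hc0 : 0 ≤ c := by positivity
    obtain ⟨M, hM₀, hM0, hM⟩ : ∃ M, M₀ ≤ M ∧ 0 ≤ M ∧ ∀ i ≤ K, Λ (i + 1) + 1 ≤ M := by
      refine ⟨|M₀| + ∑ i ∈ Finset.range (K + 1), (|Λ (i + 1)| + 1), ?_, by positivity, ?_⟩
      · have h1 := le_abs_self M₀
        have : 0 ≤ ∑ i ∈ Finset.range (K + 1), (|Λ (i + 1)| + 1) := by positivity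
        linarith
      · intro i hi
        have h1 := Finset.single_le_sum (f := fun i => |Λ (i + 1)| + 1)
          (fun i _ => by positivity) (Finset.mem_range.2 (Nat.lt_succ_of_le hi))
        have h2 := le_abs_self (Λ (i + 1))
        have h3 := abs_nonneg M₀
        linarith
    set E := 2 * M + 2 * (M + K) * (c * M) + (K + 2) * (c * M)
    have hE : 0 ≤ E := by positivity
    have hcM : 0 ≤ c * M := by positivity
    set H := 4 * (K + 3) * (1 + E) + 2 * (2 * K + 2) * (1 + c * M) + (K + 2) with hH
    have hHpos : 0 < H := by positivity
    obtain ⟨ε, hε, hε1, hεδ, hεδ2⟩ : ∃ ε, 0 < ε ∧ H * ε ≤ 1 ∧ H * ε ≤ δ ∧ H * ε ≤ δ ^ 2 := by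
      refine ⟨min 1 (min δ (δ ^ 2)) / H, by positivity, ?_, ?_, ?_⟩ <;>
        rw [mul_div_cancel₀ _ hHpos.ne'] <;> simp
    have hK : (0 : ℝ) ≤ K := by positivity
    have hH1 : 1 ≤ H := by
      have h1 : 0 ≤ 4 * (K + 3) * (1 + E) := by positivity
      have h2 : 0 ≤ 2 * (2 * K + 2) * (1 + c * M) := by positivity
      linarith
    have hε1' : ε ≤ 1 := by nlinarith
    have hεδ' : ε ≤ δ := by nlinarith
    have hb1 : Real.sqrt ((K + 3) * ε * E) ≤ δ / 2 := by
      refine Real.sqrt_le_iff.2 ⟨by positivity, ?_⟩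
      have h1 : 4 * ((K + 3) * ε * E) ≤ H * ε := by
        have : H * ε - 4 * ((K + 3) * ε * E) =
          (4 * (K + 3) + 2 * (2 * K + 2) * (1 + c * M) + (K + 2)) * ε := by rw [hH]; ring
        have : 0 ≤ H * ε - 4 * ((K + 3) * ε * E) := by rw [this]; positivity
        linarith
      nlinarith
    have hb2 : (2 * K + 2) * ε * (1 + c * M) ≤ δ / 2 := by
      have : H * ε - 2 * ((2 * K + 2) * ε * (1 + c * M)) =
          (4 * (K + 3) * (1 + E) + (K + 2)) * ε := by rw [hH]; ring
      have : 0 ≤ H * ε - 2 * ((2 * K + 2) * ε * (1 + c * M)) := by rw [this]; positivity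
      linarith
    have hb3 : (K + 2) * ε ≤ δ := by
      have : H * ε - (K + 2) * ε =
          (4 * (K + 3) * (1 + E) + 2 * (2 * K + 2) * (1 + c * M)) * ε := by rw [hH]; ring
      have : 0 ≤ H * ε - (K + 2) * ε := by rw [this]; positivity
      linarith
    obtain ⟨u₀, h₀⟩ := ih M ε hε
    obtain ⟨w, hw1, hw, hwM⟩ := hΛ.exists_next K u₀ (Λ (K + 1) + ε) (by linarith)
    set u := fun i => if i = K then w else u₀ i with hu
    have huK : u K = w := by simp [hu]
    have hui : ∀ i < K, u i = u₀ i := fun i hi => by simp [hu, hi.ne]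
    have hMε : ∀ i ≤ K, Λ (i + 1) + ε ≤ M := fun i hi => by linarith [hM i hi]
    have h₁ : W.IsApproxEigen m Λ K M ε u :=
      { ortho := fun i hi j hj => by rw [hui i hi, hui j hj]; exact h₀.ortho i hi j hj
        eigen := fun i hi => by rw [hui i hi]; exact h₀.eigen i hi
        min := fun i hi v hv => h₀.min i hi v fun j hj => by
          rw [← hui j (hj.trans hi)]; exact hv j hj
        le := fun i hi => by rw [hui i hi]; exact h₀.le i hi }
    have hw' : ∀ j < K, W.Q 1 (u K) (u j) = 0 := fun j hj => by
      rw [huK, hui j hj]; exact hw j hj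
    have hlt : ∀ {i}, i < K + 1 → ¬ i < K → i = K := by omega
    refine ⟨u, ?_, ?_, ?_, ?_⟩
    · intro i hi j hj
      by_cases hi' : i < K
      · by_cases hj' : j < K
        · exact h₁.ortho i hi' j hj'
        · rw [hlt hj hj', W.Q_comm, hw' i hi', if_neg hi'.ne]
      · rw [hlt hi hi']
        by_cases hj' : j < K
        · rw [hw' j hj', if_neg hj'.ne']
        · rw [hlt hj hj', huK, hw1, if_pos rfl]
    · intro i hi v hv
      by_cases hi' : i < K
      · exact (h₁.eigen i hi' v (hv.trans hM₀)).trans hεδ'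
      · rw [hlt hi hi']
        have := h₁.next_eigen hΛ hε.le hε1' hMε hc0 (W.Q_one_le m) (by rw [huK, hw1]) hw'
          (by rw [huK]; exact hwM) v (hv.trans hM₀)
        linarith
    · intro i hi v hv
      by_cases hi' : i < K
      · have := h₁.min i hi' v hv
        nlinarith [W.Q_self_nonneg 1 v]
      · rw [hlt hi hi'] at hv ⊢
        have := h₁.min_next hΛ hε.le hMε v hv
        nlinarith [W.Q_self_nonneg 1 v]
    · intro i hi
      by_cases hi' : i < K
      · exact (h₁.le i hi').trans (by linarith)
      · rw [hlt hi hi', huK]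
        linarith

end WeylRep

namespace WeylRep

variable {n : ℕ} {T : Type*} [NormedAddCommGroup T] [InnerProductSpace ℝ T] (W : WeylRep n T)

lemma gram_nonneg {k : ℕ} (f₁ f₂ : ℝ) (u : Fin k → T)
    (ho : ∀ i j, W.Q 1 (u i) (u j) = if i = j then 1 else 0) (v : T) (x y τ : ℝ) :
    0 ≤ x ^ 2 * (∑ α, W.Q 1 (W.x α v) (W.x α v) - ∑ α, ∑ j, W.Q 1 (W.x α v) (u j) ^ 2)
      - x * y * (f₁ * (n + 2) * W.Q 1 v v + f₂ * (n + 4) * W.Q 2 v v)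
      + x * τ * (n * W.Q 0 v v)
      + y ^ 2 * (f₁ ^ 2 * W.Q 2 v v + 2 * f₁ * f₂ * W.Q 3 v v + f₂ ^ 2 * W.Q 4 v v)
      - 2 * y * τ * (f₁ * W.Q 1 v v + f₂ * W.Q 2 v v) + τ ^ 2 * W.Q 0 v v
      - ∑ α, ∑ j, (2 * x * W.Q 1 (W.x α v) (u j) *
          (y * (f₁ * W.Q 1 (W.d α v) (u j) + f₂ * W.Q 2 (W.d α v) (u j)) +
            τ * (-W.Q 0 (W.d α v) (u j))) +
          (y * (f₁ * W.Q 1 (W.d α v) (u j) + f₂ * W.Q 2 (W.d α v) (u j)) +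
            τ * (-W.Q 0 (W.d α v) (u j))) ^ 2) := by
  set a : Fin n → Fin k → ℝ := fun α j => W.Q 1 (W.x α v) (u j) with ha
  set b : Fin n → Fin k → ℝ := fun α j =>
    y * (f₁ * W.Q 1 (W.d α v) (u j) + f₂ * W.Q 2 (W.d α v) (u j)) +
      τ * (-W.Q 0 (W.d α v) (u j)) with hb
  set Φ : Fin n → T := fun α => W.x α v - ∑ j, a α j • u j with hΦ
  set Ψ : Fin n → T := fun α => x • Φ α - ∑ j, b α j • u j with hΨ
  set h : T := τ • v - y • (f₁ • W.B v + f₂ • W.B (W.B v)) with hh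
  have hΦu : ∀ α j, W.Q 1 (Φ α) (u j) = 0 := by
    intro α j
    simp [hΦ, Q_sub_left, Q_sum_left, Q_smul_left, ho, ha]
  have hoS : ∀ i ∈ Finset.univ, ∀ j ∈ Finset.univ, W.Q 1 (u i) (u j) = if i = j then 1 else 0 :=
    fun i _ j _ => ho i j
  have hsq : ∀ c : Fin k → ℝ, W.Q 1 (∑ j, c j • u j) (∑ j, c j • u j) = ∑ j, c j ^ 2 :=
    Q_one_sum_of_ortho Finset.univ u hoS
  have hDΦ : ∀ α, W.Q 1 (Φ α) (Φ α) = W.Q 1 (W.x α v) (W.x α v) - ∑ j, a α j ^ 2 := by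
    intro α
    have h1 : W.Q 1 (Φ α) (∑ j, a α j • u j) = 0 := by
      simp [Q_sum_right, Q_smul_right, hΦu]
    have h2 : W.Q 1 (Φ α) (Φ α) = W.Q 1 (Φ α) (W.x α v) := by
      conv_lhs => rw [show Φ α = W.x α v - ∑ j, a α j • u j from rfl]
      rw [Q_sub_right]
      change W.Q 1 (Φ α) (W.x α v) - W.Q 1 (Φ α) (∑ j, a α j • u j) = _
      rw [h1, sub_zero]
    rw [h2, show Φ α = W.x α v - ∑ j, a α j • u j from rfl, Q_sub_left, Q_sum_left]
    congr 1
    refine Finset.sum_congr rfl fun j _ => ?_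
    rw [Q_smul_left, W.Q_comm 1 (u j), sq]
  have hDΨ : ∀ α, W.Q 1 (Ψ α) (Ψ α) = x ^ 2 * W.Q 1 (Φ α) (Φ α) + ∑ j, b α j ^ 2 := by
    intro α
    have h1 : W.Q 1 (Φ α) (∑ j, b α j • u j) = 0 := by
      simp [Q_sum_right, Q_smul_right, hΦu]
    have h2 := hsq (b α)
    rw [show Ψ α = x • Φ α - ∑ j, b α j • u j from rfl]
    rw [Q_sub_left, Q_sub_right, Q_sub_right, h2, Q_smul_right, Q_smul_left, Q_smul_left,
      W.Q_comm 1 (∑ j, b α j • u j), Q_smul_left, h1]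
    ring
  have hdh : ∀ α, W.d α h = τ • W.d α v - y • (f₁ • W.B (W.d α v) + f₂ • W.B (W.B (W.d α v))) := by
    intro α
    simp only [hh, map_sub, map_add, map_smul, B_d]
  have hdhg : ∀ α g, inner ℝ (W.d α h) g =
      τ * W.Q 0 (W.d α v) g - y * (f₁ * W.Q 1 (W.d α v) g + f₂ * W.Q 2 (W.d α v) g) := by
    intro α g
    rw [hdh, ← W.Q_zero]
    simp only [Q_sub_left, Q_add_left, Q_smul_left, Q_B_left, zero_add, Nat.reduceAdd]
  have hdu : ∀ α j, inner ℝ (W.d α h) (u j) = -b α j := by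
    intro α j
    rw [hdhg, hb]; ring
  have hhΨ : ∀ α, inner ℝ h (W.d α (Ψ α)) =
      -x * inner ℝ (W.d α h) (W.x α v) - x * ∑ j, a α j * b α j - ∑ j, b α j ^ 2 := by
    intro α
    have h1 := W.d_skew α h (Ψ α)
    have h2 : inner ℝ h (W.d α (Ψ α)) = -inner ℝ (W.d α h) (Ψ α) := by rw [h1]; ring
    rw [h2]
    simp only [hΨ, hΦ, inner_sub_right, inner_smul_right, inner_sum, hdu, mul_neg,
      Finset.sum_neg_distrib, sq]
    ring
  have hhh : inner ℝ h h = τ ^ 2 * W.Q 0 v v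
      - 2 * y * τ * (f₁ * W.Q 1 v v + f₂ * W.Q 2 v v)
      + y ^ 2 * (f₁ ^ 2 * W.Q 2 v v + 2 * f₁ * f₂ * W.Q 3 v v + f₂ ^ 2 * W.Q 4 v v) := by
    rw [← W.Q_zero]
    simp only [hh, Q_sub_left, Q_sub_right, Q_add_left, Q_add_right, Q_smul_left, Q_smul_right,
      Q_B_left, Q_B_right, zero_add, Nat.reduceAdd]
    ring
  have h0 : ∑ α, W.Q 0 (W.d α v) (W.x α v) = -(n * W.Q 0 v v) / 2 := by
    have := W.two_mul_sum_Q_d_x 0 v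
    push_cast at this
    linarith
  have h1 : ∑ α, W.Q 1 (W.d α v) (W.x α v) = -((n + 2) * W.Q 1 v v) / 2 := by
    have := W.two_mul_sum_Q_d_x 1 v
    push_cast at this
    linarith
  have h2 : ∑ α, W.Q 2 (W.d α v) (W.x α v) = -((n + 4) * W.Q 2 v v) / 2 := by
    have := W.two_mul_sum_Q_d_x 2 v
    push_cast at this
    linarith
  have hdx : ∑ α, inner ℝ (W.d α h) (W.x α v) = -τ * (n * W.Q 0 v v) / 2 +
      y * (f₁ * ((n + 2) * W.Q 1 v v) + f₂ * ((n + 4) * W.Q 2 v v)) / 2 := by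
    simp only [hdhg, Finset.sum_sub_distrib, ← Finset.mul_sum, Finset.sum_add_distrib, h0, h1, h2]
    ring
  have main : 0 ≤ inner ℝ h h + 2 * inner ℝ h (∑ α, W.d α (Ψ α)) + ∑ α, W.Q 1 (Ψ α) (Ψ α) := by
    have h3 := W.norm_sum_d_sq_le Ψ
    have h4 := real_inner_self_nonneg (x := h + ∑ α, W.d α (Ψ α))
    rw [real_inner_add_add_self, real_inner_self_eq_norm_sq (∑ α, W.d α (Ψ α))] at h4
    linarith
  rw [inner_sum] at main
  simp only [hhΨ, hDΨ, hDΦ, Finset.sum_sub_distrib, Finset.sum_add_distrib, ← Finset.mul_sum,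
    hhh, hdx] at main
  have hfin : ∑ α, ∑ j, (2 * x * a α j * b α j + b α j ^ 2) =
      2 * x * ∑ α, ∑ j, a α j * b α j + ∑ α, ∑ j, b α j ^ 2 := by
    simp only [Finset.sum_add_distrib, Finset.mul_sum, mul_assoc]
  change 0 ≤ _ - ∑ α, ∑ j, (2 * x * a α j * b α j + b α j ^ 2)
  rw [hfin]
  linarith

end WeylRep

/-- The inner products between eigenvectors and their images under the operators of a Weyl
representation, together with the relations they satisfy up to an error `δ`. Here `lam` are the
eigenvalues below the threshold `Z`, `a`, `t`, `β` are the matrices of the coordinates, of the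
partial derivatives `d` and of `f₁ • B d + f₂ • B² d`, `μ i s` is the value of `Q s` at the `i`-th
eigenvector, and `rem i` is the energy of the part of its coordinate multiples that is
orthogonal to all the eigenvectors. -/
structure SpectralData (n m k : ℕ) (f₁ f₂ Z : ℝ) (lam : Fin k → ℝ) (δ : ℝ)
    (a β t : Fin n → Fin k → Fin k → ℝ) (μ : Fin k → ℕ → ℝ) (rem : Fin k → ℝ) : Prop where
  μ_one : ∀ i, μ i 1 = 1
  μ_top : ∀ i, |μ i (m + 1) - lam i| ≤ δ
  μ_nonneg : ∀ i s, 0 ≤ μ i s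
  μ_log : ∀ i s, s + 1 ≤ m → μ i (s + 1) ^ 2 ≤ μ i s * μ i (s + 2)
  a_sub : ∀ α i j, a α i j - a α j i = 2 * t α i j
  t_anti : ∀ α i j, t α j i = -t α i j
  β_anti : ∀ α i j, β α j i = -β α i j
  gram : ∀ i x y τ, 0 ≤ x ^ 2 * rem i
      - x * y * (f₁ * (n + 2) * μ i 1 + f₂ * (n + 4) * μ i 2)
      + x * τ * (n * μ i 0)
      + y ^ 2 * (f₁ ^ 2 * μ i 2 + 2 * f₁ * f₂ * μ i 3 + f₂ ^ 2 * μ i 4)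
      - 2 * y * τ * (f₁ * μ i 1 + f₂ * μ i 2) + τ ^ 2 * μ i 0
      - ∑ α, ∑ j, (2 * x * a α i j * (y * β α i j + τ * t α i j) +
          (y * β α i j + τ * t α i j) ^ 2)
  rem_le : ∀ i, (Z - lam i) * rem i ≤ (m + 1) * (n + 2 * m) * μ i m - n * lam i * μ i 0
      - ∑ α, ∑ j, (lam j - lam i) * a α i j ^ 2 + δ
  rel : m = 1 → ∀ α i j,
    |f₁ * ((lam j - lam i) * a α i j + 2 * lam i * t α i j) + 4 * β α i j| ≤ δ

namespace WeylRep

variable {n : ℕ} {T : Type*} [NormedAddCommGroup T] [InnerProductSpace ℝ T] {W : WeylRep n T}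
variable {m : ℕ} {Λ : ℕ → ℝ}

lemma Q_le_top [NeZero n] {s l : ℕ} (hs : s ≤ l) (f : T) :
    W.Q s f f ≤ (1 + 4 * W.R ^ 2) ^ l * W.Q l f f := by
  have hR : 0 ≤ W.R ^ 2 := sq_nonneg _
  obtain ⟨r, rfl⟩ := Nat.exists_eq_add_of_le hs
  have h1 : W.Q s f f ≤ (1 + 4 * W.R ^ 2) ^ r * W.Q (s + r) f f := by
    clear hs
    induction r with
    | zero => simp
    | succ r ih =>
      refine ih.trans ?_
      rw [pow_succ (1 + 4 * W.R ^ 2), mul_assoc]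
      refine mul_le_mul_of_nonneg_left ?_ (by positivity)
      have h2 := W.Q_le_succ (s + r) f
      have h3 := W.Q_self_nonneg (s + r + 1) f
      rw [← add_assoc]
      linarith
  refine h1.trans (mul_le_mul_of_nonneg_right ?_ (W.Q_self_nonneg _ _))
  exact pow_le_pow_right₀ (by linarith) (by omega)

/-- Bounds for the entries of the data attached to approximate eigenvectors. -/
structure DataBounded (n k : ℕ) (bd : ℝ)
    (a β t : Fin n → Fin k → Fin k → ℝ) (μ : Fin k → ℕ → ℝ) (rem : Fin k → ℝ) : Prop where
  a : ∀ α i j, |a α i j| ≤ bd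
  β : ∀ α i j, |β α i j| ≤ bd
  t : ∀ α i j, |t α i j| ≤ bd
  μ : ∀ i s, |μ i s| ≤ bd
  rem : ∀ i, |rem i| ≤ bd

lemma abs_Q_le (s : ℕ) {f g : T} {b : ℝ} (hb : 0 ≤ b) (hf : W.Q s f f ≤ b) (hg : W.Q s g g ≤ b) :
    |W.Q s f g| ≤ b := by
  refine abs_le_of_sq_le_sq ((W.Q_cauchy_schwarz s f g).trans ?_) hb
  rw [sq]
  exact mul_le_mul hf hg (W.Q_self_nonneg _ _) hb

set_option maxHeartbeats 1000000 in
theorem IsMinMax.exists_spectralData [NeZero n] (hΛ : W.IsMinMax m Λ) (hm : 1 ≤ m) (k : ℕ)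
    (f₁ f₂ : ℝ) (hf : f₂ = 0 ∨ 3 ≤ m) :
    ∃ bd, ∀ δ > 0, ∃ a β t μ rem, SpectralData n m k f₁ f₂ (Λ (k + 1)) (fun i => Λ (i + 1)) δ
      a β t μ rem ∧ DataBounded n k bd a β t μ rem := by
  obtain ⟨C, hC, hCx⟩ := W.exists_Q_x_le (m + 1)
  set P := (1 + 4 * W.R ^ 2) ^ (m + 1) with hP
  have hP0 : 0 ≤ P := by positivity
  have hPQ : ∀ s ≤ m + 1, ∀ f, W.Q s f f ≤ P * W.Q (m + 1) f f := fun s hs f => Q_le_top hs f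
  obtain ⟨M₁, hM₁0, hM₁⟩ : ∃ M, 0 ≤ M ∧ ∀ i ≤ k, Λ (i + 1) + 1 ≤ M := by
    refine ⟨∑ i ∈ Finset.range (k + 1), (|Λ (i + 1)| + 1), by positivity, ?_⟩
    intro i hi
    have h1 := Finset.single_le_sum (f := fun i => |Λ (i + 1)| + 1)
      (fun i _ => by positivity) (Finset.mem_range.2 (Nat.lt_succ_of_le hi))
    have h2 := le_abs_self (Λ (i + 1))
    linarith
  set b := P * ((C + 1) * M₁) with hb
  have hb0 : 0 ≤ b := by positivity
  set M := M₁ + C * M₁ + C * (C * M₁) + (2 * (C * M₁) + 2 * ((M₁ + k) * b)) with hM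
  have hMle : M₁ ≤ M ∧ C * M₁ ≤ M ∧ C * (C * M₁) ≤ M ∧ 2 * (C * M₁) + 2 * ((M₁ + k) * b) ≤ M := by
    have h1 : 0 ≤ C * M₁ := by positivity
    have h2 : 0 ≤ C * (C * M₁) := by positivity
    have h3 : 0 ≤ (M₁ + k) * b := by positivity
    refine ⟨?_, ?_, ?_, ?_⟩ <;> linarith
  refine ⟨(1 + |f₁| + |f₂| + n) * (b + 1), fun δ hδ => ?_⟩
  set H := (k + 2) * (n * b) + n + n * (k * ((b + 1) * 2)) + 2 * |f₁| + 1 with hH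
  have hH0 : 0 < H := by positivity
  set ε := min 1 (δ / H) with hε
  have hε0 : 0 < ε := by positivity
  have hε1 : ε ≤ 1 := min_le_left _ _
  have hεH : H * ε ≤ δ := by
    have : ε ≤ δ / H := min_le_right _ _
    rwa [le_div_iff₀ hH0, mul_comm] at this
  obtain ⟨w, hw⟩ := hΛ.exists_isApproxEigen k M ε hε0
  set u : Fin k → T := fun i => w i with hu
  have ho : ∀ i j, W.Q 1 (u i) (u j) = if i = j then 1 else 0 := by
    intro i j
    rw [hu, hw.ortho i i.2 j j.2]
    simp [Fin.ext_iff]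
  have hA : ∀ i, W.Q (m + 1) (u i) (u i) ≤ M₁ := fun i =>
    (hw.le i i.2).trans (by linarith [hM₁ i i.2.le])
  have hAx : ∀ α i, W.Q (m + 1) (W.x α (u i)) (W.x α (u i)) ≤ C * M₁ := fun α i =>
    (hCx α _).trans (by gcongr; exact hA i)
  have hAxx : ∀ α i, W.Q (m + 1) (W.x α (W.x α (u i))) (W.x α (W.x α (u i))) ≤ C * (C * M₁) :=
    fun α i => (hCx α _).trans (by gcongr; exact hAx α i)
  have heig : ∀ i v, W.Q (m + 1) v v ≤ M →
      |W.Q (m + 1) (u i) v - Λ (i + 1) * W.Q 1 (u i) v| ≤ ε := fun i v hv =>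
    hw.eigen i i.2 v hv
  have hbu : ∀ s ≤ m + 1, ∀ i, W.Q s (u i) (u i) ≤ b := fun s hs i =>
    (hPQ s hs _).trans (by
      rw [hb]; gcongr; have := hA i; nlinarith)
  have hbx : ∀ α i, W.Q 1 (W.x α (u i)) (W.x α (u i)) ≤ b := fun α i =>
    (hPQ 1 (by omega) _).trans (by
      rw [hb]; gcongr; have := hAx α i; nlinarith)
  have hbd : ∀ s ≤ m, ∀ α i, W.Q s (W.d α (u i)) (W.d α (u i)) ≤ b := fun s hs α i =>
    (W.Q_d_le s α _).trans (hbu (s + 1) (by omega) i)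
  set a : Fin n → Fin k → Fin k → ℝ := fun α i j => W.Q 1 (W.x α (u i)) (u j) with ha
  set t : Fin n → Fin k → Fin k → ℝ := fun α i j => -W.Q 0 (W.d α (u i)) (u j) with ht
  set β : Fin n → Fin k → Fin k → ℝ := fun α i j =>
    f₁ * W.Q 1 (W.d α (u i)) (u j) + f₂ * W.Q 2 (W.d α (u i)) (u j) with hβ
  set μ : Fin k → ℕ → ℝ := fun i s => if s ≤ m + 1 then W.Q s (u i) (u i) else 0 with hμ
  have hμs : ∀ i, ∀ s ≤ m + 1, μ i s = W.Q s (u i) (u i) := fun i s hs => by simp [hμ, hs]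
  set rem : Fin k → ℝ := fun i =>
    ∑ α, W.Q 1 (W.x α (u i)) (W.x α (u i)) - ∑ α, ∑ j, a α i j ^ 2 with hrem
  set Φ : Fin n → Fin k → T := fun α i => W.x α (u i) - ∑ j, a α i j • u j with hΦ
  have hoS : ∀ i ∈ Finset.univ, ∀ j ∈ Finset.univ, W.Q 1 (u i) (u j) = if i = j then 1 else 0 :=
    fun i _ j _ => ho i j
  have hab : ∀ α i j, |a α i j| ≤ b := fun α i j =>
    abs_Q_le 1 hb0 (hbx α i) (hbu 1 (by omega) j)
  have hΦu : ∀ α i j, W.Q 1 (Φ α i) (u j) = 0 := by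
    intro α i j
    simp [hΦ, Q_sub_left, Q_sum_left, Q_smul_left, ho, ha]
  have hxs : ∀ α i, W.Q 1 (W.x α (u i)) (∑ j, a α i j • u j) = ∑ j, a α i j ^ 2 := by
    intro α i
    simp only [Q_sum_right, Q_smul_right, sq]
    rfl
  have hss : ∀ α i, W.Q 1 (∑ j, a α i j • u j) (∑ j, a α i j • u j) = ∑ j, a α i j ^ 2 :=
    fun α i => Q_one_sum_of_ortho Finset.univ u hoS _
  have hDΦ : ∀ α i, W.Q 1 (Φ α i) (Φ α i) =
      W.Q 1 (W.x α (u i)) (W.x α (u i)) - ∑ j, a α i j ^ 2 := by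
    intro α i
    rw [show Φ α i = W.x α (u i) - ∑ j, a α i j • u j from rfl]
    rw [Q_sub_left, Q_sub_right, Q_sub_right, hxs, hss, W.Q_comm 1 (∑ j, _), hxs]
    ring
  have hrem' : ∀ i, rem i = ∑ α, W.Q 1 (Φ α i) (Φ α i) := by
    intro i
    simp only [hDΦ, Finset.sum_sub_distrib, hrem]
  have hrem0 : ∀ i, 0 ≤ rem i := fun i => by
    rw [hrem']; exact Finset.sum_nonneg fun α _ => W.Q_self_nonneg _ _
  have hremb : ∀ i, rem i ≤ n * b := by
    intro i
    have h1 : ∑ α, W.Q 1 (W.x α (u i)) (W.x α (u i)) ≤ n * b := by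
      have := Finset.sum_le_card_nsmul Finset.univ (fun α => W.Q 1 (W.x α (u i)) (W.x α (u i))) b
        fun α _ => hbx α i
      simpa using this
    have h2 : 0 ≤ ∑ α, ∑ j, a α i j ^ 2 := by positivity
    simp only [hrem]
    linarith
  have hAs : ∀ α i, W.Q (m + 1) (∑ j, a α i j • u j) (∑ j, a α i j • u j) ≤ (M₁ + k) * b := by
    intro α i
    have := Q_sum_le_of_ortho (m := m) Finset.univ u hoS (fun i => Λ (i + 1)) ε M₁
      (fun i _ => by linarith [hM₁ i i.2.le])
      (fun i _ j _ => by
        have := heig i (u j) ((hA j).trans hMle.1)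
        rw [ho i j] at this
        simpa using this) (fun j => a α i j)
    refine this.trans (mul_le_mul ?_ ?_ (W.Q_self_nonneg _ _) (by positivity))
    · rw [Finset.card_univ, Fintype.card_fin]
      have : (k : ℝ) * ε ≤ k * 1 := by gcongr
      linarith
    · have h1 := W.Q_self_nonneg 1 (Φ α i)
      rw [hDΦ, ← hss] at h1
      exact (sub_nonneg.1 h1).trans (hbx α i)
  have hAΦ : ∀ α i, W.Q (m + 1) (Φ α i) (Φ α i) ≤ M := by
    intro α i
    have := W.Q_add_self_le (m + 1) (W.x α (u i)) (-∑ j, a α i j • u j)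
    rw [← sub_eq_add_neg] at this
    have h2 : W.Q (m + 1) (-∑ j, a α i j • u j) (-∑ j, a α i j • u j) =
        W.Q (m + 1) (∑ j, a α i j • u j) (∑ j, a α i j • u j) := by
      rw [Q_neg_left, Q_comm, Q_neg_left, neg_neg]
    have h3 := hAs α i
    have h4 := hAx α i
    exact (this.trans (by linarith)).trans hMle.2.2.2
  have hAΦ' : ∀ α i, W.Q (m + 1) (Φ α i) (Φ α i) ≤ W.Q (m + 1) (W.x α (u i)) (W.x α (u i)) -
      ∑ j : Fin k, Λ (j + 1) * a α i j ^ 2 + k * ((b + 1) * 2) * ε := by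
    intro α i
    have h1 : W.Q (m + 1) (Φ α i) (Φ α i) = W.Q (m + 1) (W.x α (u i)) (W.x α (u i)) -
        ∑ j : Fin k, a α i j * (W.Q (m + 1) (u j) (W.x α (u i)) + W.Q (m + 1) (u j) (Φ α i)) := by
      simp only [mul_add, Finset.sum_add_distrib, ← Q_smul_left, ← Q_sum_left]
      rw [show Φ α i = W.x α (u i) - ∑ j, a α i j • u j from rfl]
      simp only [Q_sub_left, Q_sub_right]
      rw [W.Q_comm _ (W.x α (u i)) (∑ j, _)]
      ring
    have h2 : ∀ j : Fin k, Λ (j + 1) * a α i j ^ 2 - (b + 1) * 2 * ε ≤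
        a α i j * (W.Q (m + 1) (u j) (W.x α (u i)) + W.Q (m + 1) (u j) (Φ α i)) := by
      intro j
      have h3 := heig j (W.x α (u i)) ((hAx α i).trans hMle.2.1)
      have h4 := heig j (Φ α i) (hAΦ α i)
      rw [W.Q_comm 1, hΦu, mul_zero, sub_zero] at h4
      rw [W.Q_comm 1] at h3
      have h5 : |a α i j * ((W.Q (m + 1) (u j) (W.x α (u i)) - Λ (j + 1) * a α i j) +
          W.Q (m + 1) (u j) (Φ α i))| ≤ (b + 1) * (ε + ε) := by
        rw [abs_mul]
        refine mul_le_mul ((hab α i j).trans (by linarith)) ?_ (abs_nonneg _) (by positivity)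
        exact (abs_add_le _ _).trans (add_le_add h3 h4)
      have h6 := neg_abs_le (a α i j * ((W.Q (m + 1) (u j) (W.x α (u i)) - Λ (j + 1) * a α i j) +
          W.Q (m + 1) (u j) (Φ α i)))
      nlinarith
    have h3 := Finset.sum_le_sum fun j (_ : j ∈ Finset.univ) => h2 j
    rw [Finset.sum_sub_distrib, Finset.sum_const, Finset.card_univ, Fintype.card_fin,
      nsmul_eq_mul] at h3
    rw [h1]
    linarith
  refine ⟨a, β, t, μ, rem, ⟨?_, ?_, ?_, ?_, ?_, ?_, ?_, ?_, ?_, ?_⟩, ⟨?_, ?_, ?_, ?_, ?_⟩⟩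
  · intro i
    rw [hμs i 1 (by omega), ho, if_pos rfl]
  · intro i
    have := heig i (u i) ((hA i).trans hMle.1)
    rw [ho, if_pos rfl, mul_one] at this
    rw [hμs i _ le_rfl]
    refine this.trans (le_trans ?_ hεH)
    have h1 : 0 ≤ (k + 2) * (n * b) + n + n * (k * ((b + 1) * 2)) + 2 * |f₁| := by positivity
    have : 1 ≤ H := by rw [hH]; linarith
    nlinarith
  · intro i s
    simp only [hμ]
    split_ifs
    · exact W.Q_self_nonneg _ _
    · rfl
  · intro i s hs
    rw [hμs i _ (by omega), hμs i _ (by omega), hμs i _ (by omega)]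
    exact W.Q_log_convex s _
  · intro α i j
    simp only [ha, ht]
    rw [W.Q_x_left 0 α (u i) (u j), W.Q_comm 1 (W.x α (u j))]
    push_cast
    ring
  · intro α i j
    simp only [ht]
    rw [Q_d_left, W.Q_comm 0 (u j)]
  · intro α i j
    simp only [hβ]
    rw [W.Q_d_left 1 α (u j), W.Q_comm 1 (u j), W.Q_d_left 2 α (u j), W.Q_comm 2 (u j)]
    ring
  · intro i x y τ
    have h1 := W.gram_nonneg f₁ f₂ u ho (u i) x y τ
    have h3 : f₂ * W.Q 3 (u i) (u i) = f₂ * μ i 3 := by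
      rcases hf with h | h
      · simp [h]
      · rw [hμs i 3 (by omega)]
    have h4 : f₂ * W.Q 4 (u i) (u i) = f₂ * μ i 4 := by
      rcases hf with h | h
      · simp [h]
      · rw [hμs i 4 (by omega)]
    have e : f₁ ^ 2 * μ i 2 + 2 * f₁ * f₂ * μ i 3 + f₂ ^ 2 * μ i 4 =
        f₁ ^ 2 * W.Q 2 (u i) (u i) + 2 * f₁ * f₂ * W.Q 3 (u i) (u i) +
          f₂ ^ 2 * W.Q 4 (u i) (u i) := by
      rw [hμs i 2 (by omega)]
      linear_combination (-2 * f₁) * h3 - f₂ * h4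
    rw [e, hμs i 0 (by omega), hμs i 1 (by omega), hμs i 2 (by omega)]
    exact h1
  · intro i
    have hmin : ∀ α, (Λ (k + 1) - (k + 2) * ε) * W.Q 1 (Φ α i) (Φ α i) ≤
        W.Q (m + 1) (Φ α i) (Φ α i) := fun α =>
      hw.min_next hΛ hε0.le (fun i hi => by linarith [hM₁ i hi, hMle.1]) _
        fun j hj => hΦu α i ⟨j, hj⟩
    have h1 := Finset.sum_le_sum fun α (_ : α ∈ Finset.univ) => (hmin α).trans (hAΦ' α i)
    rw [← Finset.mul_sum, ← hrem'] at h1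
    simp only [Finset.sum_add_distrib, Finset.sum_sub_distrib, W.sum_Q_x_x m, Finset.sum_const,
      Finset.card_univ, Fintype.card_fin, nsmul_eq_mul] at h1
    have h2 : W.Q (m + 1) (u i) (∑ α, W.x α (W.x α (u i))) ≤
        Λ (i + 1) * W.Q 1 (u i) (∑ α, W.x α (W.x α (u i))) + n * ε := by
      rw [Q_sum_right, Q_sum_right, Finset.mul_sum]
      have h3 := Finset.sum_le_sum fun α (_ : α ∈ Finset.univ) =>
        sub_le_iff_le_add.1 ((le_abs_self _).trans
          (heig i (W.x α (W.x α (u i))) ((hAxx α i).trans hMle.2.2.1)))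
      rw [Finset.sum_add_distrib, Finset.sum_const, Finset.card_univ, Fintype.card_fin,
        nsmul_eq_mul] at h3
      linarith
    have h3 := W.sum_Q_x_x 0 (u i)
    push_cast at h3
    rw [zero_add] at h3
    have h4 : rem i = ∑ α, W.Q 1 (W.x α (u i)) (W.x α (u i)) - ∑ α, ∑ j, a α i j ^ 2 := rfl
    have h5 : W.Q 1 (u i) (∑ α, W.x α (W.x α (u i))) =
        rem i + ∑ α, ∑ j, a α i j ^ 2 - n * W.Q 0 (u i) (u i) := by
      linarith
    rw [h5] at h2
    have h6 : ∑ α, ∑ j : Fin k, (Λ (j + 1) - Λ (i + 1)) * a α i j ^ 2 =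
        ∑ α, ∑ j : Fin k, Λ (j + 1) * a α i j ^ 2 - Λ (i + 1) * ∑ α, ∑ j, a α i j ^ 2 := by
      simp only [Finset.mul_sum, ← Finset.sum_sub_distrib, sub_mul]
    rw [h6, hμs i m (by omega), hμs i 0 (by omega)]
    have h7 : (k + 2) * ε * rem i ≤ (k + 2) * ε * (n * b) := by gcongr; exact hremb i
    have h8 : ((k + 2) * (n * b) + n + n * (k * ((b + 1) * 2))) * ε ≤ δ := by
      refine le_trans ?_ hεH
      refine mul_le_mul_of_nonneg_right ?_ hε0.le
      rw [hH]; linarith [abs_nonneg f₁]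
    clear_value H ε b M
    linarith
  · intro hm1 α i j
    have hf2 : f₂ = 0 := hf.resolve_right (by omega)
    have h1 := W.Q_x_left m α (u i) (u j)
    have h2 := heig i (W.x α (u j)) ((hAx α j).trans hMle.2.1)
    have h3 := heig j (W.x α (u i)) ((hAx α i).trans hMle.2.1)
    have h4 := W.Q_x_left 0 α (u i) (u j)
    rw [W.Q_comm _ (u j), W.Q_comm _ (u j)] at h3
    subst hm1
    push_cast at h1 h4
    rw [zero_add] at h4
    have e : f₁ * ((Λ (j + 1) - Λ (i + 1)) * a α i j + 2 * Λ (i + 1) * t α i j) + 4 * β α i j =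
        f₁ * ((W.Q (1 + 1) (u i) (W.x α (u j)) - Λ (i + 1) * W.Q 1 (u i) (W.x α (u j))) -
          (W.Q (1 + 1) (W.x α (u i)) (u j) - Λ (j + 1) * W.Q 1 (W.x α (u i)) (u j))) := by
      simp only [ha, ht, hβ, hf2]
      rw [h1, h4]
      ring
    rw [e, abs_mul]
    have h5 := (abs_sub _ _).trans (add_le_add h2 h3)
    calc |f₁| * _ ≤ |f₁| * (ε + ε) := by gcongr
      _ ≤ H * ε := by
          have : 0 ≤ (k + 2) * (n * b) + n + n * (k * ((b + 1) * 2)) + 1 := by positivity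
          rw [hH]
          nlinarith
      _ ≤ δ := hεH
  · exact fun α i j => (hab α i j).trans (by
      have : 0 ≤ (|f₁| + |f₂| + n) * (b + 1) := by positivity
      linarith)
  · intro α i j
    have h1 : |W.Q 1 (W.d α (u i)) (u j)| ≤ b :=
      abs_Q_le 1 hb0 (hbd 1 hm α i) (hbu 1 (by omega) j)
    have h2 : |f₂ * W.Q 2 (W.d α (u i)) (u j)| ≤ |f₂| * b := by
      rcases hf with h | h
      · simp [h]
      · rw [abs_mul]
        gcongr
        exact abs_Q_le 2 hb0 (hbd 2 (by omega) α i) (hbu 2 (by omega) j)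
    have h3 : |f₁ * W.Q 1 (W.d α (u i)) (u j)| ≤ |f₁| * b := by
      rw [abs_mul]; gcongr
    refine (abs_add_le _ _).trans ((add_le_add h3 h2).trans ?_)
    have : 0 ≤ (1 + n) * (b + 1) + |f₁| + |f₂| := by positivity
    nlinarith
  · intro α i j
    have h1 : |W.Q 0 (W.d α (u i)) (u j)| ≤ b :=
      abs_Q_le 0 hb0 (hbd 0 (by omega) α i) (hbu 0 (by omega) j)
    have : 0 ≤ (|f₁| + |f₂| + n) * (b + 1) := by positivity
    simp only [ht, abs_neg]
    linarith
  · intro i s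
    have : 0 ≤ (|f₁| + |f₂| + n) * (b + 1) := by positivity
    simp only [hμ]
    split_ifs with h
    · rw [abs_of_nonneg (W.Q_self_nonneg _ _)]
      linarith [hbu s h i]
    · rw [abs_zero]; positivity
  · intro i
    rw [abs_of_nonneg (hrem0 i)]
    have : 0 ≤ (1 + |f₁| + |f₂|) * (b + 1) + n := by positivity
    linarith [hremb i]

end WeylRep

open Filter Topology in
lemma exists_tendsto_hyperfilter_of_abs_le {f : ℕ → ℝ} {b : ℝ} (h : ∀ N, |f N| ≤ b) :
    ∃ l, Tendsto f (hyperfilter ℕ) (𝓝 l) := by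
  have hc : IsCompact (Set.Icc (-b) b) := isCompact_Icc
  obtain ⟨l, -, hl⟩ := hc.ultrafilter_le_nhds' ((hyperfilter ℕ).map f)
    (Filter.mem_map.2 (Filter.univ_mem' fun N : ℕ => abs_le.1 (h N)))
  exact ⟨l, hl⟩

lemma isClosed_spectralData (n m k : ℕ) (f₁ f₂ Z : ℝ) (lam : Fin k → ℝ) :
    IsClosed {p : (Fin n → Fin k → Fin k → ℝ) × (Fin n → Fin k → Fin k → ℝ) ×
      (Fin n → Fin k → Fin k → ℝ) × (Fin k → ℕ → ℝ) × (Fin k → ℝ) × ℝ |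
      SpectralData n m k f₁ f₂ Z lam p.2.2.2.2.2 p.1 p.2.1 p.2.2.1 p.2.2.2.1 p.2.2.2.2.1} := by
  have e : ∀ δ a β t μ rem, SpectralData n m k f₁ f₂ Z lam δ a β t μ rem ↔
      (∀ i, μ i 1 = 1) ∧ (∀ i, |μ i (m + 1) - lam i| ≤ δ) ∧ (∀ i s, 0 ≤ μ i s) ∧
      (∀ i s, s + 1 ≤ m → μ i (s + 1) ^ 2 ≤ μ i s * μ i (s + 2)) ∧
      (∀ α i j, a α i j - a α j i = 2 * t α i j) ∧ (∀ α i j, t α j i = -t α i j) ∧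
      (∀ α i j, β α j i = -β α i j) ∧
      (∀ i x y τ, 0 ≤ x ^ 2 * rem i
        - x * y * (f₁ * (n + 2) * μ i 1 + f₂ * (n + 4) * μ i 2)
        + x * τ * (n * μ i 0)
        + y ^ 2 * (f₁ ^ 2 * μ i 2 + 2 * f₁ * f₂ * μ i 3 + f₂ ^ 2 * μ i 4)
        - 2 * y * τ * (f₁ * μ i 1 + f₂ * μ i 2) + τ ^ 2 * μ i 0
        - ∑ α, ∑ j, (2 * x * a α i j * (y * β α i j + τ * t α i j) +
            (y * β α i j + τ * t α i j) ^ 2)) ∧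
      (∀ i, (Z - lam i) * rem i ≤ (m + 1) * (n + 2 * m) * μ i m - n * lam i * μ i 0
        - ∑ α, ∑ j, (lam j - lam i) * a α i j ^ 2 + δ) ∧
      (m = 1 → ∀ α i j,
        |f₁ * ((lam j - lam i) * a α i j + 2 * lam i * t α i j) + 4 * β α i j| ≤ δ) :=
    fun δ a β t μ rem => ⟨fun h => ⟨h.1, h.2, h.3, h.4, h.5, h.6, h.7, h.8, h.9, h.10⟩,
      fun ⟨h1, h2, h3, h4, h5, h6, h7, h8, h9, h10⟩ => ⟨h1, h2, h3, h4, h5, h6, h7, h8, h9, h10⟩⟩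
  simp only [e, Set.ofPred_and, Set.ofPred_forall]
  refine IsClosed.inter ?_ <| IsClosed.inter ?_ <| IsClosed.inter ?_ <| IsClosed.inter ?_ <|
    IsClosed.inter ?_ <| IsClosed.inter ?_ <| IsClosed.inter ?_ <| IsClosed.inter ?_ <|
    IsClosed.inter ?_ ?_
  all_goals refine isClosed_iInter fun _ => ?_
  all_goals repeat refine isClosed_iInter fun _ => ?_
  all_goals first
    | exact isClosed_eq (by fun_prop) (by fun_prop)
    | exact isClosed_le (by fun_prop) (by fun_prop)

namespace WeylRep

variable {n : ℕ} {T : Type*} [NormedAddCommGroup T] [InnerProductSpace ℝ T] {W : WeylRep n T}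
variable {m : ℕ} {Λ : ℕ → ℝ}

open Filter Topology in
theorem IsMinMax.exists_spectralData_zero [NeZero n] (hΛ : W.IsMinMax m Λ) (hm : 1 ≤ m) (k : ℕ)
    (f₁ f₂ : ℝ) (hf : f₂ = 0 ∨ 3 ≤ m) :
    ∃ a β t μ rem, SpectralData n m k f₁ f₂ (Λ (k + 1)) (fun i => Λ (i + 1)) 0 a β t μ rem := by
  obtain ⟨bd, h⟩ := hΛ.exists_spectralData hm k f₁ f₂ hf
  choose a β t μ rem h hbd using fun N : ℕ => h (1 / ((N : ℝ) + 1)) Nat.one_div_pos_of_nat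
  choose a' ha using fun α i j => exists_tendsto_hyperfilter_of_abs_le fun N => (hbd N).a α i j
  choose β' hβ using fun α i j => exists_tendsto_hyperfilter_of_abs_le fun N => (hbd N).β α i j
  choose t' ht using fun α i j => exists_tendsto_hyperfilter_of_abs_le fun N => (hbd N).t α i j
  choose μ' hμ using fun i s => exists_tendsto_hyperfilter_of_abs_le fun N => (hbd N).μ i s
  choose r' hr using fun i => exists_tendsto_hyperfilter_of_abs_le fun N => (hbd N).rem i
  have hδ : Tendsto (fun N : ℕ => 1 / ((N : ℝ) + 1)) (hyperfilter ℕ) (𝓝 0) :=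
    tendsto_one_div_add_atTop_nhds_zero_nat.mono_left
      (Nat.cofinite_eq_atTop ▸ hyperfilter_le_cofinite)
  have p3 : ∀ {f : ℕ → Fin n → Fin k → Fin k → ℝ} {l},
      (∀ α i j, Tendsto (fun N => f N α i j) (hyperfilter ℕ) (𝓝 (l α i j))) →
      Tendsto f (hyperfilter ℕ) (𝓝 l) := fun h =>
    tendsto_pi_nhds.2 fun α => tendsto_pi_nhds.2 fun i => tendsto_pi_nhds.2 fun j => h α i j
  have hp := (p3 ha).prodMk_nhds ((p3 hβ).prodMk_nhds ((p3 ht).prodMk_nhds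
    ((tendsto_pi_nhds.2 fun i => tendsto_pi_nhds.2 fun s => hμ i s).prodMk_nhds
      ((tendsto_pi_nhds.2 hr).prodMk_nhds hδ))))
  exact ⟨a', β', t', μ', r', (isClosed_spectralData n m k f₁ f₂ (Λ (k + 1))
    (fun i => Λ (i + 1))).mem_of_tendsto hp (Eventually.of_forall h)⟩

lemma IsMinMax.monotone (hΛ : W.IsMinMax m Λ) {i j : ℕ} (hi : 1 ≤ i) (hij : i ≤ j) :
    Λ i ≤ Λ j := by
  refine le_of_forall_gt_imp_ge_of_dense fun r hr => ?_
  obtain ⟨V, hV, h⟩ := hΛ.exists_of_lt j (hi.trans hij) r hr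
  have : FiniteDimensional ℝ V := Module.finite_of_finrank_pos (by omega)
  set b := Module.finBasisOfFinrankEq ℝ V hV
  have li : LinearIndependent ℝ fun l : Fin i => (b (Fin.castLE hij l) : T) :=
    ((b.linearIndependent.map' V.subtype V.ker_subtype).comp _ (Fin.castLE_injective hij))
  refine hΛ.le_of_forall i hi (Submodule.span ℝ (Set.range fun l : Fin i =>
    (b (Fin.castLE hij l) : T))) r (by rw [finrank_span_eq_card li, Fintype.card_fin]) ?_
  refine fun φ hφ => h φ (Submodule.span_le.2 ?_ hφ)
  rintro _ ⟨l, rfl⟩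
  exact (b _).2

end WeylRep

section scaling

variable {n m k : ℕ} {f₁ f₂ Z : ℝ} {lam : Fin k → ℝ}
  {a β t : Fin n → Fin k → Fin k → ℝ} {μ : Fin k → ℕ → ℝ} {rem : Fin k → ℝ}

lemma SpectralData.scale {σ : ℝ} (hσ : 0 < σ) (hZ : (σ ^ 2) ^ m = Z)
    (h : SpectralData n m k f₁ (f₂ / σ ^ 2) Z lam 0 a β t μ rem) (hm : 1 ≤ m) :
    SpectralData n m k f₁ f₂ 1 (fun i => lam i / Z) 0 (fun α i j => σ * a α i j)
      (fun α i j => β α i j / σ) (fun α i j => σ * t α i j)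
      (fun i s => σ ^ 2 * μ i s / (σ ^ 2) ^ s) (fun i => σ ^ 2 * rem i) := by
  have hZ0 : 0 < Z := hZ ▸ by positivity
  have hq : (0 : ℝ) < σ ^ 2 := by positivity
  constructor
  · intro i
    rw [h.μ_one, pow_one, mul_one, div_self hq.ne']
  · intro i
    have h1 := h.μ_top i
    have h2 : σ ^ 2 * μ i (m + 1) / (σ ^ 2) ^ (m + 1) - lam i / Z =
        (μ i (m + 1) - lam i) / Z := by
      rw [← hZ]; field_simp; ring
    rw [h2, abs_div, abs_of_pos hZ0]
    exact div_nonpos_of_nonpos_of_nonneg h1 hZ0.le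
  · intro i s
    have := h.μ_nonneg i s
    positivity
  · intro i s hs
    have := h.μ_log i s hs
    have e1 : (σ ^ 2 * μ i (s + 1) / (σ ^ 2) ^ (s + 1)) ^ 2 =
        (σ ^ 2 / (σ ^ 2) ^ (s + 1)) ^ 2 * μ i (s + 1) ^ 2 := by ring
    have e2 : σ ^ 2 * μ i s / (σ ^ 2) ^ s * (σ ^ 2 * μ i (s + 2) / (σ ^ 2) ^ (s + 2)) =
        (σ ^ 2 / (σ ^ 2) ^ (s + 1)) ^ 2 * (μ i s * μ i (s + 2)) := by
      field_simp
      ring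
    rw [e1, e2]
    gcongr
  · intro α i j
    linear_combination σ * h.a_sub α i j
  · intro α i j
    linear_combination σ * h.t_anti α i j
  · intro α i j
    linear_combination h.β_anti α i j / σ
  · intro i x y τ
    have h1 := h.gram i (σ * x) (y / σ) (σ * τ)
    convert h1 using 1
    have e : ∀ α j, 2 * x * (σ * a α i j) * (y * (β α i j / σ) + τ * (σ * t α i j)) +
        (y * (β α i j / σ) + τ * (σ * t α i j)) ^ 2 =
        2 * (σ * x) * a α i j * (y / σ * β α i j + σ * τ * t α i j) +
        (y / σ * β α i j + σ * τ * t α i j) ^ 2 := fun α j => by ring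
    simp only [e]
    field_simp
  · intro i
    have h1 := h.rem_le i
    have e : ∀ α j, (lam j / Z - lam i / Z) * (σ * a α i j) ^ 2 =
        σ ^ 2 / Z * ((lam j - lam i) * a α i j ^ 2) := fun α j => by ring
    simp only [e, ← Finset.mul_sum]
    have h2 := mul_le_mul_of_nonneg_left h1 (show 0 ≤ σ ^ 2 / Z by positivity)
    refine le_of_eq_of_le ?_ (h2.trans_eq ?_)
    · field_simp
    · rw [← hZ]
      generalize ∑ α, ∑ j, (lam j - lam i) * a α i j ^ 2 = S
      field_simp
      try ring
  · intro hm1 α i j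
    have h1 := h.rel hm1 α i j
    subst hm1
    have e : f₁ * ((lam j / Z - lam i / Z) * (σ * a α i j) + 2 * (lam i / Z) * (σ * t α i j)) +
        4 * (β α i j / σ) =
        (f₁ * ((lam j - lam i) * a α i j + 2 * lam i * t α i j) + 4 * β α i j) / σ := by
      rw [← hZ]; field_simp
    rw [e, abs_div, abs_of_pos hσ]
    exact div_nonpos_of_nonpos_of_nonneg h1 hσ.le

lemma SpectralData.lam_pos (h : SpectralData n m k f₁ f₂ Z lam 0 a β t μ rem) (i : Fin k) :
    0 < lam i := by
  have h1 : ∀ s, s ≤ m → 0 < μ i (s + 1) := by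
    intro s
    induction s with
    | zero => intro _; rw [h.μ_one]; exact one_pos
    | succ s ih =>
      intro hs
      have h1 := ih (by omega)
      have h2 := h.μ_log i s hs
      have h3 := h.μ_nonneg i s
      have h4 : 0 < μ i s * μ i (s + 2) := lt_of_lt_of_le (by positivity) h2
      exact pos_of_mul_pos_right h4 h3
  have h2 := abs_nonpos_iff.1 (h.μ_top i)
  linarith [h1 m le_rfl]

end scaling

namespace WeylRep

variable {n : ℕ} {T : Type*} [NormedAddCommGroup T] [InnerProductSpace ℝ T] {W : WeylRep n T}
variable {m : ℕ} {Λ : ℕ → ℝ}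

lemma IsMinMax.pos [NeZero n] (hΛ : W.IsMinMax m Λ) (hm : 1 ≤ m) {k : ℕ} (hk : 1 ≤ k) :
    0 < Λ k := by
  obtain ⟨a, β, t, μ, rem, h⟩ := hΛ.exists_spectralData_zero hm k 0 0 (.inl rfl)
  have := h.lam_pos ⟨k - 1, by omega⟩
  rwa [show k - 1 + 1 = k by omega] at this

theorem IsMinMax.exists_normalized [NeZero n] (hΛ : W.IsMinMax m Λ) (hm : 1 ≤ m) (k : ℕ)
    (f₁ f₂ : ℝ) (hf : f₂ = 0 ∨ 3 ≤ m) :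
    ∃ a β t μ rem, SpectralData n m k f₁ f₂ 1 (fun i => Λ (i + 1) / Λ (k + 1)) 0 a β t μ rem := by
  have hZ := hΛ.pos hm (Nat.le_add_left 1 k)
  set σ := Λ (k + 1) ^ ((2 * m : ℝ)⁻¹) with hσ
  have hσ0 : 0 < σ := by positivity
  have hσZ : (σ ^ 2) ^ m = Λ (k + 1) := by
    rw [← pow_mul, hσ, ← Real.rpow_natCast, ← Real.rpow_mul hZ.le]
    push_cast
    rw [inv_mul_cancel₀ (by positivity), Real.rpow_one]
  obtain ⟨a, β, t, μ, rem, h⟩ := hΛ.exists_spectralData_zero hm k f₁ (f₂ / σ ^ 2)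
    (hf.imp_left fun h => by simp [h])
  exact ⟨_, _, _, _, _, h.scale hσ0 hσZ hm⟩

end WeylRep

/-- The symmetric matrix `[[p, q, r], [q, s, w], [r, w, z]]` pairs nonnegatively with every
positive semidefinite ternary quadratic form. -/
def IsPSD3 (p q r s w z : ℝ) : Prop :=
  ∀ G₁ G₂ G₃ G₄ G₅ G₆ : ℝ, (∀ x y τ : ℝ, 0 ≤ x ^ 2 * G₁ + x * y * G₂ + x * τ * G₃ + y ^ 2 * G₄ +
    y * τ * G₅ + τ ^ 2 * G₆) → 0 ≤ p * G₁ + q * G₂ + r * G₃ + s * G₄ + w * G₅ + z * G₆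

lemma isPSD3_zero : IsPSD3 0 0 0 0 0 0 := fun _ _ _ _ _ _ _ => by simp

lemma isPSD3_of_schur {p q r s w z : ℝ} (hp : 0 < p) (hA : 0 < p * s - q ^ 2)
    (hAT : (p * w - q * r) ^ 2 ≤ (p * s - q ^ 2) * (p * z - r ^ 2)) : IsPSD3 p q r s w z := by
  intro G₁ G₂ G₃ G₄ G₅ G₆ h
  set A := p * s - q ^ 2 with hAdef
  set E := p * w - q * r with hEdef
  set T := p * z - r ^ 2 with hTdef
  have h1 := h p q r
  have h2 := h 0 A E
  have h3 := h 0 0 1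
  have key : A * p * (p * G₁ + q * G₂ + r * G₃ + s * G₄ + w * G₅ + z * G₆) =
      A * (p ^ 2 * G₁ + p * q * G₂ + p * r * G₃ + q ^ 2 * G₄ + q * r * G₅ + r ^ 2 * G₆) +
      (0 ^ 2 * G₁ + 0 * A * G₂ + 0 * E * G₃ + A ^ 2 * G₄ + A * E * G₅ + E ^ 2 * G₆) +
      (A * T - E ^ 2) * (0 ^ 2 * G₁ + 0 * 0 * G₂ + 0 * 1 * G₃ + 0 ^ 2 * G₄ + 0 * 1 * G₅ +
        1 ^ 2 * G₆) := by
    rw [hAdef, hEdef, hTdef]; ring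
  have h4 : 0 ≤ A * p * (p * G₁ + q * G₂ + r * G₃ + s * G₄ + w * G₅ + z * G₆) := by
    rw [key]
    have := mul_nonneg hA.le h1
    have := mul_nonneg (sub_nonneg.2 hAT) h3
    linarith
  exact nonneg_of_mul_nonneg_right h4 (by positivity)

section multipliers

variable {n m k : ℕ} {f₁ f₂ : ℝ} {lam : Fin k → ℝ}
  {a β t : Fin n → Fin k → Fin k → ℝ} {μ : Fin k → ℕ → ℝ} {rem : Fin k → ℝ}

/-- Weighted sums of the Gram inequalities. -/
theorem SpectralData.sum_nonneg (h : SpectralData n m k f₁ f₂ 1 lam 0 a β t μ rem)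
    (ω v v' u u' u'' : Fin k → ℝ) (hω : ∀ i, 0 ≤ ω i)
    (hM : ∀ i, IsPSD3 ((1 - lam i) * ω i) (v i) (v' i) (u i) (u' i) (u'' i))
    (hP : ∀ i j s b τ, (m = 1 → f₁ * ((lam j - lam i) * s + (lam i + lam j) * τ) + 4 * b = 0) →
      0 ≤ (lam j - lam i) * (ω i * (s + τ) ^ 2 - ω j * (s - τ) ^ 2) +
        2 * b * (v i * (s + τ) - v j * (s - τ)) + 2 * τ * (v' i * (s + τ) - v' j * (s - τ)) +
        (u i + u j) * b ^ 2 + 2 * (u' i + u' j) * b * τ + (u'' i + u'' j) * τ ^ 2) :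
    0 ≤ ∑ i, (ω i * ((m + 1) * (n + 2 * m) * μ i m - n * lam i * μ i 0)
      - v i * (f₁ * (n + 2) + f₂ * (n + 4) * μ i 2) + v' i * (n * μ i 0)
      + u i * (f₁ ^ 2 * μ i 2 + 2 * f₁ * f₂ * μ i 3 + f₂ ^ 2 * μ i 4)
      - 2 * u' i * (f₁ + f₂ * μ i 2) + u'' i * μ i 0) := by
  set F : Fin n → Fin k → Fin k → ℝ := fun α i j =>
    ω i * ((lam j - lam i) * a α i j ^ 2) + v i * (2 * a α i j * β α i j) +
      v' i * (2 * a α i j * t α i j) + u i * β α i j ^ 2 + u' i * (2 * β α i j * t α i j) +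
      u'' i * t α i j ^ 2 with hF
  have hi : ∀ i, ∑ α, ∑ j, F α i j ≤
      ω i * ((m + 1) * (n + 2 * m) * μ i m - n * lam i * μ i 0)
      - v i * (f₁ * (n + 2) + f₂ * (n + 4) * μ i 2) + v' i * (n * μ i 0)
      + u i * (f₁ ^ 2 * μ i 2 + 2 * f₁ * f₂ * μ i 3 + f₂ ^ 2 * μ i 4)
      - 2 * u' i * (f₁ + f₂ * μ i 2) + u'' i * μ i 0 := by
    intro i
    have h1 := mul_le_mul_of_nonneg_left (h.rem_le i) (hω i)
    have h2 := hM i (rem i)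
      (-(f₁ * (n + 2) * μ i 1 + f₂ * (n + 4) * μ i 2) - ∑ α, ∑ j, 2 * a α i j * β α i j)
      (n * μ i 0 - ∑ α, ∑ j, 2 * a α i j * t α i j)
      (f₁ ^ 2 * μ i 2 + 2 * f₁ * f₂ * μ i 3 + f₂ ^ 2 * μ i 4 - ∑ α, ∑ j, β α i j ^ 2)
      (-(2 * (f₁ * μ i 1 + f₂ * μ i 2)) - ∑ α, ∑ j, 2 * β α i j * t α i j)
      (μ i 0 - ∑ α, ∑ j, t α i j ^ 2) (by
        intro x y τ
        have h3 := h.gram i x y τ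
        have h4 : ∑ α, ∑ j, (2 * x * a α i j * (y * β α i j + τ * t α i j) +
            (y * β α i j + τ * t α i j) ^ 2) =
            x * y * ∑ α, ∑ j, 2 * a α i j * β α i j + x * τ * ∑ α, ∑ j, 2 * a α i j * t α i j +
            y ^ 2 * ∑ α, ∑ j, β α i j ^ 2 + y * τ * ∑ α, ∑ j, 2 * β α i j * t α i j +
            τ ^ 2 * ∑ α, ∑ j, t α i j ^ 2 := by
          simp only [Finset.mul_sum, ← Finset.sum_add_distrib]
          exact Finset.sum_congr rfl fun α _ => Finset.sum_congr rfl fun j _ => by ring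
        rw [h4] at h3
        linarith)
    have h5 : ∑ α, ∑ j, F α i j = ω i * ∑ α, ∑ j, (lam j - lam i) * a α i j ^ 2 +
        v i * ∑ α, ∑ j, 2 * a α i j * β α i j + v' i * ∑ α, ∑ j, 2 * a α i j * t α i j +
        u i * ∑ α, ∑ j, β α i j ^ 2 + u' i * ∑ α, ∑ j, 2 * β α i j * t α i j +
        u'' i * ∑ α, ∑ j, t α i j ^ 2 := by
      simp only [Finset.mul_sum, ← Finset.sum_add_distrib, hF]
    rw [h.μ_one] at h2
    rw [h5]
    linarith
  refine le_trans ?_ (Finset.sum_le_sum fun i _ => hi i)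
  rw [Finset.sum_comm]
  refine Finset.sum_nonneg fun α _ => ?_
  have hsymm : ∑ i, ∑ j, F α i j = ∑ i, ∑ j, F α j i := Finset.sum_comm
  have h0 : 0 ≤ ∑ i, ∑ j, (F α i j + F α j i) := by
    refine Finset.sum_nonneg fun i _ => Finset.sum_nonneg fun j _ => ?_
    have h1 := h.a_sub α i j
    have h2 := h.t_anti α i j
    have h3 := h.β_anti α i j
    have h4 := hP i j (a α i j - t α i j) (β α i j) (t α i j) (by
      intro hm
      have h5 := abs_nonpos_iff.1 (h.rel hm α i j)
      linear_combination h5)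
    have h5 : a α j i = (a α i j - t α i j) - t α i j := by linarith
    simp only [hF]
    rw [h2, h3, h5]
    exact h4.trans_eq (by ring)
  simp only [Finset.sum_add_distrib] at h0
  linarith

end multipliers

lemma le_of_convex_seq {N : ℕ} {c : ℕ → ℝ} (h : ∀ s, s + 2 ≤ N → 2 * c (s + 1) ≤ c s + c (s + 2))
    {j : ℕ} (hj : j ≤ N) : N * c j ≤ (N - j) * c 0 + j * c N := by
  have mono : ∀ r s, s + r + 1 ≤ N → c (s + 1) - c s ≤ c (s + r + 1) - c (s + r) := by
    intro r s
    induction r with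
    | zero => intro _; simp
    | succ r ih =>
      intro hr
      have h1 := h (s + r) (by omega)
      have h2 := ih (by omega)
      rw [show s + (r + 1) + 1 = s + r + 2 by ring, show s + (r + 1) = s + r + 1 by ring]
      linarith
  rcases hj.eq_or_lt with rfl | hjN
  · simp
  have up : ∀ r, j + r ≤ N → (r : ℝ) * (c (j + 1) - c j) ≤ c (j + r) - c j := by
    intro r
    induction r with
    | zero => intro _; simp
    | succ r ih =>
      intro hr
      have h1 := mono r j (by omega)
      have h2 := ih (by omega)
      rw [show j + (r + 1) = j + r + 1 by ring]
      push_cast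
      linarith
  have down : ∀ r, r ≤ j → c r - c 0 ≤ r * (c (j + 1) - c j) := by
    intro r
    induction r with
    | zero => intro _; simp
    | succ r ih =>
      intro hr
      have h1 := mono (j - r) r (by omega)
      rw [show r + (j - r) = j by omega] at h1
      have h2 := ih (by omega)
      push_cast
      linarith
  have h1 := down j le_rfl
  have h2 := up (N - j) (by omega)
  rw [show j + (N - j) = N by omega, Nat.cast_sub hj] at h2
  have h3 : (j : ℝ) ≤ N := by exact_mod_cast hj
  have h4 := mul_le_mul_of_nonneg_left h1 (sub_nonneg.2 h3)
  have h5 := mul_le_mul_of_nonneg_left h2 (Nat.cast_nonneg (α := ℝ) j)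
  linarith

section longRange

variable {n m k : ℕ} {f₁ f₂ : ℝ} {lam : Fin k → ℝ}
  {a β t : Fin n → Fin k → Fin k → ℝ} {μ : Fin k → ℕ → ℝ} {rem : Fin k → ℝ}

lemma SpectralData.μ_interp (h : SpectralData n m k f₁ f₂ 1 lam 0 a β t μ rem) (i : Fin k)
    {p N j : ℕ} (hj : j ≤ N) (hN : p + N ≤ m + 1) {τ : ℝ} (hτ : 0 < τ) :
    N * (τ ^ j * μ i (p + j)) ≤ (N - j) * μ i p + j * (τ ^ N * μ i (p + N)) := by
  have h1 := le_of_convex_seq (c := fun s => τ ^ s * μ i (p + s)) (N := N) (fun s hs => by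
    have h1 := h.μ_log i (p + s) (by omega)
    have h2 : 0 ≤ τ ^ s * μ i (p + s) := mul_nonneg (by positivity) (h.μ_nonneg _ _)
    have h3 : 0 ≤ τ ^ (s + 2) * μ i (p + (s + 2)) := mul_nonneg (by positivity) (h.μ_nonneg _ _)
    have h4 : (τ ^ (s + 1) * μ i (p + (s + 1))) ^ 2 ≤
        (τ ^ s * μ i (p + s)) * (τ ^ (s + 2) * μ i (p + (s + 2))) := by
      have e : (τ ^ s * μ i (p + s)) * (τ ^ (s + 2) * μ i (p + (s + 2))) =
        (τ ^ (s + 1)) ^ 2 * (μ i (p + s) * μ i (p + s + 2)) := by ring_nf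
      rw [e, mul_pow]
      exact mul_le_mul_of_nonneg_left h1 (by positivity)
    refine abs_le_of_sq_le_sq' ?_ (by positivity) |>.2
    nlinarith [sq_nonneg (τ ^ s * μ i (p + s) - τ ^ (s + 2) * μ i (p + (s + 2)))]) hj
  simpa using h1

lemma SpectralData.μ_top_eq (h : SpectralData n m k f₁ f₂ 1 lam 0 a β t μ rem) (i : Fin k) :
    μ i (m + 1) = lam i := sub_eq_zero.1 (abs_nonpos_iff.1 (h.μ_top i))

lemma SpectralData.μ_le_pow (h : SpectralData n m k f₁ f₂ 1 lam 0 a β t μ rem) (hm : 1 ≤ m)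
    (i : Fin k) {r : ℝ} (hr : 0 < r) (hrm : r ^ m = lam i) {j : ℕ} (hj : j ≤ m) :
    μ i (j + 1) ≤ r ^ j := by
  have h1 := h.μ_interp i (p := 1) hj (by omega) (inv_pos.2 hr)
  rw [add_comm 1 m, h.μ_top_eq, h.μ_one, ← hrm, ← mul_pow, inv_mul_cancel₀ hr.ne', one_pow,
    mul_one, mul_one, sub_add_cancel, add_comm 1 j] at h1
  have hm0 : (0 : ℝ) < m := by exact_mod_cast hm
  have h2 : (r⁻¹) ^ j * μ i (j + 1) ≤ 1 := by
    refine le_of_mul_le_mul_left ?_ hm0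
    linarith
  rwa [inv_pow, inv_mul_le_iff₀ (by positivity), mul_one] at h2

/-- Log-convexity of `s ↦ μ s` compares `μ 0` with `μ m`. -/
lemma SpectralData.μ_m_le (h : SpectralData n m k f₁ f₂ 1 lam 0 a β t μ rem)
    (i : Fin k) : μ i m ≤ lam i * μ i 0 := by
  have h1 : ∀ s, s ≤ m → μ i s * 1 ≤ μ i (s + 1) * μ i 0 ∧ 0 < μ i (s + 1) := by
    intro s
    induction s with
    | zero => intro _; rw [zero_add, h.μ_one]; simp
    | succ s ih =>
      intro hs
      obtain ⟨h1, h2⟩ := ih (by omega)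
      have h3 := h.μ_log i s hs
      have h4 := h.μ_nonneg i s
      have h5 : 0 < μ i (s + 2) :=
        pos_of_mul_pos_right (lt_of_lt_of_le (by positivity) h3) h4
      refine ⟨?_, h5⟩
      refine le_of_mul_le_mul_left ?_ h2
      nlinarith [mul_le_mul_of_nonneg_right h1 h5.le]
  have := (h1 m le_rfl).1
  rwa [mul_one, h.μ_top_eq] at this

lemma pair_form_nonneg {a c e : ℝ} (he : 0 < e)
    (hT : ∀ D P, 0 ≤ D → D ≤ P → a ^ 2 / 4 * D ^ 2 ≤ e * (P * D + (c - 2 * a) * P * (P + 3 * D) / 4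
      - ((2 - 3 * a) * P + (2 - a) * D) ^ 2 / 16)) {x y : ℝ} (hx : 0 ≤ x) (hy : 0 ≤ y)
    (s B t : ℝ) :
    0 ≤ (x - y) * (x ^ 2 * (s + t) ^ 2 - y ^ 2 * (s - t) ^ 2) +
      2 * B * (x ^ 2 * (s + t) - y ^ 2 * (s - t)) -
      2 * t * (a * x ^ 3 * (s + t) - a * y ^ 3 * (s - t)) +
      (1 + e) * (x + y) * B ^ 2 - 3 * a * (x ^ 2 + y ^ 2) * B * t +
        c * (x ^ 3 + y ^ 3) * t ^ 2 := by
  rcases (add_nonneg hx hy).eq_or_lt with h0 | h0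
  · have hx0 : x = 0 := by linarith
    have hy0 : y = 0 := by linarith
    simp [hx0, hy0]
  have h1 := hT ((x - y) ^ 2) ((x + y) ^ 2) (sq_nonneg _) (by nlinarith [mul_nonneg hx hy])
  refine nonneg_of_mul_nonneg_right (a := e * (x + y)) ?_ (by positivity)
  have key : e * (x + y) * ((x - y) * (x ^ 2 * (s + t) ^ 2 - y ^ 2 * (s - t) ^ 2) +
      2 * B * (x ^ 2 * (s + t) - y ^ 2 * (s - t)) -
      2 * t * (a * x ^ 3 * (s + t) - a * y ^ 3 * (s - t)) +
      (1 + e) * (x + y) * B ^ 2 - 3 * a * (x ^ 2 + y ^ 2) * B * t + c * (x ^ 3 + y ^ 3) * t ^ 2) =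
      e * ((x + y) * ((x - y) * s) + (x + y) * B +
        ((x ^ 2 + y ^ 2) - a * (x ^ 2 + x * y + y ^ 2)) * t) ^ 2 +
      (e * (x + y) * B - a / 2 * (x - y) ^ 2 * t) ^ 2 +
      (e * ((x + y) ^ 2 * (x - y) ^ 2 +
        (c - 2 * a) * (x + y) ^ 2 * ((x + y) ^ 2 + 3 * (x - y) ^ 2) / 4
        - ((2 - 3 * a) * (x + y) ^ 2 + (2 - a) * (x - y) ^ 2) ^ 2 / 16) -
        a ^ 2 / 4 * ((x - y) ^ 2) ^ 2) * t ^ 2 := by ring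
  rw [key]
  have := mul_nonneg (sub_nonneg.2 h1) (sq_nonneg t)
  positivity

/-- The inequality obtained from cubic weights. -/
theorem SpectralData.cubic_weights (h : SpectralData n m k f₁ f₂ 1 lam 0 a β t μ rem)
    {A c e g : ℝ} (he : 0 < e) (hg : 0 < g) (hlam : ∀ i, lam i ≤ 1)
    (hT : ∀ D P, 0 ≤ D → D ≤ P → A ^ 2 / 4 * D ^ 2 ≤ e * (P * D + (c - 2 * A) * P * (P + 3 * D) / 4
      - ((2 - 3 * A) * P + (2 - A) * D) ^ 2 / 16)) (hc : A ^ 2 / 4 ≤ e * (c - A ^ 2))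
    (hn : n * A = c) :
    0 ≤ ∑ i, (1 - lam i) * ((1 - lam i) * ((m + 1) * (n + 2 * m) * μ i m - n * lam i * μ i 0)
      - g * (1 - lam i) * (f₁ * (n + 2 - 3 * A) + f₂ * (n + 4 - 3 * A) * μ i 2)
      + g ^ 2 * (1 + e) * (f₁ ^ 2 * μ i 2 + 2 * f₁ * f₂ * μ i 3 + f₂ ^ 2 * μ i 4)) := by
  have h1 := h.sum_nonneg (fun i => (1 - lam i) ^ 2) (fun i => g * (1 - lam i) ^ 2)
    (fun i => -(A * (1 - lam i) ^ 3)) (fun i => g ^ 2 * (1 + e) * (1 - lam i))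
    (fun i => -(3 / 2 * A * g * (1 - lam i) ^ 2)) (fun i => c * (1 - lam i) ^ 3)
    (fun i => sq_nonneg _) (fun i => ?_) (fun i j s b τ _ => ?_)
  · refine h1.trans_eq (Finset.sum_congr rfl fun i _ => ?_)
    rw [← hn]
    ring
  · rcases (sub_nonneg.2 (hlam i)).eq_or_lt with h0 | h0
    · rw [← h0]
      simpa using isPSD3_zero
    · generalize 1 - lam i = L at h0
      refine isPSD3_of_schur (by positivity) ?_ ?_
      · have : L * L ^ 2 * (g ^ 2 * (1 + e) * L) - (g * L ^ 2) ^ 2 = g ^ 2 * e * L ^ 4 := by ring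
        rw [this]; positivity
      · have e1 : (L * L ^ 2 * -(3 / 2 * A * g * L ^ 2) - g * L ^ 2 * -(A * L ^ 3)) ^ 2 =
            g ^ 2 * L ^ 10 * (A ^ 2 / 4) := by ring
        have e2 : (L * L ^ 2 * (g ^ 2 * (1 + e) * L) - (g * L ^ 2) ^ 2) *
            (L * L ^ 2 * (c * L ^ 3) - (-(A * L ^ 3)) ^ 2) =
            g ^ 2 * L ^ 10 * (e * (c - A ^ 2)) := by ring
        rw [e1, e2]
        gcongr
  · have := pair_form_nonneg he hT (sub_nonneg.2 (hlam i)) (sub_nonneg.2 (hlam j)) s (g * b) τ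
    refine this.trans_eq ?_
    ring

end longRange

section highDimension

variable {n m k : ℕ} {f₁ f₂ : ℝ} {lam : Fin k → ℝ}
  {a β t : Fin n → Fin k → Fin k → ℝ} {μ : Fin k → ℕ → ℝ} {rem : Fin k → ℝ}

/-- A weighted Chebyshev sum inequality. -/
lemma chebyshev_weighted {ι : Type*} [Fintype ι] (L r : ι → ℝ) (hL : ∀ i, 0 ≤ L i)
    (hr : ∀ i, 0 ≤ r i) (hLr : ∀ i j, r i ≤ r j → L j ≤ L i) (p : ℕ) :
    (∑ i, L i ^ 2 * r i ^ p) * (∑ i, L i * r i) ≤ (∑ i, L i ^ 2) * ∑ i, L i * r i ^ (p + 1) := by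
  have key : ∀ i j, 0 ≤ L i * L j * ((r i ^ p - r j ^ p) * (L j * r i - L i * r j)) := by
    intro i j
    refine mul_nonneg (mul_nonneg (hL i) (hL j)) ?_
    rcases le_total (r i) (r j) with h | h
    · refine mul_nonneg_of_nonpos_of_nonpos
        (sub_nonpos.2 (pow_le_pow_left₀ (hr i) h p)) (sub_nonpos.2 ?_)
      exact mul_le_mul (hLr i j h) h (hr i) (hL i)
    · refine mul_nonneg (sub_nonneg.2 (pow_le_pow_left₀ (hr j) h p)) (sub_nonneg.2 ?_)
      exact mul_le_mul (hLr j i h) h (hr j) (hL j)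
  have h1 : 0 ≤ ∑ i, ∑ j, L i * L j * ((r i ^ p - r j ^ p) * (L j * r i - L i * r j)) :=
    Finset.sum_nonneg fun i _ => Finset.sum_nonneg fun j _ => key i j
  have h2 : ∑ i, ∑ j, L i * L j * ((r i ^ p - r j ^ p) * (L j * r i - L i * r j)) =
      2 * ((∑ i, L i ^ 2) * ∑ i, L i * r i ^ (p + 1)) -
        2 * ((∑ i, L i ^ 2 * r i ^ p) * (∑ i, L i * r i)) := by
    have e : ∀ i j, L i * L j * ((r i ^ p - r j ^ p) * (L j * r i - L i * r j)) =
        L j ^ 2 * (L i * r i ^ (p + 1)) + L i ^ 2 * (L j * r j ^ (p + 1)) -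
          (L i ^ 2 * r i ^ p * (L j * r j) + L j ^ 2 * r j ^ p * (L i * r i)) := by
      intro i j; ring
    simp only [e, Finset.sum_sub_distrib, Finset.sum_add_distrib, ← Finset.sum_mul,
      ← Finset.mul_sum]
    ring
  linarith

theorem SpectralData.sq_sum_le_of_three_le
    (h : SpectralData n m k 1 0 1 lam 0 a β t μ rem) (hm : 1 ≤ m) (hn : 3 ≤ n)
    (hlam : ∀ i, lam i ≤ 1) :
    ∑ i, (1 - lam i) ^ 2 ≤ 4 * m * (2 * m + n) / n ^ 2 * ∑ i, (1 - lam i) * lam i := by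
  have hn3 : (3 : ℝ) ≤ n := by exact_mod_cast hn
  have hm1 : (1 : ℝ) ≤ m := by exact_mod_cast hm
  have hn0 : (0 : ℝ) < n := by linarith
  have hn2 : (0 : ℝ) < n ^ 2 - 1 := by nlinarith
  set A : ℝ := 1 / n with hA
  have hAn : n * A = 1 := by rw [hA]; field_simp
  have hA0 : 0 < A := by positivity
  have hA1 : A ≤ 1 / 3 := by rw [hA]; gcongr
  have hA2 : 0 < 1 - A ^ 2 := by nlinarith
  set e : ℝ := A ^ 2 / (4 * (1 - A ^ 2)) with he
  have he0 : 0 < e := by positivity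
  have hee : e * (1 - A ^ 2) = A ^ 2 / 4 := by rw [he]; field_simp
  set N : ℝ := n + 2 - 3 * A with hN
  have hN0 : 0 < N := by linarith
  have hL : ∀ i, 0 ≤ 1 - lam i := fun i => sub_nonneg.2 (hlam i)
  set r : Fin k → ℝ := fun i => lam i ^ ((m : ℝ)⁻¹) with hr
  have hr0 : ∀ i, 0 < r i := fun i => Real.rpow_pos_of_pos (h.lam_pos i) _
  have hrm : ∀ i, r i ^ m = lam i := fun i =>
    Real.rpow_inv_natCast_pow (h.lam_pos i).le (by omega)
  set P : ℝ := m * (n + 2 * m + 2) with hP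
  have hP0 : 0 < P := by positivity
  have main : ∀ g > 0, 0 ≤ P * (∑ i, (1 - lam i) ^ 2 * r i ^ (m - 1)) -
      g * N * ∑ i, (1 - lam i) ^ 2 + g ^ 2 * (1 + e) * ∑ i, (1 - lam i) * r i := by
    intro g hg
    have h1 := h.cubic_weights (A := A) (c := 1) he0 hg hlam (fun D P hD hDP => ?_) (by linarith)
      hAn
    · refine h1.trans ?_
      simp only [Finset.mul_sum, ← Finset.sum_sub_distrib, ← Finset.sum_add_distrib]
      refine Finset.sum_le_sum fun i _ => ?_
      have hm' : μ i m ≤ r i ^ (m - 1) := by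
        have := h.μ_le_pow hm i (hr0 i) (hrm i) (j := m - 1) (by omega)
        rwa [show m - 1 + 1 = m by omega] at this
      have h2 : μ i 2 ≤ r i := by
        simpa using h.μ_le_pow hm i (hr0 i) (hrm i) (j := 1) hm
      have h3 := h.μ_m_le i
      have h4 : (m + 1) * (n + 2 * m) * μ i m - n * lam i * μ i 0 ≤ P * r i ^ (m - 1) := by
        have h5 := mul_le_mul_of_nonneg_left h3 hn0.le
        have h6 := mul_le_mul_of_nonneg_left hm' hP0.le
        rw [hP] at h6 ⊢
        linarith
      have h7 := mul_le_mul_of_nonneg_left h4 (mul_nonneg (hL i) (hL i))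
      have h8 := mul_le_mul_of_nonneg_left h2
        (mul_nonneg (hL i) (show 0 ≤ g ^ 2 * (1 + e) by positivity))
      rw [hN]
      linarith
    · have h2 : (1 - A ^ 2) * D ^ 2 ≤ P * D + (1 - 2 * A) * P * (P + 3 * D) / 4
          - ((2 - 3 * A) * P + (2 - A) * D) ^ 2 / 16 := by
        have h3 : D * D ≤ P * D := by gcongr
        have h4 : P * D ≤ P * P := by gcongr; linarith
        have h5 : 0 ≤ 4 * A - 9 * A ^ 2 := by nlinarith
        have h6 : 0 ≤ 5 / 4 - A / 2 - 3 * A ^ 2 / 8 := by nlinarith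
        nlinarith [mul_nonneg h5 (sub_nonneg.2 h4), mul_nonneg h5 (sub_nonneg.2 h3),
          mul_nonneg h6 (sub_nonneg.2 h3)]
      have h3 := mul_le_mul_of_nonneg_left h2 he0.le
      linear_combination h3 - D ^ 2 * hee
  set S := ∑ i, (1 - lam i) ^ 2 with hS
  set X := ∑ i, (1 - lam i) ^ 2 * r i ^ (m - 1) with hX
  set Y := ∑ i, (1 - lam i) * r i with hY
  set U := ∑ i, (1 - lam i) * lam i with hU
  have hch : X * Y ≤ S * U := by
    have := chebyshev_weighted (fun i => 1 - lam i) r hL (fun i => (hr0 i).le)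
      (fun i j hij => by
        have := pow_le_pow_left₀ (hr0 i).le hij m
        rw [hrm, hrm] at this
        linarith) (m - 1)
    rw [show m - 1 + 1 = m by omega] at this
    simpa only [hrm] using this
  have hY0 : 0 ≤ Y := Finset.sum_nonneg fun i _ => mul_nonneg (hL i) (hr0 i).le
  have hU0 : 0 ≤ U := Finset.sum_nonneg fun i _ => mul_nonneg (hL i) (h.lam_pos i).le
  have hS0 : 0 ≤ S := Finset.sum_nonneg fun i _ => sq_nonneg _
  rcases hS0.eq_or_lt with h0 | hS0
  · rw [← h0]; positivity
  have hY1 : 0 < Y := by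
    refine hY0.lt_of_ne' fun hY => ?_
    have h1 := (Finset.sum_eq_zero_iff_of_nonneg fun i _ => mul_nonneg (hL i) (hr0 i).le).1 hY
    refine hS0.ne' (Finset.sum_eq_zero fun i hi => ?_)
    have := (mul_eq_zero.1 (h1 i hi)).resolve_right (hr0 i).ne'
    rw [this]; ring
  have h1 := main (N * S / (2 * (1 + e) * Y)) (by positivity)
  have h2 : N ^ 2 * S ^ 2 ≤ 4 * P * (1 + e) * (X * Y) := by
    have h3 : 0 ≤ (P * X - N * S / (2 * (1 + e) * Y) * N * S +
        (N * S / (2 * (1 + e) * Y)) ^ 2 * (1 + e) * Y) * (4 * (1 + e) * Y) :=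
      mul_nonneg h1 (by positivity)
    have h4 : (P * X - N * S / (2 * (1 + e) * Y) * N * S +
        (N * S / (2 * (1 + e) * Y)) ^ 2 * (1 + e) * Y) * (4 * (1 + e) * Y) =
        4 * P * (1 + e) * (X * Y) - N ^ 2 * S ^ 2 := by
      field_simp
      ring
    linarith
  have h3 : N ^ 2 * S ≤ 4 * P * (1 + e) * U := by
    have h4 := mul_le_mul_of_nonneg_left hch (show 0 ≤ 4 * P * (1 + e) by positivity)
    refine le_of_mul_le_mul_right ?_ hS0
    linarith
  have h4 : 4 * P * (1 + e) ≤ 4 * m * (2 * m + n) / n ^ 2 * N ^ 2 := by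
    have h5 : (n + 2 * m + 2 : ℝ) * n ^ 4 * (4 * n ^ 2 - 3) ≤
        (2 * m + n) * ((n + 3) * (n - 1)) ^ 2 * (4 * (n ^ 2 - 1)) := by
      obtain ⟨ν, hν, e1⟩ : ∃ ν : ℝ, 0 ≤ ν ∧ (n : ℝ) = 3 + ν := ⟨n - 3, by linarith, by ring⟩
      obtain ⟨κ, hκ, e2⟩ : ∃ κ : ℝ, 0 ≤ κ ∧ (m : ℝ) = 1 + κ := ⟨m - 1, by linarith, by ring⟩
      rw [e1, e2, ← sub_nonneg]
      ring_nf
      positivity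
    have e1 : 1 + e = (4 * n ^ 2 - 3) / (4 * (n ^ 2 - 1)) := by
      rw [he, hA]; field_simp; ring
    have e2 : N = (n + 3) * (n - 1) / n := by
      rw [hN, hA]; field_simp; ring
    rw [e1, e2, hP]
    have h6 := mul_le_mul_of_nonneg_left h5
      (show 0 ≤ 4 * m / (n ^ 4 * (4 * (n ^ 2 - 1)) : ℝ) by positivity)
    refine le_of_eq_of_le ?_ (h6.trans_eq ?_)
    · field_simp
    · field_simp
  have h5 := mul_le_mul_of_nonneg_right h4 hU0
  refine le_of_mul_le_mul_left (h3.trans (h5.trans_eq ?_)) (show 0 < N ^ 2 by positivity)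
  ring

end highDimension

section planar

variable {m k : ℕ} {f₁ f₂ : ℝ} {lam : Fin k → ℝ}
  {a β t : Fin 2 → Fin k → Fin k → ℝ} {μ : Fin k → ℕ → ℝ} {rem : Fin k → ℝ}

theorem SpectralData.sq_sum_le_of_parameters (hm : 3 ≤ m)
    (h : SpectralData 2 m k f₁ f₂ 1 lam 0 a β t μ rem) (hlam : ∀ i, lam i ≤ 1)
    (hf₁ : 0 < f₁) (hf₂ : 0 ≤ f₂) {τ σ : ℝ} (hτ : 0 < τ) (hσ : 0 < σ)
    (h2 : 2 * m * (m + 2) * (τ⁻¹) ^ (m - 2) + 9 / 8 * (f₁ ^ 2 * (m - 1) +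
      2 * f₁ * f₂ * (m - 2) * σ⁻¹ + f₂ ^ 2 * (m - 3) * σ⁻¹ ^ 2) ≤ 4 * f₂ * (m - 1))
    (hl : 2 * m * (m + 2) * (m - 2) * τ + 9 / 8 * (2 * f₁ * f₂ * σ ^ (m - 2) +
      2 * f₂ ^ 2 * σ ^ (m - 3)) + 4 * f₂ * (m - 1) ≤ 4 * f₁ * m * (m + 1) * (m - 1)) :
    ∑ i, (1 - lam i) ^ 2 ≤ 2 * m * (m + 1) * ∑ i, (1 - lam i) * lam i := by
  have hm3 : (3 : ℝ) ≤ m := by exact_mod_cast hm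
  have hL : ∀ i, 0 ≤ 1 - lam i := fun i => sub_nonneg.2 (hlam i)
  have h1 := h.cubic_weights (A := 2 / 3) (c := 4 / 3) (e := 1 / 8) (g := 1) (by norm_num)
    (by norm_num) hlam
    (fun D P hD hDP => by nlinarith [mul_le_mul_of_nonneg_right hDP hD]) (by norm_num)
    (by norm_num)
  push_cast at h1
  have h3 : ∀ i, (1 - lam i) * ((1 - lam i) * ((m + 1) * (2 + 2 * m) * μ i m - 2 * lam i * μ i 0)
      - 1 * (1 - lam i) * (f₁ * (2 + 2 - 3 * (2 / 3)) + f₂ * (2 + 4 - 3 * (2 / 3)) * μ i 2)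
      + 1 ^ 2 * (1 + 1 / 8) * (f₁ ^ 2 * μ i 2 + 2 * f₁ * f₂ * μ i 3 + f₂ ^ 2 * μ i 4)) ≤
      (1 - lam i) * (-(2 * f₁) * ((1 - lam i) - 2 * m * (m + 1) * lam i)) := by
    intro i
    refine mul_le_mul_of_nonneg_left ?_ (hL i)
    have hl0 := (h.lam_pos i).le
    have hμ2 := h.μ_nonneg i 2
    have hμm := h.μ_nonneg i m
    have e1 : μ i 2 ≤ 1 := by
      have := h.μ_interp i (p := 1) (N := m) (j := 1) (by omega) (by omega) one_pos
      rw [add_comm 1 m, h.μ_top_eq, h.μ_one] at this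
      norm_num at this
      have h4 := hlam i
      refine le_of_mul_le_mul_left (a := (m : ℝ)) ?_ (by linarith)
      linarith
    have e2 := h.μ_interp i (p := 2) (N := m - 1) (j := m - 2) (by omega) (by omega) hτ
    have e3 := h.μ_interp i (p := 2) (N := m - 1) (j := 1) (by omega) (by omega) hσ
    have e4 := h.μ_interp i (p := 2) (N := m - 1) (j := 2) (by omega) (by omega) hσ
    rw [show 2 + (m - 2) = m by omega, show 2 + (m - 1) = m + 1 by omega, h.μ_top_eq] at e2
    rw [show 2 + (m - 1) = m + 1 by omega, h.μ_top_eq] at e3 e4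
    rw [show m - 1 = (m - 2) + 1 by omega] at e2 e3
    rw [show m - 1 = (m - 3) + 2 by omega] at e4
    push_cast [show 2 ≤ m by omega, hm] at e2 e3 e4
    have e2' : (m - 1) * μ i m ≤ (τ⁻¹) ^ (m - 2) * μ i 2 + (m - 2) * τ * lam i := by
      have h4 := mul_le_mul_of_nonneg_left e2 (show 0 ≤ τ⁻¹ ^ (m - 2) by positivity)
      have h5 : τ⁻¹ ^ (m - 2) * τ ^ (m - 2) = 1 := by
        rw [← mul_pow, inv_mul_cancel₀ hτ.ne', one_pow]
      rw [pow_succ] at h4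
      linear_combination h4 + (-(m - 1) * μ i m + (m - 2) * τ * lam i) * h5
    have e3' : (m - 1) * μ i 3 ≤ (m - 2) * σ⁻¹ * μ i 2 + σ ^ (m - 2) * lam i := by
      have h4 := mul_le_mul_of_nonneg_left e3 (show 0 ≤ σ⁻¹ by positivity)
      have h5 : σ⁻¹ * σ = 1 := inv_mul_cancel₀ hσ.ne'
      rw [pow_succ] at h4
      norm_num at h4
      linear_combination h4 + (-(m - 1) * μ i 3 + σ ^ (m - 2) * lam i) * h5
    have e4' : (m - 1) * μ i 4 ≤ (m - 3) * σ⁻¹ ^ 2 * μ i 2 + 2 * σ ^ (m - 3) * lam i := by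
      have h4 := mul_le_mul_of_nonneg_left e4 (show 0 ≤ σ⁻¹ ^ 2 by positivity)
      have h5 : σ⁻¹ ^ 2 * σ ^ 2 = 1 := by rw [← mul_pow, inv_mul_cancel₀ hσ.ne', one_pow]
      rw [pow_add] at h4
      norm_num at h4
      norm_num at h5 ⊢
      linear_combination h4 + (-(m - 1) * μ i 4 + 2 * σ ^ (m - 3) * lam i) * h5
    have e5 := h.μ_m_le i
    have e6 : (1 - lam i) * (2 * m * (m + 2) * μ i m) ≤ 2 * m * (m + 2) * μ i m := by
      refine mul_le_of_le_one_left (by positivity) (by linarith)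
    have e7 : (1 - lam i) * ((m + 1) * (2 + 2 * m) * μ i m - 2 * lam i * μ i 0) ≤
        2 * m * (m + 2) * μ i m := by
      refine le_trans ?_ e6
      refine mul_le_mul_of_nonneg_left ?_ (hL i)
      linarith
    have e8 : 4 * f₂ * lam i * μ i 2 ≤ 4 * f₂ * lam i :=
      mul_le_of_le_one_right (by positivity) e1
    have key : 2 * m * (m + 2) * μ i m + 9 / 8 * (f₁ ^ 2 * μ i 2 + 2 * f₁ * f₂ * μ i 3 +
        f₂ ^ 2 * μ i 4) ≤ 4 * f₂ * μ i 2 + (4 * f₁ * m * (m + 1) - 4 * f₂) * lam i := by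
      refine le_of_mul_le_mul_left (a := (m - 1 : ℝ)) ?_ (by linarith)
      have g1 := mul_le_mul_of_nonneg_left e2' (show 0 ≤ 2 * m * (m + 2 : ℝ) by positivity)
      have g2 := mul_le_mul_of_nonneg_left e3' (show 0 ≤ 9 / 8 * (2 * f₁ * f₂) by positivity)
      have g3 := mul_le_mul_of_nonneg_left e4' (show 0 ≤ 9 / 8 * f₂ ^ 2 by positivity)
      have g4 := mul_le_mul_of_nonneg_right h2 hμ2
      have g5 := mul_le_mul_of_nonneg_right hl hl0
      linarith
    linarith
  have h4 := h1.trans (Finset.sum_le_sum fun i _ => h3 i)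
  have h5 : ∑ i, (1 - lam i) * (-(2 * f₁) * ((1 - lam i) - 2 * m * (m + 1) * lam i)) =
      2 * f₁ * (2 * m * (m + 1) * ∑ i, (1 - lam i) * lam i - ∑ i, (1 - lam i) ^ 2) := by
    rw [Finset.mul_sum, ← Finset.sum_sub_distrib, Finset.mul_sum]
    exact Finset.sum_congr rfl fun i _ => by ring
  rw [h5] at h4
  exact sub_nonneg.1 (nonneg_of_mul_nonneg_right h4 (by positivity))

end planar

lemma exists_parameters {m : ℕ} (hm : 3 ≤ m) : ∃ f₁ f₂ τ σ : ℝ, 0 < f₁ ∧ 0 ≤ f₂ ∧ 0 < τ ∧ 0 < σ ∧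
    2 * m * (m + 2) * (τ⁻¹) ^ (m - 2) + 9 / 8 * (f₁ ^ 2 * (m - 1) +
      2 * f₁ * f₂ * (m - 2) * σ⁻¹ + f₂ ^ 2 * (m - 3) * σ⁻¹ ^ 2) ≤ 4 * f₂ * (m - 1) ∧
    2 * m * (m + 2) * (m - 2) * τ + 9 / 8 * (2 * f₁ * f₂ * σ ^ (m - 2) +
      2 * f₂ ^ 2 * σ ^ (m - 3)) + 4 * f₂ * (m - 1) ≤ 4 * f₁ * m * (m + 1) * (m - 1) := by
  rcases le_or_gt m 12 with h | h
  · refine ⟨13 / 10, 14 / 5, 12 / 5, 7 / 5, by norm_num, by norm_num, by norm_num, by norm_num,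
      ?_, ?_⟩ <;> interval_cases m <;> norm_num
  · refine ⟨4 / 5, 11 / 10, 3 / 2, 1, by norm_num, by norm_num, by norm_num, by norm_num, ?_, ?_⟩
    · have key : ∀ p : ℕ, 2 * (p + 13 : ℝ) * (p + 15) * (2 / 3) ^ (p + 11) ≤
          5 := by
        intro p
        induction p with
        | zero => norm_num
        | succ p ih =>
          have h1 : (0 : ℝ) ≤ (2 / 3) ^ (p + 11) := by positivity
          have h2 : (2 / 3 : ℝ) ^ (p + 1 + 11) = (2 / 3) ^ (p + 11) * (2 / 3) := by ring
          rw [h2]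
          push_cast
          have hp : (0 : ℝ) ≤ p := p.cast_nonneg
          nlinarith [mul_nonneg hp h1, mul_nonneg (mul_nonneg hp hp) h1]
      obtain ⟨p, rfl⟩ := Nat.exists_eq_add_of_le h
      have := key p
      rw [show 12 + 1 + p - 2 = p + 11 by omega]
      push_cast
      norm_num
      norm_num at this
      linarith
    · have h3 : (12 : ℝ) < m := by exact_mod_cast h
      obtain ⟨p, hp, e⟩ : ∃ p : ℝ, 0 ≤ p ∧ (m : ℝ) = 12 + p := ⟨m - 12, by linarith, by ring⟩
      simp only [one_pow, e]
      rw [← sub_nonneg]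
      ring_nf
      positivity

lemma ternary_form_nonneg {c A B T W g : ℝ} (hc : 0 < c) (hA : 0 < A)
    (hdet : 0 ≤ A * (T * c - W ^ 2) - B ^ 2 * c) (S b τ : ℝ) :
    0 ≤ c * S ^ 2 + 2 * S * (c * g * b + W * τ) + (A + g ^ 2 * c) * b ^ 2 +
      2 * (B + g * W) * b * τ + T * τ ^ 2 := by
  refine nonneg_of_mul_nonneg_right (a := A * c) ?_ (by positivity)
  have key : A * c * (c * S ^ 2 + 2 * S * (c * g * b + W * τ) + (A + g ^ 2 * c) * b ^ 2 +
      2 * (B + g * W) * b * τ + T * τ ^ 2) = A * (c * (S + g * b) + W * τ) ^ 2 +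
      c * (A * b + B * τ) ^ 2 + (A * (T * c - W ^ 2) - B ^ 2 * c) * τ ^ 2 := by ring
  rw [key]
  positivity

lemma exists_eq_add_div {a c x : ℝ} (ha : a < x) (hb : x ≤ a + c) :
    ∃ p, 0 ≤ p ∧ x = a + c / (1 + p) := by
  refine ⟨c / (x - a) - 1, ?_, ?_⟩
  · rw [sub_nonneg, le_div_iff₀ (by linarith)]; linarith
  · have : x - a ≠ 0 := by linarith
    have : c ≠ 0 := by linarith
    rw [add_sub_cancel, div_div_cancel₀ this]
    ring

private lemma det_nonneg_aux {x s : ℝ} (hx : 0 < x) (hx1 : x ≤ 1) (hs : 0 ≤ s) (hs1 : s ≤ 1) :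
    let y := x * s
    let ω := fun x : ℝ => 9 / 4 * x ^ 2 - 5 / 4 * x ^ 3
    let O := 9 / 4 * (x + y) - 5 / 4 * (x ^ 2 + x * y + y ^ 2)
    let W := ω x + ω y - 2 / 3 * (x ^ 2 + x * y + y ^ 2)
    let A := (x * (31 - 17 * x) + y * (31 - 17 * y)) - 49 / 4 * O
    let u := fun x : ℝ => x ^ 2 * (-7 / 2 + 13 * (1 - x) - 15 * (1 - x) ^ 2)
    let B := 7 / 2 * (ω x + ω y) + u x + u y - 7 / 2 * W
    let T := (x - y) ^ 2 * O + 2 * ((1 - x) * ω x) + 2 * ((1 - y) * ω y)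
    0 ≤ A * (T * O - W ^ 2) - B ^ 2 * O := by
  intro y ω O W A u B T
  simp only [y, O, W, A, u, B, T, ω]
  have hx' : ∃ p, 0 ≤ p ∧ (x = 0 + 1 / 2 / (1 + p) ∨ x = 1 / 2 + 1 / 4 / (1 + p) ∨
      x = 3 / 4 + 1 / 4 / (1 + p)) := by
    rcases le_or_gt x (1 / 2) with h | h
    · obtain ⟨p, hp, h1⟩ := exists_eq_add_div (a := 0) (c := 1 / 2) hx (by linarith)
      exact ⟨p, hp, Or.inl h1⟩
    rcases le_or_gt x (3 / 4) with h' | h'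
    · obtain ⟨p, hp, h1⟩ := exists_eq_add_div (c := 1 / 4) h (by linarith)
      exact ⟨p, hp, Or.inr (Or.inl h1)⟩
    · obtain ⟨p, hp, h1⟩ := exists_eq_add_div (c := 1 / 4) h' (by linarith)
      exact ⟨p, hp, Or.inr (Or.inr h1)⟩
  obtain ⟨p, hp, hx'⟩ := hx'
  rcases hs.eq_or_lt with rfl | hs
  · rcases hx' with rfl | rfl | rfl <;>
    · field_simp
      ring_nf
      positivity
  · obtain ⟨q, hq, rfl⟩ := exists_eq_add_div (a := 0) (c := 1) hs (by linarith)
    rcases hx' with rfl | rfl | rfl <;>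
    · field_simp
      ring_nf
      positivity

private lemma pair_nonneg_aux {x y : ℝ} (hx : 0 ≤ x) (hy : 0 ≤ y) (hx1 : x ≤ 1) (hy1 : y ≤ 1)
    (s b τ : ℝ) :
    let ω := fun x : ℝ => 9 / 4 * x ^ 2 - 5 / 4 * x ^ 3
    let u := fun x : ℝ => x * (31 - 17 * x)
    let u' := fun x : ℝ => x ^ 2 * (-7 / 2 + 13 * (1 - x) - 15 * (1 - x) ^ 2)
    let u'' := fun x : ℝ => 4 / 3 * x ^ 3 + 2 * (1 - x) * ω x
    0 ≤ (x - y) * (ω x * (s + τ) ^ 2 - ω y * (s - τ) ^ 2) +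
      2 * b * (7 / 2 * ω x * (s + τ) - 7 / 2 * ω y * (s - τ)) +
      2 * τ * (-(2 / 3) * x ^ 3 * (s + τ) - (-(2 / 3) * y ^ 3) * (s - τ)) +
      (u x + u y) * b ^ 2 + 2 * (u' x + u' y) * b * τ + (u'' x + u'' y) * τ ^ 2 := by
  wlog hxy : y ≤ x generalizing x y b τ
  · have := this hy hx hy1 hx1 (-b) (-τ) (le_of_not_ge hxy)
    intro ω u u' u''
    refine this.trans_eq ?_
    simp only [ω, u, u', u'']
    ring
  intro ω u u' u''
  rcases hx.eq_or_lt with rfl | hx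
  · have : y = 0 := le_antisymm hxy hy
    simp [this, ω, u, u', u'']
  have hdet := det_nonneg_aux hx hx1 (s := y / x) (by positivity) ((div_le_one hx).2 hxy)
  simp only [mul_div_cancel₀ y hx.ne'] at hdet
  have h1 : y ^ 2 ≤ x * y := by nlinarith
  have h2 : x * y ≤ y := by nlinarith
  have h3 : x ^ 2 ≤ x := by nlinarith
  refine (ternary_form_nonneg (g := 7 / 2) ?_ ?_ hdet ((x - y) * s) b τ).trans_eq ?_
  · linarith
  · linarith [mul_nonneg hx.le hy]
  · simp only [ω, u, u', u'']
    ring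

private lemma psd_aux {L : ℝ} (hL : 0 ≤ L) (hL1 : L ≤ 1) :
    IsPSD3 (L * (9 / 4 * L ^ 2 - 5 / 4 * L ^ 3)) (7 / 2 * (9 / 4 * L ^ 2 - 5 / 4 * L ^ 3))
      (-(2 / 3) * L ^ 3) (L * (31 - 17 * L))
      (L ^ 2 * (-7 / 2 + 13 * (1 - L) - 15 * (1 - L) ^ 2))
      (4 / 3 * L ^ 3 + 2 * (1 - L) * (9 / 4 * L ^ 2 - 5 / 4 * L ^ 3)) := by
  rcases hL.eq_or_lt with rfl | hL
  · simpa using isPSD3_zero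
  refine isPSD3_of_schur ?_ ?_ ?_
  · nlinarith [pow_pos hL 3]
  · obtain ⟨p, hp, rfl⟩ := exists_eq_add_div (a := 0) (c := 1) hL (by linarith)
    field_simp
    ring_nf
    positivity
  · rw [← sub_nonneg]
    rcases le_or_gt L (1 / 2) with h | h
    · obtain ⟨p, hp, rfl⟩ := exists_eq_add_div (a := 0) (c := 1 / 2) hL (by linarith)
      field_simp
      ring_nf
      positivity
    · obtain ⟨p, hp, rfl⟩ := exists_eq_add_div (c := 1 / 2) h (by linarith)
      field_simp
      ring_nf
      positivity

private lemma total_aux {y : ℝ} (hy : 0 < y) (hy1 : y ≤ 1) :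
    (1 - y ^ 2) * (18 * y * (1 + 5 / 4 * y ^ 2) - 14 * (1 + 5 / 4 * y ^ 2) -
      2 * (-7 / 2 + 13 * y ^ 2 - 15 * (y ^ 2) ^ 2)) + (14 + 17 * y ^ 2) * y ≤
      -(31 / 10) * (1 - y ^ 2 - 12 * y ^ 2) := by
  rw [← sub_nonneg]
  rcases le_or_gt y (1 / 2) with h | h
  · rcases le_or_gt y (1 / 4) with h' | h'
    · obtain ⟨p, hp, rfl⟩ := exists_eq_add_div (a := 0) (c := 1 / 4) hy (by linarith)
      field_simp
      ring_nf
      positivity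
    · obtain ⟨p, hp, rfl⟩ := exists_eq_add_div (c := 1 / 4) h' (by linarith)
      field_simp
      ring_nf
      positivity
  · obtain ⟨p, hp, rfl⟩ := exists_eq_add_div (c := 1 / 2) h (by linarith)
    field_simp
    ring_nf
    positivity

theorem SpectralData.sq_sum_le_two_two {k : ℕ} {lam : Fin k → ℝ}
    {a β t : Fin 2 → Fin k → Fin k → ℝ} {μ : Fin k → ℕ → ℝ} {rem : Fin k → ℝ}
    (h : SpectralData 2 2 k 1 0 1 lam 0 a β t μ rem) (hlam : ∀ i, lam i ≤ 1) :
    ∑ i, (1 - lam i) ^ 2 ≤ 12 * ∑ i, (1 - lam i) * lam i := by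
  have hL0 : ∀ i, 0 ≤ 1 - lam i := fun i => sub_nonneg.2 (hlam i)
  have hL1 : ∀ i, 1 - lam i ≤ 1 := fun i => by linarith [h.lam_pos i]
  set ω : ℝ → ℝ := fun x => 9 / 4 * x ^ 2 - 5 / 4 * x ^ 3 with hω
  set u : ℝ → ℝ := fun x => x * (31 - 17 * x) with hu
  set u' : ℝ → ℝ := fun x => x ^ 2 * (-7 / 2 + 13 * (1 - x) - 15 * (1 - x) ^ 2) with hu'
  have h1 := h.sum_nonneg (fun i => ω (1 - lam i)) (fun i => 7 / 2 * ω (1 - lam i))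
    (fun i => -(2 / 3) * (1 - lam i) ^ 3) (fun i => u (1 - lam i)) (fun i => u' (1 - lam i))
    (fun i => 4 / 3 * (1 - lam i) ^ 3 + 2 * (1 - (1 - lam i)) * ω (1 - lam i))
    (fun i => ?_) (fun i => psd_aux (hL0 i) (hL1 i)) (fun i j s b τ _ => ?_)
  · have h2 := h1.trans (Finset.sum_le_sum (g := fun i => -(31 / 10) *
        ((1 - lam i) ^ 2 - 12 * ((1 - lam i) * lam i))) fun i _ => ?_)
    · rw [← Finset.mul_sum, Finset.sum_sub_distrib, ← Finset.mul_sum] at h2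
      linarith
    · have hy := Real.sqrt_pos.2 (h.lam_pos i)
      have hy2 := Real.sq_sqrt (h.lam_pos i).le
      have h3 : μ i 2 ≤ √(lam i) := by
        simpa using h.μ_le_pow (by norm_num) i hy hy2 (j := 1) (by norm_num)
      have h4 := total_aux hy (Real.sqrt_le_one.2 (hlam i))
      generalize √(lam i) = y at *
      have h5 := h.lam_pos i
      have h6 := hL0 i
      have h7 : 0 ≤ 18 * ω (1 - lam i) + u (1 - lam i) := by
        have : 18 * ω (1 - lam i) + u (1 - lam i) =
          (1 - lam i) * (18 * (1 - lam i) * (1 + 5 / 4 * lam i) + (14 + 17 * lam i)) := by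
          simp only [hω, hu]; ring
        rw [this]
        positivity
      have h8 := mul_le_mul_of_nonneg_left h3 h7
      have h9 := mul_le_mul_of_nonneg_left h4 h6
      rw [hy2] at h9
      simp only [hω, hu, hu'] at h8 ⊢
      push_cast
      linarith
  · have : ω (1 - lam i) = (1 - lam i) ^ 2 * (1 + 5 / 4 * lam i) := by simp only [hω]; ring
    rw [this]
    have := (h.lam_pos i).le
    positivity
  · refine (pair_nonneg_aux (hL0 i) (hL0 j) (hL1 i) (hL1 j) s b τ).trans_eq ?_
    simp only [hω, hu, hu']
    ring

private lemma det_nonneg_aux' {x s : ℝ} (hx : 0 < x) (hx1 : x ≤ 1) (hs : 0 ≤ s) (hs1 : s ≤ 1) :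
    let y := x * s
    let σ := 2 - x - y
    let V := fun x : ℝ => x ^ 2 * (33 / 10 + 7 / 10 * x)
    let dV := 33 / 10 * (x + y) + 7 / 10 * (x ^ 2 + x * y + y ^ 2)
    let W := x ^ 2 + y ^ 2 - 3 / 10 * (x + y) * (x ^ 2 + y ^ 2)
    let u := fun x : ℝ => x * (12 + 11 * x)
    let u' := fun x : ℝ => x ^ 2 * (21 / 5 - 33 / 5 * x)
    let u'' := fun x : ℝ => x ^ 2 * (7 / 5 - 4 / 5 * x)
    0 ≤ (u x + u y - 8 * dV + 16 * (x + y)) *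
      (σ ^ 2 * (x + y) - 2 * σ * W + (x - y) ^ 2 * (x + y) - 3 / 5 * (x ^ 4 + y ^ 4) +
        u'' x + u'' y) - (σ * (4 * (x + y) - dV) - 4 * W + V x + V y + u' x + u' y) ^ 2 := by
  intro y σ V dV W u u' u''
  simp only [y, σ, V, dV, W, u, u', u'']
  have hx' : ∃ p, 0 ≤ p ∧ (x = 0 + 1 / 2 / (1 + p) ∨ x = 1 / 2 + 1 / 2 / (1 + p)) := by
    rcases le_or_gt x (1 / 2) with h | h
    · obtain ⟨p, hp, h1⟩ := exists_eq_add_div (a := 0) (c := 1 / 2) hx (by linarith)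
      exact ⟨p, hp, Or.inl h1⟩
    · obtain ⟨p, hp, h1⟩ := exists_eq_add_div (c := 1 / 2) h (by linarith)
      exact ⟨p, hp, Or.inr h1⟩
  obtain ⟨p, hp, hx'⟩ := hx'
  rcases hs.eq_or_lt with rfl | hs
  · rcases hx' with rfl | rfl <;>
    · field_simp
      ring_nf
      positivity
  · obtain ⟨q, hq, rfl⟩ := exists_eq_add_div (a := 0) (c := 1) hs (by linarith)
    rcases hx' with rfl | rfl <;>
    · field_simp
      ring_nf
      positivity

private lemma pair_nonneg_aux' {x y : ℝ} (hx : 0 ≤ x) (hy : 0 ≤ y) (hx1 : x ≤ 1) (hy1 : y ≤ 1)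
    {s b τ : ℝ} (hs : (x - y) * s + (2 - x - y) * τ + 4 * b = 0) :
    let V := fun x : ℝ => x ^ 2 * (33 / 10 + 7 / 10 * x)
    let u := fun x : ℝ => x * (12 + 11 * x)
    let u' := fun x : ℝ => x ^ 2 * (21 / 5 - 33 / 5 * x)
    let u'' := fun x : ℝ => x ^ 2 * (7 / 5 - 4 / 5 * x)
    0 ≤ (x - y) * (x ^ 2 * (s + τ) ^ 2 - y ^ 2 * (s - τ) ^ 2) +
      2 * b * (V x * (s + τ) - V y * (s - τ)) +
      2 * τ * (-(3 / 10) * x ^ 4 * (s + τ) - (-(3 / 10) * y ^ 4) * (s - τ)) +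
      (u x + u y) * b ^ 2 + 2 * (u' x + u' y) * b * τ + (u'' x + u'' y) * τ ^ 2 := by
  wlog hxy : y ≤ x generalizing x y s b τ
  · have := this hy hx hy1 hx1 (s := s) (b := -b) (τ := -τ) (by linarith) (le_of_not_ge hxy)
    intro V u u' u''
    refine this.trans_eq ?_
    simp only [V, u, u', u'']
    ring
  intro V u u' u''
  rcases hx.eq_or_lt with rfl | hx
  · have : y = 0 := le_antisymm hxy hy
    simp [this, V, u, u', u'']
  have hdet := det_nonneg_aux' hx hx1 (s := y / x) (by positivity) ((div_le_one hx).2 hxy)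
  simp only [mul_div_cancel₀ y hx.ne'] at hdet
  have hA : 0 < x * (12 + 11 * x) + y * (12 + 11 * y) -
      8 * (33 / 10 * (x + y) + 7 / 10 * (x ^ 2 + x * y + y ^ 2)) + 16 * (x + y) := by
    nlinarith [sq_nonneg (x - y), mul_nonneg hx.le hy]
  refine nonneg_of_mul_nonneg_right (add_nonneg
    (sq_nonneg ((x * (12 + 11 * x) + y * (12 + 11 * y) -
      8 * (33 / 10 * (x + y) + 7 / 10 * (x ^ 2 + x * y + y ^ 2)) + 16 * (x + y)) * b +
      ((2 - x - y) * (4 * (x + y) - (33 / 10 * (x + y) + 7 / 10 * (x ^ 2 + x * y + y ^ 2))) -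
        4 * (x ^ 2 + y ^ 2 - 3 / 10 * (x + y) * (x ^ 2 + y ^ 2)) + V x + V y + u' x + u' y) * τ))
    (mul_nonneg hdet (sq_nonneg τ)) |>.trans_eq ?_) hA
  have e : (x - y) * (x ^ 2 * (s + τ) ^ 2 - y ^ 2 * (s - τ) ^ 2) +
      2 * b * (V x * (s + τ) - V y * (s - τ)) +
      2 * τ * (-(3 / 10) * x ^ 4 * (s + τ) - (-(3 / 10) * y ^ 4) * (s - τ)) =
      (x + y) * ((x - y) * s) ^ 2 + 2 * ((x - y) * s) *
        ((33 / 10 * (x + y) + 7 / 10 * (x ^ 2 + x * y + y ^ 2)) * b +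
        (x ^ 2 + y ^ 2 - 3 / 10 * (x + y) * (x ^ 2 + y ^ 2)) * τ) + 2 * (V x + V y) * b * τ +
        ((x - y) ^ 2 * (x + y) - 3 / 5 * (x ^ 4 + y ^ 4)) * τ ^ 2 := by
    simp only [V]
    ring
  rw [e, show (x - y) * s = -(4 * b + (2 - x - y) * τ) by linarith]
  simp only [V, u, u', u'']
  ring

private lemma psd_aux' {L : ℝ} (hL : 0 ≤ L) (hL1 : L ≤ 1) :
    IsPSD3 (L * L ^ 2) (L ^ 2 * (33 / 10 + 7 / 10 * L)) (-(3 / 10) * L ^ 4) (L * (12 + 11 * L))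
      (L ^ 2 * (21 / 5 - 33 / 5 * L)) (L ^ 2 * (7 / 5 - 4 / 5 * L)) := by
  rcases hL.eq_or_lt with rfl | hL
  · simpa using isPSD3_zero
  refine isPSD3_of_schur (by positivity) ?_ ?_
  · obtain ⟨p, hp, rfl⟩ := exists_eq_add_div (a := 0) (c := 1) hL (by linarith)
    field_simp
    ring_nf
    positivity
  · rw [← sub_nonneg]
    rcases le_or_gt L (1 / 2) with h | h
    · obtain ⟨p, hp, rfl⟩ := exists_eq_add_div (a := 0) (c := 1 / 2) hL (by linarith)
      field_simp
      ring_nf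
      positivity
    · obtain ⟨p, hp, rfl⟩ := exists_eq_add_div (c := 1 / 2) h (by linarith)
      field_simp
      ring_nf
      positivity

theorem SpectralData.sq_sum_le_two_one {k : ℕ} {lam : Fin k → ℝ}
    {a β t : Fin 2 → Fin k → Fin k → ℝ} {μ : Fin k → ℕ → ℝ} {rem : Fin k → ℝ}
    (h : SpectralData 2 1 k 1 0 1 lam 0 a β t μ rem) (hlam : ∀ i, lam i ≤ 1) :
    ∑ i, (1 - lam i) ^ 2 ≤ 4 * ∑ i, (1 - lam i) * lam i := by
  have hL0 : ∀ i, 0 ≤ 1 - lam i := fun i => sub_nonneg.2 (hlam i)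
  have hL1 : ∀ i, 1 - lam i ≤ 1 := fun i => by linarith [h.lam_pos i]
  have h1 := h.sum_nonneg (fun i => (1 - lam i) ^ 2)
    (fun i => (1 - lam i) ^ 2 * (33 / 10 + 7 / 10 * (1 - lam i)))
    (fun i => -(3 / 10) * (1 - lam i) ^ 4) (fun i => (1 - lam i) * (12 + 11 * (1 - lam i)))
    (fun i => (1 - lam i) ^ 2 * (21 / 5 - 33 / 5 * (1 - lam i)))
    (fun i => (1 - lam i) ^ 2 * (7 / 5 - 4 / 5 * (1 - lam i)))
    (fun i => sq_nonneg _) (fun i => psd_aux' (hL0 i) (hL1 i)) (fun i j s b τ hs => ?_)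
  · have h2 := h1.trans (Finset.sum_le_sum (g := fun i => -(16 / 5) *
        ((1 - lam i) ^ 2 - 4 * ((1 - lam i) * lam i))) fun i _ => ?_)
    · rw [← Finset.mul_sum, Finset.sum_sub_distrib, ← Finset.mul_sum] at h2
      linarith
    · have h3 : lam i ≤ lam i ^ 2 * μ i 0 := by
        have := h.μ_log i 0 (by norm_num)
        rw [zero_add, zero_add, h.μ_one, show μ i 2 = lam i from h.μ_top_eq i] at this
        nlinarith [h.lam_pos i]
      have h4 := mul_le_mul_of_nonneg_left h3 (sq_nonneg (1 - lam i))
      have h5 := mul_nonneg (hL0 i) (h.lam_pos i).le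
      rw [h.μ_one, show μ i 2 = lam i from h.μ_top_eq i]
      push_cast
      linarith
  · refine (pair_nonneg_aux' (hL0 i) (hL0 j) (hL1 i) (hL1 j) (s := s) (b := b) (τ := τ)
      ?_).trans_eq ?_
    · linarith [hs rfl]
    · ring

namespace WeylRep

variable {n : ℕ} {T : Type*} [NormedAddCommGroup T] [InnerProductSpace ℝ T] {W : WeylRep n T}
variable {m : ℕ} {Λ : ℕ → ℝ}

theorem IsMinMax.sq_sum_le_normalized (hΛ : W.IsMinMax m Λ) (hn : 2 ≤ n) (hm : 1 ≤ m) (k : ℕ) :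
    ∑ i : Fin k, (1 - Λ (i + 1) / Λ (k + 1)) ^ 2 ≤ 4 * m * (2 * m + n) / n ^ 2 *
      ∑ i : Fin k, (1 - Λ (i + 1) / Λ (k + 1)) * (Λ (i + 1) / Λ (k + 1)) := by
  have : NeZero n := ⟨by omega⟩
  have hlam : ∀ i : Fin k, Λ (i + 1) / Λ (k + 1) ≤ 1 := fun i =>
    (div_le_one (hΛ.pos hm (by omega))).2 (hΛ.monotone (by omega) (by omega))
  rcases hn.eq_or_lt with rfl | hn
  · rcases (show m = 1 ∨ m = 2 ∨ 3 ≤ m by omega) with rfl | rfl | hm3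
    · obtain ⟨a, β, t, μ, rem, h⟩ := hΛ.exists_normalized hm k 1 0 (.inl rfl)
      refine (h.sq_sum_le_two_one hlam).trans_eq ?_
      norm_num
    · obtain ⟨a, β, t, μ, rem, h⟩ := hΛ.exists_normalized hm k 1 0 (.inl rfl)
      refine (h.sq_sum_le_two_two hlam).trans_eq ?_
      norm_num
    · obtain ⟨f₁, f₂, τ, σ, h₁, h₂, h₃, h₄, h₅, h₆⟩ := exists_parameters hm3
      obtain ⟨a, β, t, μ, rem, h⟩ := hΛ.exists_normalized hm k f₁ f₂ (.inr hm3)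
      refine (h.sq_sum_le_of_parameters hm3 hlam h₁ h₂ h₃ h₄ h₅ h₆).trans_eq ?_
      push_cast
      ring
  · obtain ⟨a, β, t, μ, rem, h⟩ := hΛ.exists_normalized hm k 1 0 (.inl rfl)
    exact h.sq_sum_le_of_three_le hm hn hlam

/-- A Yang type inequality for the min–max values. -/
theorem IsMinMax.sq_sum_le (hΛ : W.IsMinMax m Λ) (hn : 2 ≤ n) (hm : 1 ≤ m) (k : ℕ) :
    ∑ i ∈ Finset.Icc 1 k, (Λ (k + 1) - Λ i) ^ 2 ≤ 4 * m * (2 * m + n) / n ^ 2 *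
      ∑ i ∈ Finset.Icc 1 k, (Λ (k + 1) - Λ i) * Λ i := by
  have : NeZero n := ⟨by omega⟩
  have hZ : 0 < Λ (k + 1) := hΛ.pos hm (by omega)
  have h := mul_le_mul_of_nonneg_left (hΛ.sq_sum_le_normalized hn hm k) (sq_nonneg (Λ (k + 1)))
  have e : ∀ g : ℕ → ℝ, ∑ i ∈ Finset.Icc 1 k, g i = ∑ i : Fin k, g (i + 1) := by
    intro g
    rw [Fin.sum_univ_eq_sum_range (fun i => g (i + 1)), Finset.range_eq_Ico,
      Finset.sum_Ico_add' g 0 k 1]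
    rfl
  rw [e, e]
  rw [mul_left_comm, Finset.mul_sum, Finset.mul_sum (s := Finset.univ) (a := Λ (k + 1) ^ 2)] at h
  refine le_of_eq_of_le (Finset.sum_congr rfl fun i _ => ?_) (h.trans_eq ?_)
  · field_simp
  · congr 1
    refine Finset.sum_congr rfl fun i _ => ?_
    field_simp

end WeylRep

lemma le_add_sqrt_of_sq_sum_le {k : ℕ} (hk : 1 ≤ k) {Λ : ℕ → ℝ} {Z K : ℝ}
    (h : ∑ i ∈ Finset.Icc 1 k, (Z - Λ i) ^ 2 ≤ K * ∑ i ∈ Finset.Icc 1 k, (Z - Λ i) * Λ i) :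
    Z ≤ (1 + K / 2) * ((1 / k) * ∑ i ∈ Finset.Icc 1 k, Λ i) +
      √((K / 2 * ((1 / k) * ∑ i ∈ Finset.Icc 1 k, Λ i)) ^ 2 - (1 + K) *
        ((1 / k) * ∑ i ∈ Finset.Icc 1 k,
          (Λ i - (1 / k) * ∑ j ∈ Finset.Icc 1 k, Λ j) ^ 2)) := by
  have hk0 : (0 : ℝ) < k := by exact_mod_cast hk
  set S := (1 / k : ℝ) * ∑ i ∈ Finset.Icc 1 k, Λ i with hS
  have hS' : ∑ i ∈ Finset.Icc 1 k, Λ i = k * S := by rw [hS]; field_simp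
  have e1 : ∑ i ∈ Finset.Icc 1 k, (Z - Λ i) ^ 2 =
      k * (Z - S) ^ 2 + ∑ i ∈ Finset.Icc 1 k, (Λ i - S) ^ 2 := by
    have : ∀ i, (Z - Λ i) ^ 2 = (Λ i - S) ^ 2 + ((Z - S) ^ 2 + 2 * (Z - S) * S) -
      2 * (Z - S) * Λ i := by intro i; ring
    simp only [this, Finset.sum_sub_distrib, Finset.sum_add_distrib, ← Finset.mul_sum, hS',
      Finset.sum_const, Nat.card_Icc, nsmul_eq_mul, Nat.add_sub_cancel]
    ring
  have e2 : ∑ i ∈ Finset.Icc 1 k, (Z - Λ i) * Λ i =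
      k * ((Z - S) * S) - ∑ i ∈ Finset.Icc 1 k, (Λ i - S) ^ 2 := by
    have : ∀ i, (Z - Λ i) * Λ i = (Z - 2 * S) * Λ i + S ^ 2 - (Λ i - S) ^ 2 := by
      intro i; ring
    simp only [this, Finset.sum_sub_distrib, Finset.sum_add_distrib, ← Finset.mul_sum, hS',
      Finset.sum_const, Nat.card_Icc, nsmul_eq_mul, Nat.add_sub_cancel]
    ring
  rw [e1, e2] at h
  set V := ∑ i ∈ Finset.Icc 1 k, (Λ i - S) ^ 2 with hV
  have h1 : (Z - (1 + K / 2) * S) ^ 2 ≤ (K / 2 * S) ^ 2 - (1 + K) * (1 / k * V) := by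
    have h2 : V = k * (1 / k * V) := by field_simp
    rw [h2] at h
    refine le_of_mul_le_mul_left ?_ hk0
    linarith
  linarith [Real.le_sqrt_of_sq_le h1]

/-- The smooth functions with compact support contained in `Ω`. -/
def testSubmodule {n : ℕ} (Ω : Set (EuclideanSpace ℝ (Fin n))) :
    Submodule ℝ (EuclideanSpace ℝ (Fin n) → ℝ) where
  carrier := {f | ContDiff ℝ (⊤ : ℕ∞) f ∧ HasCompactSupport f ∧ tsupport f ⊆ Ω}
  add_mem' := by
    rintro f g ⟨hf, hfc, hfs⟩ ⟨hg, hgc, hgs⟩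
    exact ⟨hf.add hg, hfc.add hgc, (tsupport_add f g).trans (Set.union_subset hfs hgs)⟩
  zero_mem' := ⟨contDiff_const, HasCompactSupport.zero, by simp [tsupport]⟩
  smul_mem' := by
    rintro c f ⟨hf, hfc, hfs⟩
    refine ⟨hf.const_smul c, hfc.smul_left (f := fun _ => c), ?_⟩
    exact (closure_mono (Function.support_const_smul_subset c f)).trans hfs

/-- The space of test functions on `Ω`, with the `L²` inner product. -/
def TestSpace {n : ℕ} (Ω : Set (EuclideanSpace ℝ (Fin n))) : Type := testSubmodule Ω

namespace TestSpace

variable {n : ℕ} {Ω : Set (EuclideanSpace ℝ (Fin n))}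

noncomputable instance instAddCommGroup : AddCommGroup (TestSpace Ω) :=
  inferInstanceAs (AddCommGroup (testSubmodule Ω))

noncomputable instance instModule : Module ℝ (TestSpace Ω) :=
  inferInstanceAs (Module ℝ (testSubmodule Ω))

/-- The inclusion of the test functions into all functions. -/
noncomputable def incl : TestSpace Ω →ₗ[ℝ] (EuclideanSpace ℝ (Fin n) → ℝ) :=
  (testSubmodule Ω).subtype

noncomputable instance : CoeFun (TestSpace Ω) fun _ => EuclideanSpace ℝ (Fin n) → ℝ :=
  ⟨fun f => incl f⟩

lemma incl_injective : Function.Injective (incl (Ω := Ω)) := Subtype.val_injective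

@[ext] lemma ext {f g : TestSpace Ω} (h : ∀ x, f x = g x) : f = g := incl_injective (funext h)

lemma contDiff (f : TestSpace Ω) : ContDiff ℝ (⊤ : ℕ∞) f := f.2.1

lemma hasCompactSupport (f : TestSpace Ω) : HasCompactSupport f := f.2.2.1

lemma tsupport_subset (f : TestSpace Ω) : tsupport f ⊆ Ω := f.2.2.2

/-- A smooth function with compact support in `Ω`, as an element of the test space. -/
def mk (f : EuclideanSpace ℝ (Fin n) → ℝ) (h₁ : ContDiff ℝ (⊤ : ℕ∞) f)
    (h₂ : HasCompactSupport f) (h₃ : tsupport f ⊆ Ω) : TestSpace Ω := ⟨f, h₁, h₂, h₃⟩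

@[simp] lemma mk_apply (f : EuclideanSpace ℝ (Fin n) → ℝ) (h₁ h₂ h₃)
    (x : EuclideanSpace ℝ (Fin n)) : (mk f h₁ h₂ h₃ : TestSpace Ω) x = f x := rfl

@[simp] lemma add_apply (f g : TestSpace Ω) (x : EuclideanSpace ℝ (Fin n)) :
    (f + g) x = f x + g x := rfl

@[simp] lemma smul_apply (c : ℝ) (f : TestSpace Ω) (x : EuclideanSpace ℝ (Fin n)) :
    (c • f) x = c * f x := rfl

@[simp] lemma neg_apply (f : TestSpace Ω) (x : EuclideanSpace ℝ (Fin n)) : (-f) x = -f x := rfl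

@[simp] lemma zero_apply (x : EuclideanSpace ℝ (Fin n)) : (0 : TestSpace Ω) x = 0 := rfl

lemma sum_apply {ι : Type*} (s : Finset ι) (f : ι → TestSpace Ω)
    (x : EuclideanSpace ℝ (Fin n)) : (∑ i ∈ s, f i) x = ∑ i ∈ s, f i x := by
  simp [map_sum]

lemma differentiable (f : TestSpace Ω) : Differentiable ℝ f :=
  f.contDiff.differentiable (by simp)

lemma integrable_mul (f g : TestSpace Ω) : Integrable fun x => f x * g x :=
  (f.contDiff.continuous.mul g.contDiff.continuous).integrable_of_hasCompactSupport
    f.hasCompactSupport.mul_right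

/-- The `L²` inner product on the test space. -/
noncomputable abbrev innerCore : InnerProductSpace.Core ℝ (TestSpace Ω) where
  inner f g := ∫ x, f x * g x
  conj_inner_symm f g := by simp [mul_comm]
  re_inner_nonneg f := integral_nonneg fun x => mul_self_nonneg _
  add_left f g h := by
    simp only [add_apply, add_mul]
    exact integral_add (f.integrable_mul h) (g.integrable_mul h)
  smul_left f g c := by
    simp only [smul_apply, mul_assoc, conj_trivial]
    exact integral_const_mul _ _
  definite f hf := by
    have hc : Continuous fun x => f x * f x := f.contDiff.continuous.mul f.contDiff.continuous
    have h := (Continuous.ae_eq_iff_eq volume hc continuous_zero).1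
      ((integral_eq_zero_iff_of_nonneg (fun x => mul_self_nonneg _) (f.integrable_mul f)).1 hf)
    ext x
    simpa using congrFun h x

noncomputable instance instNormedAddCommGroup : NormedAddCommGroup (TestSpace Ω) :=
  innerCore.toNormedAddCommGroup

noncomputable instance instInnerProductSpace : InnerProductSpace ℝ (TestSpace Ω) :=
  InnerProductSpace.ofCore innerCore.toCore

lemma inner_def (f g : TestSpace Ω) : inner ℝ f g = ∫ x, f x * g x := rfl

/-- The partial derivative in direction `α`. -/
noncomputable def partialDeriv (α : Fin n) : Module.End ℝ (TestSpace Ω) where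
  toFun f := mk (fun x => fderiv ℝ f x (EuclideanSpace.single α 1))
    ((f.contDiff.fderiv_right (m := (⊤ : ℕ∞)) (by simp)).clm_apply contDiff_const)
    (f.hasCompactSupport.fderiv_apply ℝ _)
    ((tsupport_fderiv_apply_subset ℝ _).trans f.tsupport_subset)
  map_add' f g := by
    ext x
    have : (⇑(f + g) : EuclideanSpace ℝ (Fin n) → ℝ) = ⇑f + ⇑g := rfl
    simp [this, fderiv_add (f.differentiable x) (g.differentiable x)]
  map_smul' c f := by
    ext x
    have : (⇑(c • f) : EuclideanSpace ℝ (Fin n) → ℝ) = c • ⇑f := rfl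
    simp [this, fderiv_const_smul (f.differentiable x)]

lemma partialDeriv_apply (α : Fin n) (f : TestSpace Ω) (x : EuclideanSpace ℝ (Fin n)) :
    partialDeriv α f x = fderiv ℝ f x (EuclideanSpace.single α 1) := rfl

/-- Multiplication by the coordinate `α`. -/
noncomputable def mulCoord (α : Fin n) : Module.End ℝ (TestSpace Ω) where
  toFun f := mk (fun x => x α * f x)
    ((EuclideanSpace.proj (𝕜 := ℝ) α).contDiff.mul f.contDiff)
    f.hasCompactSupport.mul_left
    ((tsupport_mul_subset_right (f := fun x : EuclideanSpace ℝ (Fin n) => x α)).trans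
      f.tsupport_subset)
  map_add' f g := by
    ext x
    exact mul_add _ _ _
  map_smul' c f := by
    ext x
    exact mul_left_comm _ _ _

lemma mulCoord_apply (α : Fin n) (f : TestSpace Ω) (x : EuclideanSpace ℝ (Fin n)) :
    mulCoord α f x = x α * f x := rfl

lemma partialDeriv_skew (α : Fin n) (f g : TestSpace Ω) :
    inner ℝ (partialDeriv α f) g = -inner ℝ f (partialDeriv α g) := by
  have := integral_mul_fderiv_eq_neg_fderiv_mul_of_integrable (μ := volume)
    (v := EuclideanSpace.single α (1 : ℝ)) ((partialDeriv α f).integrable_mul g)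
    (f.integrable_mul (partialDeriv α g)) (f.integrable_mul g)
    (fun x _ => f.differentiable x) (fun x _ => g.differentiable x)
  simp only [inner_def, partialDeriv_apply]
  rw [this, neg_neg]

lemma partialDeriv_comm (α β : Fin n) (f : TestSpace Ω) :
    partialDeriv α (partialDeriv β f) = partialDeriv β (partialDeriv α f) := by
  have key : ∀ (γ δ : Fin n) (x : EuclideanSpace ℝ (Fin n)),
      partialDeriv γ (partialDeriv δ f) x =
        fderiv ℝ (fderiv ℝ f) x (EuclideanSpace.single γ 1) (EuclideanSpace.single δ 1) := by
    intro γ δ x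
    have hd : DifferentiableAt ℝ (fderiv ℝ f) x :=
      (f.contDiff.fderiv_right (m := (⊤ : ℕ∞)) (by simp)).differentiable (by simp) x
    have : (⇑(partialDeriv δ f) : EuclideanSpace ℝ (Fin n) → ℝ) =
        fun y => fderiv ℝ f y (EuclideanSpace.single δ 1) := rfl
    rw [partialDeriv_apply, this, fderiv_clm_apply hd (differentiableAt_const _)]
    simp
  ext x
  rw [key, key]
  exact (f.contDiff.contDiffAt.isSymmSndFDerivAt (by
    rw [minSmoothness_of_isRCLikeNormedField]
    exact WithTop.coe_le_coe.2 (le_top : (2 : ℕ∞) ≤ ⊤))) _ _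

lemma partialDeriv_mulCoord (α β : Fin n) (f : TestSpace Ω) :
    partialDeriv α (mulCoord β f) = mulCoord β (partialDeriv α f) + if α = β then f else 0 := by
  ext x
  have : (⇑(mulCoord β f) : EuclideanSpace ℝ (Fin n) → ℝ) =
      fun y => EuclideanSpace.proj (𝕜 := ℝ) β y * f y := rfl
  rw [partialDeriv_apply, this,
    fderiv_fun_mul (EuclideanSpace.proj (𝕜 := ℝ) β).differentiableAt (f.differentiable x)]
  simp only [ContinuousLinearMap.fderiv]
  split_ifs with h
  · simp [mulCoord_apply, partialDeriv_apply, h]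
  · simp [mulCoord_apply, partialDeriv_apply, Ne.symm h]

lemma norm_mulCoord_le {R : ℝ} (hR : 0 ≤ R) (hΩ : Ω ⊆ Metric.closedBall 0 R) (α : Fin n)
    (f : TestSpace Ω) : ‖mulCoord α f‖ ≤ R * ‖f‖ := by
  refine abs_le_of_sq_le_sq' ?_ (by positivity) |>.2
  rw [mul_pow, ← real_inner_self_eq_norm_sq, ← real_inner_self_eq_norm_sq, inner_def, inner_def,
    ← integral_const_mul]
  refine integral_mono ((mulCoord α f).integrable_mul _) ((f.integrable_mul f).const_mul _) ?_
  intro x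
  simp only [mulCoord_apply]
  by_cases hx : f x = 0
  · simp [hx]
  have hx' : ‖x‖ ≤ R := by
    simpa using hΩ (f.tsupport_subset (subset_tsupport _ (Function.mem_support.2 hx)))
  have h1 : |x α| ≤ R := (PiLp.norm_apply_le x α).trans hx'
  have h2 : x α ^ 2 ≤ R ^ 2 := sq_le_sq' (by linarith [abs_le.1 h1]) (abs_le.1 h1).2
  nlinarith [mul_le_mul_of_nonneg_right h2 (mul_self_nonneg (f x))]

/-- Partial derivatives and coordinate multiplications on the test functions of a bounded set. -/
noncomputable def weylRep {R : ℝ} (hR : 0 ≤ R) (hΩ : Ω ⊆ Metric.closedBall 0 R) :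
    WeylRep n (TestSpace Ω) where
  d := partialDeriv
  x := mulCoord
  R := R
  R_nonneg := hR
  d_skew := partialDeriv_skew
  x_symm α f g := by simp [inner_def, mulCoord_apply, mul_assoc, mul_left_comm]
  d_comm := partialDeriv_comm
  d_x := partialDeriv_mulCoord
  x_bound := norm_mulCoord_le hR hΩ

variable {R : ℝ} (hR : 0 ≤ R) (hΩ : Ω ⊆ Metric.closedBall 0 R)

lemma coe_B_pow (s : ℕ) (f : TestSpace Ω) :
    (⇑(((weylRep hR hΩ).B ^ s) f) : EuclideanSpace ℝ (Fin n) → ℝ) = negLap^[s] f := by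
  induction s with
  | zero => rfl
  | succ s ih =>
    rw [WeylRep.B_pow_succ, Function.iterate_succ_apply', ← ih, WeylRep.B_apply]
    ext x
    rw [neg_apply, sum_apply]
    rfl

lemma Q_eq_integral (s : ℕ) (f : TestSpace Ω) :
    (weylRep hR hΩ).Q s f f = ∫ x, f x * (negLap^[s] f) x := by
  rw [WeylRep.Q, inner_def, coe_B_pow]
  simp only [mul_comm]

lemma Q_one_eq_integral (f : TestSpace Ω) :
    (weylRep hR hΩ).Q 1 f f = ∫ x, ‖gradient f x‖ ^ 2 := by
  rw [WeylRep.Q_one]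
  simp only [inner_def]
  rw [← integral_finsetSum _ fun α _ => integrable_mul _ _]
  congr 1
  ext x
  rw [EuclideanSpace.norm_sq_eq]
  refine Finset.sum_congr rfl fun α _ => ?_
  have : gradient f x α = fderiv ℝ f x (EuclideanSpace.single α 1) := by
    have := EuclideanSpace.inner_single_right α (1 : ℝ) (gradient f x)
    rw [inner_gradient_left] at this
    simpa using this.symm
  rw [this, Real.norm_eq_abs, sq_abs, sq]
  rfl

end TestSpace

namespace WeylRep

variable {n : ℕ} {T : Type*} [NormedAddCommGroup T] [InnerProductSpace ℝ T]

lemma not_finite [NeZero n] [Nontrivial T] (W : WeylRep n T) : ¬ Module.Finite ℝ T := by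
  intro h
  have h1 : W.d 0 * W.x 0 - W.x 0 * W.d 0 = 1 := by
    ext f
    simp [W.d_x]
  have h2 := congrArg (LinearMap.trace ℝ T) h1
  rw [map_sub, LinearMap.trace_mul_comm, sub_self, LinearMap.trace_one] at h2
  have : 0 < Module.finrank ℝ T := Module.finrank_pos
  have h3 : (Module.finrank ℝ T : ℝ) = 0 := h2.symm
  norm_cast at h3
  omega

lemma exists_finrank_eq [NeZero n] [Nontrivial T] (W : WeylRep n T) (k : ℕ) :
    ∃ V : Submodule ℝ T, Module.finrank ℝ V = k := by
  have h : (k : Cardinal) ≤ Module.rank ℝ T := by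
    refine (Cardinal.natCast_lt_aleph0.le).trans ?_
    by_contra h'
    exact W.not_finite (Module.rank_lt_aleph0_iff.1 (not_le.1 h'))
  obtain ⟨s, hs, hli⟩ := exists_finset_linearIndependent_of_le_rank h
  refine ⟨Submodule.span ℝ (s : Set T), ?_⟩
  rw [finrank_span_finset_eq_card hli, hs]

lemma Q_one_pos [NeZero n] (W : WeylRep n T) {f : T} (hf : f ≠ 0) : 0 < W.Q 1 f f := by
  have h1 := W.Q_zero_le f
  rw [Q_zero] at h1
  have h2 : 0 < inner ℝ f f := real_inner_self_pos.2 hf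
  have h3 := W.Q_self_nonneg 1 f
  rcases h3.lt_or_eq with h | h
  · exact h
  · rw [← h] at h1
    linarith

lemma exists_Q_le [NeZero n] (W : WeylRep n T) (m : ℕ) (V : Submodule ℝ T) [FiniteDimensional ℝ V] :
    ∃ c, ∀ f ∈ V, W.Q m f f ≤ c * W.Q 1 f f := by
  set A : V →L[ℝ] T := LinearMap.toContinuousLinearMap ((W.B ^ m) ∘ₗ V.subtype) with hA
  refine ⟨‖A‖ * (4 * W.R ^ 2), fun f hf => ?_⟩
  have h1 := A.le_opNorm ⟨f, hf⟩
  have h2 : W.Q m f f ≤ ‖A ⟨f, hf⟩‖ * ‖f‖ := real_inner_le_norm _ _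
  have h3 := W.Q_zero_le f
  rw [Q_zero, real_inner_self_eq_norm_sq] at h3
  have h4 : ‖(⟨f, hf⟩ : V)‖ = ‖f‖ := rfl
  rw [h4] at h1
  calc W.Q m f f ≤ ‖A‖ * ‖f‖ * ‖f‖ :=
        h2.trans (mul_le_mul_of_nonneg_right h1 (norm_nonneg _))
    _ = ‖A‖ * ‖f‖ ^ 2 := by ring
    _ ≤ ‖A‖ * (4 * W.R ^ 2 * W.Q 1 f f) := mul_le_mul_of_nonneg_left h3 (norm_nonneg A)
    _ = _ := by ring

end WeylRep

namespace TestSpace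

variable {n : ℕ} {Ω : Set (EuclideanSpace ℝ (Fin n))}

lemma nontrivial (hΩo : IsOpen Ω) (hΩ : Ω.Nonempty) : Nontrivial (TestSpace Ω) := by
  obtain ⟨x, hx⟩ := hΩ
  obtain ⟨f, h1, h2, h3, -, h5⟩ :=
    exists_contDiff_tsupport_subset (n := ⊤) (hΩo.mem_nhds hx)
  refine ⟨mk f h3 h2 h1, 0, fun h => ?_⟩
  have := congrArg (fun g : TestSpace Ω => g x) h
  simp [h5] at this

variable {R : ℝ} (hR : 0 ≤ R) (hΩ : Ω ⊆ Metric.closedBall 0 R)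

lemma finrank_map_incl (V : Submodule ℝ (TestSpace Ω)) :
    Module.finrank ℝ (V.map incl) = Module.finrank ℝ V :=
  (LinearEquiv.finrank_eq (Submodule.equivMapOfInjective incl incl_injective V)).symm

lemma isMinMax [NeZero n] (m : ℕ) (hΩo : IsOpen Ω) (hne : Ω.Nonempty) :
    (weylRep hR hΩ).IsMinMax m (bucklingEigenvalue n (m + 1) Ω) := by
  set W := weylRep hR hΩ
  have := nontrivial hΩo hne
  have hq : ∀ φ : TestSpace Ω,
      (∫ x, φ x * (negLap^[m + 1] φ) x) / (∫ x, ‖gradient φ x‖ ^ 2) =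
        W.Q (m + 1) φ φ / W.Q 1 φ φ := fun φ => by
    rw [← Q_eq_integral hR hΩ, ← Q_one_eq_integral hR hΩ]
  have hmem : ∀ V : Submodule ℝ (TestSpace Ω), ∀ f ∈ V.map incl,
      ContDiff ℝ (⊤ : ℕ∞) f ∧ HasCompactSupport f ∧ tsupport f ⊆ Ω := by
    rintro V - ⟨f, -, rfl⟩
    exact ⟨f.contDiff, f.hasCompactSupport, f.tsupport_subset⟩
  constructor
  · intro k hk V r hV hr
    rw [bucklingEigenvalue]
    refine (csInf_le ?_
      (by exact ⟨V.map incl, by rw [finrank_map_incl, hV], hmem V, rfl⟩)).trans ?_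
    · refine ⟨0, ?_⟩
      rintro - ⟨V', -, hV', rfl⟩
      refine Real.sSup_nonneg ?_
      rintro - ⟨φ, hφ, -, rfl⟩
      obtain ⟨h1, h2, h3⟩ := hV' φ hφ
      have := hq (mk φ h1 h2 h3)
      exact this.symm ▸ div_nonneg (W.Q_self_nonneg _ _) (W.Q_self_nonneg _ _)
    · have hpos : V ≠ ⊥ := by
        rintro rfl
        simp at hV
        omega
      obtain ⟨φ, hφ, hφ0⟩ := V.exists_mem_ne_zero_of_ne_bot hpos
      refine csSup_le ⟨_, incl φ, Submodule.mem_map_of_mem hφ,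
        fun h => hφ0 (incl_injective (h.trans (map_zero incl).symm)), rfl⟩ ?_
      rintro - ⟨-, ⟨ψ, hψ, rfl⟩, hψ0, rfl⟩
      rw [hq, div_le_iff₀ (W.Q_one_pos fun h => hψ0 (by rw [h, map_zero]))]
      exact hr ψ hψ
  · intro k hk r hr
    rw [bucklingEigenvalue] at hr
    obtain ⟨V₀, hV₀⟩ := W.exists_finrank_eq k
    obtain ⟨-, ⟨V, hV, hV', rfl⟩, hlt⟩ := exists_lt_of_csInf_lt
      (by exact ⟨_, V₀.map incl, by rw [finrank_map_incl, hV₀], hmem V₀, rfl⟩) hr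
    have hmap : (V.comap (incl (Ω := Ω))).map incl = V := by
      refine Submodule.map_comap_eq_of_le ?_
      intro f hf
      obtain ⟨h1, h2, h3⟩ := hV' f hf
      exact ⟨mk f h1 h2 h3, rfl⟩
    have hfin : Module.finrank ℝ (V.comap (incl (Ω := Ω))) = k := by
      rw [← finrank_map_incl, hmap, hV]
    refine ⟨V.comap incl, hfin, fun φ hφ => ?_⟩
    have : FiniteDimensional ℝ (V.comap (incl (Ω := Ω))) :=
      FiniteDimensional.of_finrank_pos (by omega)
    obtain ⟨c, hc⟩ := W.exists_Q_le (m + 1) (V.comap (incl (Ω := Ω)))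
    rcases eq_or_ne φ 0 with rfl | hφ0
    · simp [WeylRep.Q]
    rw [← div_le_iff₀ (W.Q_one_pos hφ0), ← hq]
    refine le_trans (le_csSup ⟨c, ?_⟩ (by exact ⟨incl φ, hφ,
      fun h => hφ0 (incl_injective (h.trans (map_zero incl).symm)), rfl⟩)) hlt.le
    rintro - ⟨ψ, hψ, hψ0, rfl⟩
    obtain ⟨h1, h2, h3⟩ := hV' ψ hψ
    have h0 : (mk ψ h1 h2 h3 : TestSpace Ω) ≠ 0 := fun h => hψ0 (congrArg incl h)
    refine (hq (mk ψ h1 h2 h3)).trans_le ?_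
    rw [div_le_iff₀ (W.Q_one_pos h0)]
    exact hc _ hψ

end TestSpace

theorem buckling_explicit_bound_two (n l : ℕ) (hn : 2 ≤ n) (hl : 2 ≤ l)
    (Ω : Set (EuclideanSpace ℝ (Fin n))) (hΩo : IsOpen Ω) (hΩc : IsConnected Ω)
    (hΩb : Bornology.IsBounded Ω)
    (Λ : ℕ → ℝ) (hΛ : ∀ m, Λ m = bucklingEigenvalue n l Ω m)
    (C : ℝ) (hC : C = 2 * (l : ℝ) ^ 2 + ((n : ℝ) - 4) * l + 2 - n)
    (k : ℕ) (hk : 1 ≤ k) :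
    Λ (k + 1) ≤
      (1 + 2 * C / (n : ℝ) ^ 2) * ((1 / k) * ∑ i ∈ Finset.Icc 1 k, Λ i) +
      Real.sqrt
        (((2 * C / (n : ℝ) ^ 2) * ((1 / k) * ∑ i ∈ Finset.Icc 1 k, Λ i)) ^ 2 -
          (1 + 4 * C / (n : ℝ) ^ 2) *
            ((1 / k) * ∑ i ∈ Finset.Icc 1 k,
              (Λ i - (1 / k) * ∑ j ∈ Finset.Icc 1 k, Λ j) ^ 2)) := by
  obtain ⟨m, rfl⟩ : ∃ m, l = m + 1 := ⟨l - 1, by omega⟩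
  obtain rfl : Λ = bucklingEigenvalue n (m + 1) Ω := funext hΛ
  obtain ⟨R, hR⟩ := hΩb.subset_closedBall 0
  have : NeZero n := ⟨by omega⟩
  have hR' : Ω ⊆ Metric.closedBall 0 (max R 0) :=
    hR.trans (Metric.closedBall_subset_closedBall (le_max_left _ _))
  have h := (TestSpace.isMinMax (le_max_right R 0) hR' m hΩo hΩc.nonempty).sq_sum_le hn
    (by omega) k
  have hC' : 4 * m * (2 * m + n) / (n : ℝ) ^ 2 = 4 * C / n ^ 2 := by
    rw [hC]
    push_cast
    ring
  rw [hC'] at h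
  have key := le_add_sqrt_of_sq_sum_le hk h
  have h2 : 4 * C / (n : ℝ) ^ 2 / 2 = 2 * C / n ^ 2 := by ring
  rwa [h2] at key
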